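/- arXiv:1903.03549 — 2 statements merged into one kernel-verified Lean document; each statement's English description precedes it below -/
import Mathlib

section
/- Let A_n denote the alternating group on n letters and consider the poset A_2(A_n) of nontrivial elementary abelian 2-subgroups. Then: A_2(A_n) is simply connected for n = 4 and for all n ≥ 8; π1(A_2(A_6)) is a free group of rank 16; π1(A_2(A_7)) is a free group of rank 176; and every connected component of the geometric realization of K(A_2(A_5)) is simply connected. -/
open Function

/-- The geometric realization of the order complex of the subposet `S` of `X`,
realized as a subspace of `X → ℝ`: convex combinations supported on finite
nonempty chains contained in `S`. -/
def geomRealOn {X : Type*} [Preorder X] (S : Set X) : Set (X → ℝ) :=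
  {f | (∀ x, 0 ≤ f x) ∧ Function.support f ⊆ S ∧ IsChain (· ≤ ·) (Function.support f) ∧
    ∃ s : Finset X, Function.support f ⊆ ↑s ∧ ∑ x ∈ s, f x = 1}

/-- A group is elementary abelian for the prime `p` if it is abelian and
every element has order dividing `p`. -/
def IsElementaryAbelian (p : ℕ) (G : Type*) [Group G] : Prop :=
  (∀ a b : G, a * b = b * a) ∧ ∀ a : G, a ^ p = 1

/-- The Quillen poset `A_p(G)`: nontrivial elementary abelian `p`-subgroups of `G`. -/
def apSet (p : ℕ) (G : Type*) [Group G] : Set (Subgroup G) :=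
  {H | H ≠ ⊥ ∧ IsElementaryAbelian p ↥H}

open scoped unitInterval
open Path.Homotopic (Quotient)

/-! ### Paths subordinate to an open cover -/

/-- A property of homotopy classes of paths which is stable under concatenation and holds for paths
inside the members of an open cover holds for all paths. -/
theorem Path.Homotopic.Quotient.cover_induction {X ι : Type*} [TopologicalSpace X] {c : ι → Set X}
    (ho : ∀ i, IsOpen (c i)) (hc : ∀ x, ∃ i, x ∈ c i)
    {W : ∀ x y : X, Path.Homotopic.Quotient x y → Prop}
    (htrans : ∀ x y z (p : Path.Homotopic.Quotient x y) (q : Path.Homotopic.Quotient y z),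
      W x y p → W y z q → W x z (p.trans q))
    (hloc : ∀ i x y (p : Path x y), (∀ t, p t ∈ c i) → W x y (.mk p))
    {x y : X} (p : Path.Homotopic.Quotient x y) : W x y p := by
  induction p using Path.Homotopic.Quotient.ind with | mk γ =>
  obtain ⟨t, t0, tmono, ⟨n, hn⟩, ht⟩ := exists_monotone_Icc_subset_open_cover_unitInterval
    (c := fun i => γ ⁻¹' c i) (fun i => (ho i).preimage γ.continuous)
    (fun s _ => by simpa using hc (γ s))
  have key : ∀ m, W (γ (t 0)) (γ (t m)) (.mk (γ.subpath (t 0) (t m))) := by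
    intro m
    induction m with
    | zero =>
      obtain ⟨i, hi⟩ := ht 0
      refine hloc i _ _ _ fun s => ?_
      have : γ.subpath (t 0) (t 0) s ∈ Set.range (γ.subpath (t 0) (t 0)) := ⟨s, rfl⟩
      rw [Path.range_subpath_of_le _ _ _ le_rfl] at this
      obtain ⟨r, hr, hr'⟩ := this
      rw [← hr']
      exact hi ⟨hr.1, hr.2.trans (tmono (Nat.zero_le _))⟩
    | succ m ih =>
      have h1 : W (γ (t m)) (γ (t (m + 1))) (.mk (γ.subpath (t m) (t (m + 1)))) := by
        obtain ⟨i, hi⟩ := ht m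
        refine hloc i _ _ _ fun s => ?_
        have : γ.subpath (t m) (t (m + 1)) s ∈ Set.range (γ.subpath (t m) (t (m + 1))) := ⟨s, rfl⟩
        rw [Path.range_subpath_of_le _ _ _ (tmono (Nat.le_succ m))] at this
        obtain ⟨r, hr, hr'⟩ := this
        rw [← hr']
        exact hi hr
      have h2 := htrans _ _ _ _ _ ih h1
      rwa [← Path.Homotopic.Quotient.mk_trans,
        Path.Homotopic.Quotient.eq.2 ⟨Path.Homotopy.subpathTransSubpath γ _ _ _⟩] at h2
  have h := key n
  rw [t0, hn n le_rfl] at h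
  have e : ∀ (a b : X) (q : Path a b) (ha : x = a) (hb : y = b), W a b (.mk q) →
      W x y (.mk (q.cast ha hb)) := by
    rintro _ _ q rfl rfl hq
    exact hq
  have := e _ _ _ γ.source.symm γ.target.symm h
  have h0 : (γ.subpath 0 1).cast γ.source.symm γ.target.symm = γ := by
    rw [Path.subpath_zero_one]
    rfl
  rwa [h0] at this

theorem Path.Homotopic.Quotient.symm_trans_cancel {Y : Type*} [TopologicalSpace Y] {x y z : Y}
    (p : Path.Homotopic.Quotient x y) (q : Path.Homotopic.Quotient x z) :
    p.trans (p.symm.trans q) = q := by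
  rw [← trans_assoc, trans_symm, refl_trans]

theorem Path.Homotopic.Quotient.trans_symm_rev {Y : Type*} [TopologicalSpace Y] {x y z : Y}
    (p : Path.Homotopic.Quotient x y) (q : Path.Homotopic.Quotient y z) :
    (p.trans q).symm = q.symm.trans p.symm := by
  calc (p.trans q).symm = (p.trans q).symm.trans (p.trans (q.trans (q.symm.trans p.symm))) := by
        rw [symm_trans_cancel, trans_symm, trans_refl]
    _ = ((p.trans q).symm.trans (p.trans q)).trans (q.symm.trans p.symm) := by
        simp only [trans_assoc]
    _ = q.symm.trans p.symm := by rw [symm_trans, refl_trans]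

theorem Path.Homotopic.Quotient.trans_trans_symm_conj {Y : Type*} [TopologicalSpace Y]
    {u x y v w : Y}
    (a : Path.Homotopic.Quotient u v) (c : Path.Homotopic.Quotient v x)
    (b : Path.Homotopic.Quotient u w) (d : Path.Homotopic.Quotient w y) :
    (c.trans ((a.trans c).symm.trans (b.trans d))).trans d.symm = a.symm.trans b := by
  rw [trans_symm_rev]
  simp only [trans_assoc, trans_symm, trans_refl, symm_trans_cancel]

theorem Path.Homotopic.Quotient.symm_refl {Y : Type*} [TopologicalSpace Y] (x : Y) :
    (refl x).symm = refl x := by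
  rw [← mk_refl, ← mk_symm, Path.refl_symm]

theorem Path.Homotopic.Quotient.symm_symm {Y : Type*} [TopologicalSpace Y] {x y : Y}
    (p : Path.Homotopic.Quotient x y) : p.symm.symm = p := by
  calc p.symm.symm = p.trans (p.symm.trans p.symm.symm) := (symm_trans_cancel _ _).symm
    _ = p := by rw [trans_symm, trans_refl]

theorem Path.Homotopic.Quotient.trans_symm_cancel {Y : Type*} [TopologicalSpace Y] {x y z : Y}
    (p : Path.Homotopic.Quotient y x) (q : Path.Homotopic.Quotient x z) :
    p.symm.trans (p.trans q) = q := by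
  rw [← trans_assoc, symm_trans, refl_trans]

/-! ### Stars and segments in the realization of an order complex -/

section Realization

variable {X : Type*} [PartialOrder X] {S : Set X}

theorem geomRealOn.combo_mem {f g : X → ℝ} (hf : f ∈ geomRealOn S) (hg : g ∈ geomRealOn S)
    (h : IsChain (· ≤ ·) (support f ∪ support g)) {a b : ℝ} (ha : 0 ≤ a) (hb : 0 ≤ b)
    (hab : a + b = 1) : a • f + b • g ∈ geomRealOn S := by
  classical
  obtain ⟨hf0, hfS, -, s, hs, hs1⟩ := hf
  obtain ⟨hg0, hgS, -, t, ht, ht1⟩ := hg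
  have hsub : support (a • f + b • g) ⊆ support f ∪ support g := by
    intro x hx
    by_contra hx'
    simp only [Set.mem_union, mem_support, not_or, not_not] at hx'
    simp [hx'.1, hx'.2] at hx
  refine ⟨fun x => ?_, hsub.trans (Set.union_subset hfS hgS), h.mono hsub, s ∪ t, ?_, ?_⟩
  · have := hf0 x; have := hg0 x
    simp only [Pi.add_apply, Pi.smul_apply, smul_eq_mul]; positivity
  · exact hsub.trans (by rw [Finset.coe_union]; exact Set.union_subset_union hs ht)
  · have e1 : ∑ x ∈ s ∪ t, f x = 1 := by
      rw [← hs1]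
      refine (Finset.sum_subset Finset.subset_union_left fun x _ hx => ?_).symm
      by_contra h'
      exact hx (hs h')
    have e2 : ∑ x ∈ s ∪ t, g x = 1 := by
      rw [← ht1]
      refine (Finset.sum_subset Finset.subset_union_right fun x _ hx => ?_).symm
      by_contra h'
      exact hx (ht h')
    simp only [Pi.add_apply, Pi.smul_apply, smul_eq_mul, Finset.sum_add_distrib,
      ← Finset.mul_sum, e1, e2, mul_one, hab]

theorem geomRealOn.exists_ne_zero {f : X → ℝ} (hf : f ∈ geomRealOn S) : ∃ x, f x ≠ 0 := by
  obtain ⟨-, -, -, s, -, hs⟩ := hf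
  by_contra! h
  simp [h] at hs

/-- The vertex of the realization given by an element of `S`. -/
noncomputable def realVertex (v : S) : geomRealOn S := by
  classical
  exact ⟨Pi.single v.1 1, fun x => by by_cases h : x = v.1 <;> simp [h],
    by simp, by simp [Set.subsingleton_singleton.isChain], {v.1}, by simp, by simp⟩

theorem realVertex_apply_ne {v : S} {x : X} : (realVertex v).1 x ≠ 0 ↔ x = v.1 := by
  classical
  simp [realVertex, Pi.single_apply]

theorem support_realVertex (v : S) : support (realVertex v).1 = {v.1} := by
  ext x
  simpa using realVertex_apply_ne

/-- The closed star of a vertex. -/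
def closedStar (v : S) : Set (geomRealOn S) :=
  {f | ∀ x, f.1 x ≠ 0 → x ≤ v.1 ∨ v.1 ≤ x}

/-- The open star of a vertex. -/
def openStar (v : S) : Set (geomRealOn S) := {f | f.1 v.1 ≠ 0}

theorem isOpen_openStar (v : S) : IsOpen (openStar v) :=
  isOpen_ne.preimage ((continuous_apply v.1).comp continuous_subtype_val)

theorem openStar_subset_closedStar (v : S) : openStar v ⊆ closedStar v :=
  fun f hf _ hx => f.2.2.2.1.total hx hf

theorem exists_mem_openStar (f : geomRealOn S) : ∃ v : S, f ∈ openStar v := by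
  obtain ⟨x, hx⟩ := geomRealOn.exists_ne_zero f.2
  exact ⟨⟨x, f.2.2.1 hx⟩, hx⟩

theorem isChain_union_realVertex {v : S} {f : geomRealOn S} (hf : f ∈ closedStar v) :
    IsChain (· ≤ ·) (support f.1 ∪ support (realVertex v).1) := by
  rw [support_realVertex, Set.union_singleton]
  exact f.2.2.2.1.insert fun x hx _ => (hf x hx).symm

theorem isSimplyConnected_closedStar (v : S) : IsSimplyConnected (closedStar v) := by
  rw [← Topology.IsEmbedding.subtypeVal.isSimplyConnected_image]
  have hv : realVertex v ∈ closedStar v := fun x hx => by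
    rw [realVertex_apply_ne] at hx; simp [hx]
  have hs : StarConvex ℝ (realVertex v).1 (Subtype.val '' closedStar v) := by
    rintro _ ⟨f, hf, rfl⟩ a b ha hb hab
    have hc := isChain_union_realVertex hf
    rw [Set.union_comm] at hc
    refine ⟨⟨_, geomRealOn.combo_mem (realVertex v).2 f.2 hc ha hb hab⟩, fun x hx => ?_, rfl⟩
    by_cases h : x = v.1
    · simp [h]
    · have h' : (realVertex v).1 x = 0 := by
        by_contra h'; exact h (realVertex_apply_ne.1 h')
      refine hf x fun h0 => hx ?_
      simp [h0, h']
  have := hs.contractibleSpace ⟨_, _, hv, rfl⟩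
  exact inferInstanceAs (SimplyConnectedSpace _)

theorem Path.homotopic_of_mem_isSimplyConnected {Y : Type*} [TopologicalSpace Y] {s : Set Y}
    (hs : IsSimplyConnected s) {x y : Y} (p q : Path x y) (hp : ∀ t, p t ∈ s) (hq : ∀ t, q t ∈ s) :
    p.Homotopic q := by
  have := hs.simplyConnectedSpace
  have hx : x ∈ s := by simpa using hp 0
  have hy : y ∈ s := by simpa using hp 1
  let lift (r : Path x y) (hr : ∀ t, r t ∈ s) : Path (⟨x, hx⟩ : s) ⟨y, hy⟩ :=
    { toFun := fun t => ⟨r t, hr t⟩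
      continuous_toFun := by fun_prop
      source' := by simp
      target' := by simp }
  exact (SimplyConnectedSpace.paths_homotopic (lift p hp) (lift q hq)).map
    ⟨Subtype.val, continuous_subtype_val⟩

/-- Two points of the realization which lie in a common simplex. -/
def Cofacial (f g : geomRealOn S) : Prop := IsChain (· ≤ ·) (support f.1 ∪ support g.1)

theorem Cofacial.symm {f g : geomRealOn S} (h : Cofacial f g) : Cofacial g f := by
  rwa [Cofacial, Set.union_comm]

/-- The straight path between two points of a common simplex. -/
def segPath {f g : geomRealOn S} (h : Cofacial f g) : Path f g where
  toFun t := ⟨(1 - t : ℝ) • f.1 + (t : ℝ) • g.1,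
    geomRealOn.combo_mem f.2 g.2 h (by linarith [t.2.2]) t.2.1 (by ring)⟩
  continuous_toFun := by fun_prop
  source' := by simp
  target' := by simp

/-- The homotopy class of the straight path. -/
def seg {f g : geomRealOn S} (h : Cofacial f g) : Path.Homotopic.Quotient f g := .mk (segPath h)

theorem segPath_apply_ne {f g : geomRealOn S} (h : Cofacial f g) {t : I} {x : X}
    (hx : (segPath h t).1 x ≠ 0) : f.1 x ≠ 0 ∨ g.1 x ≠ 0 := by
  by_contra! h0
  exact hx (by simp [segPath, h0.1, h0.2])

theorem segPath_mem_closedStar {v : S} {f g : geomRealOn S} (h : Cofacial f g)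
    (hf : f ∈ closedStar v) (hg : g ∈ closedStar v) (t : I) : segPath h t ∈ closedStar v :=
  fun x hx => (segPath_apply_ne h hx).elim (hf x) (hg x)

theorem seg_trans (v : S) {f g h : geomRealOn S} (hf : f ∈ closedStar v) (hg : g ∈ closedStar v)
    (hh : h ∈ closedStar v) (hfg : Cofacial f g) (hgh : Cofacial g h) (hfh : Cofacial f h) :
    (seg hfg).trans (seg hgh) = seg hfh := by
  rw [seg, seg, seg, ← Path.Homotopic.Quotient.mk_trans, Path.Homotopic.Quotient.eq]
  refine Path.homotopic_of_mem_isSimplyConnected (isSimplyConnected_closedStar v) _ _ (fun t => ?_)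
    (segPath_mem_closedStar hfh hf hh)
  have : ((segPath hfg).trans (segPath hgh)) t ∈
      Set.range ((segPath hfg).trans (segPath hgh)) := ⟨t, rfl⟩
  rw [Path.trans_range] at this
  rcases this with ⟨s, hs⟩ | ⟨s, hs⟩ <;> rw [← hs]
  exacts [segPath_mem_closedStar hfg hf hg s, segPath_mem_closedStar hgh hg hh s]

theorem seg_symm {f g : geomRealOn S} (h : Cofacial f g) : (seg h).symm = seg h.symm := by
  rw [seg, seg, ← Path.Homotopic.Quotient.mk_symm]
  congr 1
  ext t
  simp [segPath, add_comm]

theorem cofacial_self (f : geomRealOn S) : Cofacial f f := by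
  simpa [Cofacial] using f.2.2.2.1

theorem seg_self (f : geomRealOn S) : seg (cofacial_self f) = .refl f := by
  rw [seg, ← Path.Homotopic.Quotient.mk_refl]
  congr 1
  ext t
  simp only [segPath, ← add_smul]
  simp

/-- Comparability. -/
def Comp (x y : X) : Prop := x ≤ y ∨ y ≤ x

theorem Comp.symm {x y : X} (h : Comp x y) : Comp y x := Or.symm h

theorem realVertex_mem_closedStar {v w : S} (h : Comp v.1 w.1) : realVertex v ∈ closedStar w := by
  intro x hx
  rw [realVertex_apply_ne] at hx
  subst hx
  exact h

theorem Comp.cofacial {v w : S} (h : Comp v.1 w.1) : Cofacial (realVertex v) (realVertex w) :=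
  isChain_union_realVertex (realVertex_mem_closedStar h)

/-- The homotopy class of the edge between two comparable vertices. -/
noncomputable def edge {v w : S} (h : Comp v.1 w.1) :
    Path.Homotopic.Quotient (realVertex v) (realVertex w) := seg h.cofacial

theorem edge_trans {u v w : S} (huv : Comp u.1 v.1) (hvw : Comp v.1 w.1) (huw : Comp u.1 w.1) :
    (edge huv).trans (edge hvw) = edge huw :=
  seg_trans v (realVertex_mem_closedStar huv) (realVertex_mem_closedStar (.inl le_rfl))
    (realVertex_mem_closedStar hvw.symm) _ _ _

theorem edge_symm {u v : S} (h : Comp u.1 v.1) : (edge h).symm = edge h.symm := seg_symm _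

theorem edge_self {u : S} (h : Comp u.1 u.1) : edge h = .refl _ := seg_self _

/-- A vertex of the carrier of a point. -/
noncomputable def carrierVertex (f : geomRealOn S) : S := (exists_mem_openStar f).choose

theorem mem_openStar_carrierVertex (f : geomRealOn S) : f ∈ openStar (carrierVertex f) :=
  (exists_mem_openStar f).choose_spec

theorem carrierVertex_realVertex (v : S) : carrierVertex (realVertex v) = v :=
  Subtype.ext (realVertex_apply_ne.1 (mem_openStar_carrierVertex (realVertex v)))

theorem cofacial_of_mem_openStar {v : S} {f : geomRealOn S} (hf : f ∈ openStar v) :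
    Cofacial (realVertex v) f :=
  Cofacial.symm (isChain_union_realVertex (openStar_subset_closedStar v hf))

theorem comp_of_mem_openStar {v w : S} {f : geomRealOn S} (hv : f ∈ openStar v)
    (hw : f ∈ openStar w) : Comp v.1 w.1 := f.2.2.2.1.total hv hw

/-- The straight path from the chosen carrier vertex of a point to that point. -/
noncomputable def toPoint (f : geomRealOn S) :
    Path.Homotopic.Quotient (realVertex (carrierVertex f)) f :=
  seg (cofacial_of_mem_openStar (mem_openStar_carrierVertex f))

theorem edge_trans_toPoint {v : S} {f : geomRealOn S} (hf : f ∈ openStar v) :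
    (edge (comp_of_mem_openStar hf (mem_openStar_carrierVertex f))).trans (toPoint f) =
      seg (cofacial_of_mem_openStar hf) :=
  seg_trans v (realVertex_mem_closedStar (.inl le_rfl))
    (realVertex_mem_closedStar (comp_of_mem_openStar (mem_openStar_carrierVertex f) hf))
    (openStar_subset_closedStar v hf) _ _ _

theorem mk_eq_of_mem_openStar {v : S} {f g : geomRealOn S} (p : Path f g)
    (hp : ∀ t, p t ∈ openStar v) (hf : f ∈ openStar v) (hg : g ∈ openStar v) :
    Path.Homotopic.Quotient.mk p =
      (seg (cofacial_of_mem_openStar hf)).symm.trans (seg (cofacial_of_mem_openStar hg)) := by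
  rw [seg, seg, ← Path.Homotopic.Quotient.mk_symm, ← Path.Homotopic.Quotient.mk_trans,
    Path.Homotopic.Quotient.eq]
  refine Path.homotopic_of_mem_isSimplyConnected (isSimplyConnected_closedStar v) _ _
    (fun t => openStar_subset_closedStar v (hp t)) (fun t => ?_)
  have hmem : ∀ {f : geomRealOn S} (hf : f ∈ openStar v) (s : I),
      segPath (cofacial_of_mem_openStar hf) s ∈ closedStar v := fun hf s =>
    segPath_mem_closedStar _ (realVertex_mem_closedStar (.inl le_rfl))
      (openStar_subset_closedStar v hf) s
  have : ((segPath (cofacial_of_mem_openStar hf)).symm.trans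
      (segPath (cofacial_of_mem_openStar hg))) t ∈ Set.range
      ((segPath (cofacial_of_mem_openStar hf)).symm.trans
        (segPath (cofacial_of_mem_openStar hg))) := ⟨t, rfl⟩
  rw [Path.trans_range, Path.symm_range] at this
  rcases this with ⟨s, hs⟩ | ⟨s, hs⟩ <;> rw [← hs]
  exacts [hmem hf s, hmem hg s]

/-- A property of homotopy classes of paths between vertices which is stable under concatenation
and holds for edges holds for all of them. -/
theorem edge_induction {W : ∀ v w : S, Path.Homotopic.Quotient (realVertex v) (realVertex w) → Prop}
    (htrans : ∀ u v w (p : Path.Homotopic.Quotient (realVertex u) (realVertex v))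
      (q : Path.Homotopic.Quotient (realVertex v) (realVertex w)),
      W u v p → W v w q → W u w (p.trans q))
    (hedge : ∀ (v w : S) (h : Comp v.1 w.1), W v w (edge h))
    {v w : S} (p : Path.Homotopic.Quotient (realVertex v) (realVertex w)) : W v w p := by
  have key : ∀ {f g : geomRealOn S} (p : Path.Homotopic.Quotient f g),
      W _ _ (((toPoint f).trans p).trans (toPoint g).symm) := by
    intro f g p
    refine Path.Homotopic.Quotient.cover_induction (isOpen_openStar (S := S)) exists_mem_openStar
      (W := fun f g p => W _ _ (((toPoint f).trans p).trans (toPoint g).symm)) ?_ ?_ p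
    · intro f g h p q hp hq
      have := htrans _ _ _ _ _ hp hq
      simp only [Path.Homotopic.Quotient.trans_assoc] at this ⊢
      rwa [← Path.Homotopic.Quotient.trans_assoc (toPoint g).symm,
        Path.Homotopic.Quotient.symm_trans, Path.Homotopic.Quotient.refl_trans] at this
    · intro v f g p hp
      have hf : f ∈ openStar v := by simpa using hp 0
      have hg : g ∈ openStar v := by simpa using hp 1
      have e : ((toPoint f).trans (.mk p)).trans (toPoint g).symm =
          (edge (comp_of_mem_openStar hf (mem_openStar_carrierVertex f))).symm.trans
            (edge (comp_of_mem_openStar hg (mem_openStar_carrierVertex g))) := by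
        rw [mk_eq_of_mem_openStar p hp hf hg, ← edge_trans_toPoint hf, ← edge_trans_toPoint hg]
        exact Path.Homotopic.Quotient.trans_trans_symm_conj _ _ _ _
      rw [e, edge_symm]
      exact htrans _ _ _ _ _ (hedge _ _ _) (hedge _ _ _)
  have h := key p
  have hc : ∀ v : S, HEq (toPoint (realVertex v))
      (Path.Homotopic.Quotient.refl (realVertex v)) := by
    intro v
    rw [← edge_self (u := v) (.inl le_rfl)]
    unfold toPoint edge
    congr! 1
    rw [carrierVertex_realVertex]
  have e : ∀ (a b : S) (c : Path.Homotopic.Quotient (realVertex a) (realVertex v))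
      (d : Path.Homotopic.Quotient (realVertex b) (realVertex w)), a = v → b = w →
      HEq c (Path.Homotopic.Quotient.refl (realVertex v)) →
      HEq d (Path.Homotopic.Quotient.refl (realVertex w)) →
      W a b ((c.trans p).trans d.symm) → W v w p := by
    rintro a b c d rfl rfl hc hd h
    rw [eq_of_heq hc, eq_of_heq hd, Path.Homotopic.Quotient.refl_trans] at h
    rwa [Path.Homotopic.Quotient.symm_refl, Path.Homotopic.Quotient.trans_refl] at h
  exact e _ _ _ _ (carrierVertex_realVertex v) (carrierVertex_realVertex w) (hc v) (hc w) h

end Realization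

/-! ### Cocycles on a set with a relation -/

section Cocycle

/-- The relation `r` connects the set `D`. -/
def ConnOn {α : Type*} (r : α → α → Prop) (D : Set α) : Prop :=
  ∀ x ∈ D, ∀ y ∈ D, Relation.ReflTransGen (fun a b => a ∈ D ∧ b ∈ D ∧ r a b) x y

/-- A group-valued `1`-cocycle on the flag complex of a relation. -/
def IsCocycle {α H : Type*} [Group H] (r : α → α → Prop) (D : Set α) (c : α → α → H) : Prop :=
  ∀ x ∈ D, ∀ y ∈ D, ∀ z ∈ D, r x y → r y z → r x z → c x y * c y z = c x z

/-- The cocycle `c` is a coboundary on `D`. -/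
def IsCobound {α H : Type*} [Group H] (r : α → α → Prop) (D : Set α) (c : α → α → H) : Prop :=
  ∃ d : α → H, ∀ x ∈ D, ∀ y ∈ D, r x y → d x * c x y = d y

end Cocycle

section SimplyConnected

universe u

variable {X : Type u} [PartialOrder X] {S : Set X}

theorem pathConnectedSpace_geomRealOn (hne : S.Nonempty) (hconn : ConnOn Comp S) :
    PathConnectedSpace (geomRealOn S) := by
  have hv : ∀ v w : S, Joined (realVertex v) (realVertex w) := by
    intro v w
    have : ∀ x, Relation.ReflTransGen (fun a b => a ∈ S ∧ b ∈ S ∧ Comp a b) v.1 x →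
        ∀ hx : x ∈ S, Joined (realVertex v) (realVertex ⟨x, hx⟩) := by
      intro x h
      induction h with
      | refl => exact fun _ => Joined.refl _
      | tail _ hbc ih =>
        intro hx
        refine (ih hbc.1).trans ⟨segPath ?_⟩
        exact Comp.cofacial (v := ⟨_, hbc.1⟩) (w := ⟨_, hbc.2.1⟩) hbc.2.2
    exact this w.1 (hconn _ v.2 _ w.2) w.2
  have hf : ∀ f : geomRealOn S, Joined (realVertex (carrierVertex f)) f := fun f =>
    ⟨segPath (cofacial_of_mem_openStar (mem_openStar_carrierVertex f))⟩
  exact ⟨⟨realVertex ⟨_, hne.some_mem⟩⟩, fun f g => ((hf f).symm.trans (hv _ _)).trans (hf g)⟩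

/-- A homotopy class of paths is determined by its conjugate between carrier vertices. -/
theorem toPoint_conj_injective {f g : geomRealOn S} {p q : Path.Homotopic.Quotient f g}
    (h : ((toPoint f).trans p).trans (toPoint g).symm =
      ((toPoint f).trans q).trans (toPoint g).symm) : p = q := by
  have key : ∀ p : Path.Homotopic.Quotient f g, p =
      (toPoint f).symm.trans ((((toPoint f).trans p).trans (toPoint g).symm).trans
        (toPoint g)) := by
    intro p
    simp only [Path.Homotopic.Quotient.trans_assoc, Path.Homotopic.Quotient.symm_trans,
      Path.Homotopic.Quotient.trans_refl]
    rw [← Path.Homotopic.Quotient.trans_assoc, Path.Homotopic.Quotient.symm_trans,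
      Path.Homotopic.Quotient.refl_trans]
  rw [key p, key q, h]

/-- Compatible choices of paths to the vertices show that the realization is simply connected. -/
theorem simplyConnectedSpace_of_paths [PathConnectedSpace (geomRealOn S)] {b : geomRealOn S}
    (q : ∀ v : S, Path.Homotopic.Quotient b (realVertex v))
    (hq : ∀ (v w : S) (h : Comp v.1 w.1), (q v).trans (edge h) = q w) :
    SimplyConnectedSpace (geomRealOn S) := by
  have key : ∀ (v w : S) (p : Path.Homotopic.Quotient (realVertex v) (realVertex w)),
      (q v).trans p = q w := by
    intro v w p
    refine edge_induction (W := fun v w p => (q v).trans p = q w) ?_ hq p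
    intro u v w p p' h h'
    rw [← Path.Homotopic.Quotient.trans_assoc, h, h']
  rw [simply_connected_iff_paths_homotopic]
  refine ⟨inferInstance, fun f g => ⟨fun p p' => toPoint_conj_injective ?_⟩⟩
  have h2 : ∀ p : Path.Homotopic.Quotient (realVertex (carrierVertex f))
      (realVertex (carrierVertex g)), p = (q _).symm.trans (q _) := by
    intro p
    rw [← key _ _ p, ← Path.Homotopic.Quotient.trans_assoc, Path.Homotopic.Quotient.symm_trans,
      Path.Homotopic.Quotient.refl_trans]
  rw [h2 (((toPoint f).trans p).trans (toPoint g).symm),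
    h2 (((toPoint f).trans p').trans (toPoint g).symm)]

/-- If all cocycles on a connected poset are coboundaries, then its realization is simply
connected. -/
theorem simplyConnectedSpace_of_isCobound (hne : S.Nonempty) (hconn : ConnOn Comp S)
    (htriv : ∀ (H : Type u) [Group H] (c : X → X → H), IsCocycle Comp S c → IsCobound Comp S c) :
    SimplyConnectedSpace (geomRealOn S) := by
  classical
  have := pathConnectedSpace_geomRealOn hne hconn
  set b : geomRealOn S := realVertex ⟨_, hne.some_mem⟩
  let q (v : S) : Path.Homotopic.Quotient b (realVertex v) := .mk (PathConnectedSpace.somePath _ _)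
  let c (x y : X) : FundamentalGroup (geomRealOn S) b :=
    if h : x ∈ S ∧ y ∈ S ∧ Comp y x then
      ((q ⟨y, h.2.1⟩).trans (edge (v := ⟨y, h.2.1⟩) (w := ⟨x, h.1⟩) h.2.2)).trans (q ⟨x, h.1⟩).symm
    else 1
  obtain ⟨d, hd⟩ := htriv (FundamentalGroup (geomRealOn S) b) c (by
    intro x hx y hy z hz hxy hyz hxz
    simp only [c, hx, hy, hz, hxy.symm, hyz.symm, hxz.symm, and_self, dite_true,
      FundamentalGroup.mul_def]
    rw [← edge_trans (u := ⟨z, hz⟩) (v := ⟨y, hy⟩) (w := ⟨x, hx⟩) hyz.symm hxy.symm hxz.symm]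
    simp only [Path.Homotopic.Quotient.trans_assoc]
    congr 2
    rw [← Path.Homotopic.Quotient.trans_assoc, Path.Homotopic.Quotient.symm_trans,
      Path.Homotopic.Quotient.refl_trans])
  let d' (x : X) : Path.Homotopic.Quotient b b := d x
  refine simplyConnectedSpace_of_paths (b := b) (fun v => (d' v).symm.trans (q v)) ?_
  intro v w h
  have := hd w.1 w.2 v.1 v.2 h.symm
  simp only [c, v.2, w.2, h, and_self, dite_true, FundamentalGroup.mul_def] at this
  change ((((q v).trans (edge h)).trans (q w).symm).trans (d' w)) = d' v at this
  rw [← this]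
  simp only [Path.Homotopic.Quotient.trans_symm_rev, Path.Homotopic.Quotient.trans_assoc,
    Path.Homotopic.Quotient.symm_symm, Path.Homotopic.Quotient.symm_trans,
    Path.Homotopic.Quotient.trans_refl]

end SimplyConnected

section Holonomy

variable {X : Type*} [PartialOrder X] {S : Set X} {G : Type*} [Group G]

open Bundle

theorem segPath_mem_openStar {v : S} {f g : geomRealOn S} (h : Cofacial f g)
    (hf : f ∈ openStar v) (hg : g ∈ openStar v) (t : I) : segPath h t ∈ openStar v := by
  have hf' : 0 < f.1 v.1 := lt_of_le_of_ne (f.2.1 _) (Ne.symm hf)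
  have hg' : 0 < g.1 v.1 := lt_of_le_of_ne (g.2.1 _) (Ne.symm hg)
  have e : (segPath h t).1 v.1 = (1 - t : ℝ) * f.1 v.1 + (t : ℝ) * g.1 v.1 := rfl
  change (segPath h t).1 v.1 ≠ 0
  rw [e]
  have h0 := t.2.1; have h1 := t.2.2
  rcases h0.eq_or_lt with h | h
  · simp only [← h]; linarith
  · have : 0 ≤ (1 - t : ℝ) * f.1 v.1 := mul_nonneg (by linarith) hf'.le
    positivity

/-- The principal bundle with discrete fibre `G` over the realization given by a cocycle. -/
noncomputable def cocycleBundle [TopologicalSpace G] [DiscreteTopology G] (κ : S → S → G)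
    (hκ : ∀ u v w : S, Comp u.1 v.1 → Comp v.1 w.1 → Comp u.1 w.1 → κ u v * κ v w = κ u w) :
    FiberBundleCore S (geomRealOn S) G where
  baseSet := openStar
  isOpen_baseSet := isOpen_openStar
  indexAt := carrierVertex
  mem_baseSet_at := mem_openStar_carrierVertex
  coordChange i j _ g := κ j i * g
  coordChange_self i x _ v := by
    have h : Comp i.1 i.1 := .inl le_rfl
    rw [mul_eq_right]
    simpa using hκ i i i h h h
  continuousOn_coordChange i j :=
    ((continuous_of_discreteTopology (f := fun g : G => κ j i * g)).comp
      continuous_snd).continuousOn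
  coordChange_comp i j k x hx v := by
    rw [← mul_assoc, hκ k j i (comp_of_mem_openStar hx.2 hx.1.2)
      (comp_of_mem_openStar hx.1.2 hx.1.1) (comp_of_mem_openStar hx.2 hx.1.1)]

/-- A cocycle has a holonomy, defined on homotopy classes of paths between vertices. -/
theorem exists_holonomy (κ : S → S → G)
    (hκ : ∀ u v w : S, Comp u.1 v.1 → Comp v.1 w.1 → Comp u.1 w.1 → κ u v * κ v w = κ u w) :
    ∃ hol : ∀ {v w : S}, Path.Homotopic.Quotient (realVertex v) (realVertex w) → G,
      (∀ {u v w : S} (p : Path.Homotopic.Quotient (realVertex u) (realVertex v))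
        (q : Path.Homotopic.Quotient (realVertex v) (realVertex w)),
        hol (p.trans q) = hol q * hol p) ∧
      ∀ {v w : S} (h : Comp v.1 w.1), hol (edge h) = κ w v := by
  let _ : TopologicalSpace G := ⊥
  have : DiscreteTopology G := ⟨rfl⟩
  let Z := cocycleBundle κ hκ
  have cov : IsCoveringMap Z.proj := FiberBundle.isCoveringMap (F := G) (E := Z.Fiber)
  let pt (f : geomRealOn S) (g : G) : Z.proj ⁻¹' {f} := ⟨⟨f, g⟩, rfl⟩
  have hloc : ∀ (v : S) {f f' : geomRealOn S} (p : Path f f') (_ : ∀ t, p t ∈ openStar v) (g : G),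
      cov.monodromy (.mk p) (pt f g) =
        pt f' (κ (carrierVertex f') v * (κ v (carrierVertex f) * g)) := by
    intro v f f' p hp g
    have hf : f ∈ openStar v := by simpa using hp 0
    have hf' : f' ∈ openStar v := by simpa using hp 1
    let sec (x : geomRealOn S) : Z.TotalSpace :=
      ⟨x, κ (carrierVertex x) v * (κ v (carrierVertex f) * g)⟩
    have hsec : ContinuousOn sec (openStar v) := by
      have h1 := (Z.localTriv v).toOpenPartialHomeomorph.symm.continuousOn
      refine h1.comp (f := fun x => (x, κ v (carrierVertex f) * g))
        (by fun_prop) fun x hx => ?_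
      exact ((Z.localTriv v).mem_target).2 hx
    have e1 : sec f = (pt f g).1 := by
      have h : κ (carrierVertex f) v * (κ v (carrierVertex f) * g) = g :=
        (Z.coordChange_comp (carrierVertex f) v (carrierVertex f) f
          ⟨⟨mem_openStar_carrierVertex f, hf⟩, mem_openStar_carrierVertex f⟩ g).trans
          (Z.coordChange_self _ _ (mem_openStar_carrierVertex f) g)
      change (⟨f, _⟩ : Z.TotalSpace) = ⟨f, g⟩
      rw [h]
    let Γ : Path (pt f g).1
        (pt f' (κ (carrierVertex f') v * (κ v (carrierVertex f) * g))).1 :=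
      { toFun := fun t => sec (p t)
        continuous_toFun := hsec.comp_continuous p.continuous hp
        source' := by rw [p.source]; exact e1
        target' := by rw [p.target] }
    exact cov.monodromy_eq_of_map_eq (.mk Γ) rfl
  have hedge : ∀ {v w : S} (h : Comp v.1 w.1) (g : G),
      cov.monodromy (edge h) (pt _ g) = pt _ (κ w v * g) := by
    intro v w h g
    let m : geomRealOn S := ⟨_, geomRealOn.combo_mem (realVertex v).2 (realVertex w).2 h.cofacial
      (a := 1 / 2) (b := 1 / 2) (by norm_num) (by norm_num) (by norm_num)⟩
    have hval : ∀ x, m.1 x = 1 / 2 * (realVertex v).1 x + 1 / 2 * (realVertex w).1 x := by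
      intro x; simp [m]
    have hne : ∀ x, m.1 x ≠ 0 → x = v.1 ∨ x = w.1 := by
      intro x hx
      by_contra! h0
      have h1 : (realVertex v).1 x = 0 := not_not.1 fun h' => h0.1 (realVertex_apply_ne.1 h')
      have h2 : (realVertex w).1 x = 0 := not_not.1 fun h' => h0.2 (realVertex_apply_ne.1 h')
      simp [hval, h1, h2] at hx
    have hpos : ∀ u : S, 0 < (realVertex u).1 u.1 := fun u =>
      lt_of_le_of_ne ((realVertex u).2.1 _) (realVertex_apply_ne.2 rfl).symm
    have hmv : m ∈ openStar v := by
      have := hpos v; have := (realVertex w).2.1 v.1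
      change m.1 v.1 ≠ 0
      rw [hval]; positivity
    have hmw : m ∈ openStar w := by
      have := hpos w; have := (realVertex v).2.1 w.1
      change m.1 w.1 ≠ 0
      rw [hval]; positivity
    have hv : realVertex v ∈ openStar v := (hpos v).ne'
    have hw : realVertex w ∈ openStar w := (hpos w).ne'
    have hvm : Cofacial (realVertex v) m := cofacial_of_mem_openStar hmv
    have hmw' : Cofacial m (realVertex w) := (cofacial_of_mem_openStar hmw).symm
    have he : edge h = (seg hvm).trans (seg hmw') :=
      (seg_trans v (openStar_subset_closedStar v hv) (openStar_subset_closedStar v hmv)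
        (realVertex_mem_closedStar h.symm) _ _ _).symm
    rw [he, cov.monodromy_trans_apply, seg, seg,
      hloc v _ (segPath_mem_openStar hvm hv hmv) g,
      hloc w _ (segPath_mem_openStar hmw' hmw hw)]
    congr 1
    have hself : ∀ u, κ u u = 1 := fun u => by
      have h : Comp u.1 u.1 := .inl le_rfl
      simpa using hκ u u u h h h
    rw [carrierVertex_realVertex, carrierVertex_realVertex, hself, hself, one_mul, one_mul,
      ← mul_assoc, hκ _ _ _ (comp_of_mem_openStar hmw (mem_openStar_carrierVertex m))
        (comp_of_mem_openStar (mem_openStar_carrierVertex m) hmv) h.symm]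
  have key : ∀ {v w : S} (p : Path.Homotopic.Quotient (realVertex v) (realVertex w)),
      ∃ k : G, ∀ g, cov.monodromy p (pt _ g) = pt _ (k * g) := by
    intro v w p
    refine edge_induction (W := fun v w p => ∃ k : G, ∀ g, cov.monodromy p (pt _ g) = pt _ (k * g))
      ?_ (fun v w h => ⟨_, hedge h⟩) p
    rintro u v w p q ⟨k, hk⟩ ⟨l, hl⟩
    exact ⟨l * k, fun g => by rw [cov.monodromy_trans_apply, hk, hl, mul_assoc]⟩
  have inj : ∀ {f : geomRealOn S} {g g' : G}, pt f g = pt f g' → g = g' := by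
    intro f g g' h
    have h' := congrArg Subtype.val h
    injection h' with _ h'
  choose hol hhol using @key
  refine ⟨@hol, fun p q => ?_, fun h => ?_⟩
  · have h1 := hhol (p.trans q) 1
    rw [cov.monodromy_trans_apply, hhol, hhol] at h1
    simpa using (inj h1).symm
  · simpa using inj ((hhol (edge h) 1).symm.trans (hedge h 1))

end Holonomy

section Graph

variable {X : Type*} [PartialOrder X] {S : Set X}

/-- The comparability graph of a set of elements of a poset. -/
def compGraph (S : Set X) : SimpleGraph S where
  Adj v w := v ≠ w ∧ Comp v.1 w.1
  symm := ⟨fun _ _ h => ⟨h.1.symm, h.2.symm⟩⟩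
  loopless := ⟨fun _ h => h.1 rfl⟩

/-- The homotopy class of the path in the realization traced by a walk. -/
noncomputable def walkClass {T : SimpleGraph S} (hT : T ≤ compGraph S) :
    ∀ {v w : S}, T.Walk v w → Path.Homotopic.Quotient (realVertex v) (realVertex w)
  | _, _, .nil => .refl _
  | _, _, .cons h p => (edge (hT h).2).trans (walkClass hT p)

theorem walkClass_append {T : SimpleGraph S} (hT : T ≤ compGraph S) {u v w : S} (p : T.Walk u v)
    (q : T.Walk v w) : walkClass hT (p.append q) = (walkClass hT p).trans (walkClass hT q) := by
  induction p with
  | nil => simp [walkClass, Path.Homotopic.Quotient.refl_trans]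
  | cons h p ih => simp [walkClass, ih, Path.Homotopic.Quotient.trans_assoc]

theorem compGraph_connected (hne : S.Nonempty) (hconn : ConnOn Comp S) :
    (compGraph S).Connected := by
  have : Nonempty S := hne.to_subtype
  refine ⟨fun v w => ?_⟩
  have : ∀ x, Relation.ReflTransGen (fun a b => a ∈ S ∧ b ∈ S ∧ Comp a b) v.1 x →
      ∀ hx : x ∈ S, (compGraph S).Reachable v ⟨x, hx⟩ := by
    intro x h
    induction h with
    | refl => exact fun _ => .refl _
    | @tail y z _ hbc ih =>
      intro hx
      by_cases h : y = z
      · subst h; exact ih hx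
      · refine (ih hbc.1).trans 
          (SimpleGraph.Adj.reachable (u := (⟨y, hbc.1⟩ : S)) (v := ⟨z, hx⟩) ?_)
        exact ⟨by simpa using h, hbc.2.2⟩
  exact this w.1 (hconn _ v.2 _ w.2) w.2

/-- Paths in a spanning tree give compatible homotopy classes. -/
theorem exists_tree_classes {T : SimpleGraph S} (hT : T ≤ compGraph S) (htree : T.IsTree) (b : S) :
    ∃ q : ∀ v, T.Walk b v, q b = .nil ∧ ∀ (v w : S) (h : T.Adj v w),
      (walkClass hT (q v)).trans (edge (hT h).2) = walkClass hT (q w) := by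
  choose q hq hq' using fun v => htree.existsUnique_path b v
  have hlt : ∀ (v w : S) (h : T.Adj v w), w ∉ (q v).support →
      (walkClass hT (q v)).trans (edge (hT h).2) = walkClass hT (q w) := by
    intro v w h hw
    rw [← hq' w _ ((hq v).concat hw h), SimpleGraph.Walk.concat_eq_append, walkClass_append]
    simp [walkClass]
  refine ⟨q, (hq' b _ .nil).symm, fun v w h => ?_⟩
  by_cases hw : w ∈ (q v).support
  · have hv : v ∉ (q w).support := by
      exact htree.isAcyclic.ne_mem_support_of_support_of_adj_of_isPath (hq v) (hq w) h hw
    have hself : Comp w.1 w.1 := .inl le_rfl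
    rw [← hlt w v h.symm hv, Path.Homotopic.Quotient.trans_assoc,
      edge_trans (hT h.symm).2 (hT h).2 hself, edge_self, Path.Homotopic.Quotient.trans_refl]
  · exact hlt v w h hw

/-- The realization of a finite connected poset without chains of length two has free fundamental
group. -/
theorem fundamentalGroup_geomRealOn [Finite S] (hne : S.Nonempty) (hconn : ConnOn Comp S)
    (hdim : ∀ x ∈ S, ∀ y ∈ S, ∀ z ∈ S, x < y → ¬ y < z) {n : ℕ}
    (hn : n + Nat.card S = Nat.card {e : S × S // e.1 < e.2} + 1) (x : geomRealOn S) :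
    Nonempty (FundamentalGroup (geomRealOn S) x ≃* FreeGroup (Fin n)) := by
  classical
  have := pathConnectedSpace_geomRealOn hne hconn
  let b : S := ⟨_, hne.some_mem⟩
  obtain ⟨T, hT, htree⟩ := (compGraph_connected hne hconn).exists_isTree_le
  obtain ⟨w, hwb, hw⟩ := exists_tree_classes hT htree b
  let q (v : S) := walkClass hT (w v)
  let N := {e : S × S // e.1 < e.2 ∧ ¬ T.Adj e.1 e.2}
  let κ (v w : S) : FreeGroup N :=
    if h : v < w ∧ ¬ T.Adj v w then .of ⟨(v, w), h⟩
    else if h : w < v ∧ ¬ T.Adj w v then (.of ⟨(w, v), h⟩)⁻¹ else 1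
  have hself : ∀ v, κ v v = 1 := fun v => by simp [κ]
  have hgen : ∀ e : N, κ e.1.1 e.1.2 = .of e := fun e => by simp [κ, e.2]
  have hinv : ∀ v w, κ v w * κ w v = 1 := by
    intro v w
    by_cases h1 : v < w ∧ ¬ T.Adj v w
    · have h2 : ¬ (w < v ∧ ¬ T.Adj w v) := fun h2 => lt_asymm h1.1 h2.1
      simp only [κ, dif_pos h1, dif_neg h2, mul_inv_cancel]
    · by_cases h2 : w < v ∧ ¬ T.Adj w v
      · simp only [κ, dif_pos h2, dif_neg h1, inv_mul_cancel]
      · simp only [κ, dif_neg h2, dif_neg h1, mul_one]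
  have htriv : ∀ {v w}, T.Adj v w → κ v w = 1 := fun h => by simp [κ, h, h.symm]
  obtain ⟨hol, hol_trans, hol_edge⟩ := exists_holonomy κ (by
    intro u v w huv hvw huw
    have : u = v ∨ v = w ∨ u = w := by
      by_contra! h
      obtain ⟨h1, h2, h3⟩ := h
      have lt : ∀ {x y : S}, x ≠ y → Comp x.1 y.1 → x.1 < y.1 ∨ y.1 < x.1 := fun h h' =>
        h'.imp (fun h' => lt_of_le_of_ne h' fun h'' => h (Subtype.ext h''))
          (fun h' => lt_of_le_of_ne h' fun h'' => h (Subtype.ext h'').symm)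
      have hd : ∀ x y z : S, x.1 < y.1 → ¬ y.1 < z.1 := fun x y z =>
        hdim _ x.2 _ y.2 _ z.2
      have := hd u v w; have := hd w v u; have := hd v w u
      have := hd u w v; have := hd v u w; have := hd w u v
      have := lt h1 huv; have := lt h2 hvw; have := lt h3 huw
      tauto
    rcases this with rfl | rfl | rfl
    · rw [hself, one_mul]
    · rw [hself, mul_one]
    · rw [hself, hinv])
  have hol_refl : ∀ v : S, hol (.refl (realVertex v)) = 1 := fun v => by
    simpa [Path.Homotopic.Quotient.refl_trans] using hol_trans (.refl (realVertex v)) (.refl _)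
  have hol_walk : ∀ {v w} (p : T.Walk v w), hol (walkClass hT p) = 1 := by
    intro v w p
    induction p with
    | nil => simp [walkClass, hol_refl]
    | cons h p ih => simp [walkClass, hol_trans, ih, hol_edge, htriv h.symm]
  have hol_symm : ∀ {v w : S} (p : Path.Homotopic.Quotient (realVertex v) (realVertex w)),
      hol p.symm = (hol p)⁻¹ := fun p => by
    rw [eq_inv_iff_mul_eq_one, ← hol_trans, Path.Homotopic.Quotient.trans_symm, hol_refl]
  let H : FundamentalGroup (geomRealOn S) (realVertex b) →* FreeGroup N :=
    { toFun := fun p => hol (v := b) (w := b) p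
      map_one' := hol_refl b
      map_mul' := fun p q => hol_trans (u := b) (v := b) (w := b) q p }
  let loop {v w : S} (p : Path.Homotopic.Quotient (realVertex v) (realVertex w)) :
      FundamentalGroup (geomRealOn S) (realVertex b) := ((q v).trans p).trans (q w).symm
  have comp_of : ∀ e : N, Comp e.1.2.1 e.1.1.1 := fun e => .inr e.2.1.le
  let φ : FreeGroup N →* FundamentalGroup (geomRealOn S) (realVertex b) :=
    FreeGroup.lift fun e => loop (edge (comp_of e))
  have hφ : H.comp φ = MonoidHom.id _ := by
    refine FreeGroup.ext_hom _ _ fun e => ?_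
    simp only [MonoidHom.comp_apply, φ, FreeGroup.lift_apply_of, MonoidHom.id_apply]
    change hol (v := b) (w := b) (((q e.1.2).trans (edge (comp_of e))).trans (q e.1.1).symm) = _
    simp only [hol_trans, hol_symm, hol_edge, q, hol_walk, hgen]
    simp
  have hsurj : ∀ {v w : S} (p : Path.Homotopic.Quotient (realVertex v) (realVertex w)),
      loop p ∈ φ.range := by
    intro v w p
    refine edge_induction (W := fun v w p => loop p ∈ φ.range) ?_ ?_ p
    · intro u v w p p' hp hp'
      have : loop (p.trans p') = loop p' * loop p := by
        simp only [loop, FundamentalGroup.mul_def, Path.Homotopic.Quotient.trans_assoc,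
          Path.Homotopic.Quotient.trans_symm_cancel]
      rw [this]
      exact mul_mem hp' hp
    · have hup : ∀ (v w : S) (h : Comp v.1 w.1), w < v → loop (edge h) ∈ φ.range := by
        intro v w h hlt
        by_cases hT' : T.Adj v w
        · have : loop (edge h) = 1 := by
            simp only [loop, q]
            rw [hw v w hT', Path.Homotopic.Quotient.trans_symm]
            rfl
          rw [this]
          exact one_mem _
        · exact ⟨.of ⟨(w, v), hlt, fun h => hT' h.symm⟩, by simp [φ]⟩
      intro v w h
      by_cases hvw : v = w
      · subst hvw
        have : loop (edge h) = 1 := by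
          simp only [loop, edge_self, Path.Homotopic.Quotient.trans_refl,
            Path.Homotopic.Quotient.trans_symm]
          rfl
        rw [this]
        exact one_mem _
      · rcases id h with h' | h'
        · have : loop (edge h) = (loop (edge h.symm))⁻¹ := by
            simp only [loop, FundamentalGroup.inv_def, Path.Homotopic.Quotient.trans_symm_rev,
              Path.Homotopic.Quotient.symm_symm, edge_symm, Path.Homotopic.Quotient.trans_assoc]
          rw [this]
          exact inv_mem (hup w v h.symm (lt_of_le_of_ne h' hvw))
        · exact hup v w h (lt_of_le_of_ne h' (Ne.symm hvw))
  have hbij : Function.Bijective φ := by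
    refine ⟨fun x y h => ?_, fun p => ?_⟩
    · have := congrArg H h
      simpa only [← MonoidHom.comp_apply, hφ, MonoidHom.id_apply] using this
    · have := hsurj (v := b) (w := b) p
      simpa [loop, q, hwb, walkClass, Path.Homotopic.Quotient.symm_refl] using this
  have hcard : Nat.card N = n := by
    have := Fintype.ofFinite S
    have h1 := htree.card_edgeFinset
    have h2 : Nat.card {e : S × S // e.1 < e.2 ∧ T.Adj e.1 e.2} = T.edgeFinset.card := by
      rw [← Fintype.card_coe, Fintype.card_eq_nat_card]
      refine Nat.card_eq_of_bijective (fun e => ⟨s(e.1.1, e.1.2), by simpa using e.2.2⟩) ⟨?_, ?_⟩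
      · rintro ⟨⟨a, b⟩, hab, hab2⟩ ⟨⟨c, d⟩, hcd, hcd2⟩ h
        simp only [Subtype.mk.injEq, Sym2.eq_iff] at h
        rcases h with ⟨rfl, rfl⟩ | ⟨rfl, rfl⟩
        · rfl
        · exact absurd hab (lt_asymm hcd)
      · rintro ⟨e, he⟩
        induction e with | _ v w =>
        have he' : T.Adj v w := by simpa using he
        have hne := (hT he').1
        rcases (hT he').2 with h | h
        · exact ⟨⟨(v, w), lt_of_le_of_ne h hne, he'⟩, rfl⟩
        · exact ⟨⟨(w, v), lt_of_le_of_ne h hne.symm, he'.symm⟩, Subtype.ext Sym2.eq_swap⟩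
    have h3 : Nat.card {e : S × S // e.1 < e.2} =
        Nat.card {e : S × S // e.1 < e.2 ∧ T.Adj e.1 e.2} + Nat.card N := by
      rw [← Nat.card_sum]
      exact Nat.card_congr (((Equiv.subtypeSubtypeEquivSubtypeInter _ _).symm.sumCongr
        (Equiv.subtypeSubtypeEquivSubtypeInter _ _).symm).trans
          (Equiv.sumCompl fun e : {e : S × S // e.1 < e.2} => T.Adj e.1.1 e.1.2)).symm
    rw [Fintype.card_eq_nat_card] at h1
    omega
  exact ⟨(FundamentalGroup.fundamentalGroupMulEquivOfPathConnected x (realVertex b)).trans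
    ((MulEquiv.ofBijective φ hbij).symm.trans (FreeGroup.freeGroupCongr
      (Finite.equivFinOfCardEq hcard)))⟩

end Graph

section Components

variable {X : Type*} [PartialOrder X] {S : Set X}

theorem IsSimplyConnected.of_connectedComponent_eq {Y : Type*} [TopologicalSpace Y] {s : Set Y}
    (hs : IsSimplyConnected s) (hs' : IsClopen s) {y : Y} (hy : y ∈ s) :
    SimplyConnectedSpace (connectedComponent y) := by
  have := hs.simplyConnectedSpace
  have hconn : IsPreconnected s := hs.isPathConnected.isConnected.isPreconnected
  have : connectedComponent y = s :=
    (hs'.connectedComponent_subset hy).antisymm (hconn.subset_connectedComponent hy)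
  rw [this]
  exact hs.simplyConnectedSpace

/-- If every element lies below a distinguished one which is constant on comparable elements, then
the components of the realization are simply connected. -/
theorem simplyConnectedSpace_connectedComponent (m : X → X) (hm : ∀ x ∈ S, m x ∈ S ∧ x ≤ m x)
    (hm' : ∀ x ∈ S, ∀ y ∈ S, x ≤ y → m x = m y) (f : geomRealOn S) :
    SimplyConnectedSpace (connectedComponent f) := by
  obtain ⟨x, hx⟩ := exists_mem_openStar f
  let v : S := ⟨m x, (hm x x.2).1⟩
  have hv : m v.1 = v.1 := (hm' _ x.2 _ (hm x x.2).1 (hm x x.2).2).symm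
  have hstar : ∀ (y : S) (g : geomRealOn S), g ∈ openStar y → (g ∈ closedStar v ↔ m y = v.1) := by
    intro y g hg
    constructor
    · intro h
      rcases h _ hg with h | h
      · exact (hm' _ y.2 _ v.2 h).trans hv
      · exact (hm' _ v.2 _ y.2 h).symm.trans hv
    · intro h z hz
      have hzS := g.2.2.1 hz
      refine .inl ?_
      rw [← h]
      rcases g.2.2.2.1.total hz hg with h' | h'
      · rw [← hm' _ hzS _ y.2 h']; exact (hm _ hzS).2
      · rw [hm' _ y.2 _ hzS h']; exact (hm _ hzS).2
  refine (isSimplyConnected_closedStar v).of_connectedComponent_eq ⟨?_, ?_⟩ ((hstar x f hx).2 rfl)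
  · rw [← isOpen_compl_iff, isOpen_iff_forall_mem_open]
    intro g hg
    obtain ⟨y, hy⟩ := exists_mem_openStar g
    exact ⟨openStar y, fun g' hg' h => hg ((hstar y g hy).2 ((hstar y g' hg').1 h)),
      isOpen_openStar y, hy⟩
  · rw [isOpen_iff_forall_mem_open]
    intro g hg
    obtain ⟨y, hy⟩ := exists_mem_openStar g
    exact ⟨openStar y, fun g' hg' => (hstar y g' hg').2 ((hstar y g hy).1 hg),
      isOpen_openStar y, hy⟩

theorem simplyConnectedSpace_of_forall_comp {v : X} (hv : v ∈ S) (h : ∀ x ∈ S, Comp x v) :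
    SimplyConnectedSpace (geomRealOn S) := by
  have : closedStar (⟨v, hv⟩ : S) = Set.univ := by
    ext f
    exact ⟨fun _ => trivial, fun _ x hx => h x (f.2.2.1 hx)⟩
  have hs := isSimplyConnected_closedStar (⟨v, hv⟩ : S)
  rw [this] at hs
  have := hs.simplyConnectedSpace
  exact (Homeomorph.Set.univ (geomRealOn S)).symm.toHomotopyEquiv.simplyConnectedSpace

end Components

section ElementaryAbelian

variable {G : Type*} [Group G]

theorem mem_apSet_two {H : Subgroup G} :
    H ∈ apSet 2 G ↔ H ≠ ⊥ ∧ ∀ a ∈ H, a ^ 2 = 1 := by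
  refine ⟨fun h => ⟨h.1, fun a ha => congrArg Subtype.val (h.2.2 ⟨a, ha⟩)⟩, fun h => ⟨h.1, ?_, ?_⟩⟩
  · have hinv : ∀ a : H, a⁻¹ = a := fun a => inv_eq_of_mul_eq_one_left
      (Subtype.ext (by simpa [sq] using h.2 a a.2))
    intro a b
    rw [← hinv (a * b), mul_inv_rev, hinv, hinv]
  · exact fun a => Subtype.ext (h.2 a a.2)

/-- The involutions commuting with `x`, together with the identity. -/
def involutionCentralizer (hG : ∀ x s t : G, x ≠ 1 → x ^ 2 = 1 → s ^ 2 = 1 → t ^ 2 = 1 →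
    Commute s x → Commute t x → Commute s t) (x : G) (hx : x ≠ 1) (hx2 : x ^ 2 = 1) :
    Subgroup G where
  carrier := {s | s ^ 2 = 1 ∧ Commute s x}
  one_mem' := ⟨one_pow _, Commute.one_left _⟩
  mul_mem' {s t} hs ht := ⟨by
    rw [(hG x s t hx hx2 hs.1 ht.1 hs.2 ht.2).mul_pow, hs.1, ht.1, one_mul], hs.2.mul_left ht.2⟩
  inv_mem' {s} hs := ⟨by rw [inv_pow, hs.1, inv_one], hs.2.inv_left⟩

theorem involutionCentralizer_mem_apSet (hG : ∀ x s t : G, x ≠ 1 → x ^ 2 = 1 → s ^ 2 = 1 →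
    t ^ 2 = 1 → Commute s x → Commute t x → Commute s t) (x : G) (hx : x ≠ 1) (hx2 : x ^ 2 = 1) :
    involutionCentralizer hG x hx hx2 ∈ apSet 2 G := by
  rw [mem_apSet_two]
  refine ⟨fun h => hx ?_, fun a ha => ha.1⟩
  rw [← Subgroup.mem_bot, ← h]
  exact ⟨hx2, Commute.refl x⟩

theorem apSet_commute {H : Subgroup G} (hH : H ∈ apSet 2 G) {x y : G} (hx : x ∈ H) (hy : y ∈ H) :
    Commute x y := congrArg Subtype.val (hH.2.1 ⟨x, hx⟩ ⟨y, hy⟩)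

theorem apSet_sq {H : Subgroup G} (hH : H ∈ apSet 2 G) {x : G} (hx : x ∈ H) : x ^ 2 = 1 :=
  (mem_apSet_two.1 hH).2 x hx

theorem exists_mem_apSet {H : Subgroup G} (hH : H ∈ apSet 2 G) : ∃ x ∈ H, x ≠ 1 :=
  H.bot_or_exists_ne_one.resolve_left hH.1

theorem simplyConnectedSpace_connectedComponent_apSet (hG : ∀ x s t : G, x ≠ 1 → x ^ 2 = 1 →
    s ^ 2 = 1 → t ^ 2 = 1 → Commute s x → Commute t x → Commute s t)
    (f : geomRealOn (apSet 2 G)) : SimplyConnectedSpace (connectedComponent f) := by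
  classical
  have hex : ∀ H : Subgroup G, H ∈ apSet 2 G → ∃ x ∈ H, x ≠ 1 ∧ x ^ 2 = 1 := by
    intro H hH
    obtain ⟨x, hx, hx1⟩ := exists_mem_apSet hH
    exact ⟨x, hx, hx1, apSet_sq hH hx⟩
  choose! x hx hx1 hx2 using hex
  refine simplyConnectedSpace_connectedComponent (fun H => if h : H ∈ apSet 2 G then
    involutionCentralizer hG (x H) (hx1 H h) (hx2 H h) else ⊥) ?_ ?_ f
  · intro H hH
    simp only [hH, dite_true]
    exact ⟨involutionCentralizer_mem_apSet _ _ _ _, fun a ha =>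
      ⟨apSet_sq hH ha, apSet_commute hH ha (hx H hH)⟩⟩
  · intro H hH K hK hle
    simp only [hH, hK, dite_true]
    have hc : Commute (x H) (x K) := apSet_commute hK (hle (hx H hH)) (hx K hK)
    ext a
    exact ⟨fun ha => ⟨ha.1, hG _ _ _ (hx1 H hH) (hx2 H hH) ha.1 (hx2 K hK) ha.2 hc.symm⟩,
      fun ha => ⟨ha.1, hG _ _ _ (hx1 K hK) (hx2 K hK) ha.1 (hx2 H hH) ha.2 hc⟩⟩

theorem simplyConnectedSpace_apSet_of_commute (hne : ∃ x : G, x ≠ 1 ∧ x ^ 2 = 1)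
    (hG : ∀ s t : G, s ^ 2 = 1 → t ^ 2 = 1 → Commute s t) :
    SimplyConnectedSpace (geomRealOn (apSet 2 G)) := by
  obtain ⟨x, hx, hx2⟩ := hne
  refine simplyConnectedSpace_of_forall_comp (involutionCentralizer_mem_apSet
    (fun _ s t _ _ hs ht _ _ => hG s t hs ht) x hx hx2) fun H hH => .inl fun a ha =>
      ⟨apSet_sq hH ha, hG _ _ (apSet_sq hH ha) hx2⟩

end ElementaryAbelian

section Involutions

variable {G : Type*} [Group G]

/-- The set of elements of order two. -/
def involutions (G : Type*) [Group G] : Set G := {s | s ≠ 1 ∧ s ^ 2 = 1}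

theorem closure_mem_apSet {T : Set G} (hT : T ⊆ involutions G) (hne : T.Nonempty)
    (hc : ∀ a ∈ T, ∀ b ∈ T, Commute a b) : Subgroup.closure T ∈ apSet 2 G := by
  have hcomm : ∀ a ∈ Subgroup.closure T, ∀ b ∈ Subgroup.closure T, Commute a b := by
    intro a ha b hb
    induction ha, hb using Subgroup.closure_induction₂ with
    | mem a b ha hb => exact hc a ha b hb
    | one_left => exact Commute.one_left _
    | one_right => exact Commute.one_right _
    | mul_left _ _ _ _ _ _ h h' => exact h.mul_left h'
    | mul_right _ _ _ _ _ _ h h' => exact h.mul_right h'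
    | inv_left _ _ _ _ h => exact h.inv_left
    | inv_right _ _ _ _ h => exact h.inv_right
  rw [mem_apSet_two]
  obtain ⟨s, hs⟩ := hne
  refine ⟨fun h => (hT hs).1 ?_, fun a ha => ?_⟩
  · rw [← Subgroup.mem_bot, ← h]
    exact Subgroup.subset_closure hs
  · induction ha using Subgroup.closure_induction with
    | mem a ha => exact (hT ha).2
    | one => exact one_pow _
    | mul a b ha hb h h' => rw [(hcomm a ha b hb).mul_pow, h, h', one_mul]
    | inv a _ h => rw [inv_pow, h, inv_one]

theorem exists_involution_mem {K : Subgroup G} (hK : K ∈ apSet 2 G) :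
    ∃ s ∈ K, s ∈ involutions G := by
  obtain ⟨x, hx, hx1⟩ := exists_mem_apSet hK
  exact ⟨x, hx, hx1, apSet_sq hK hx⟩

theorem closure_singleton_mem_apSet {s : G} (hs : s ∈ involutions G) :
    Subgroup.closure {s} ∈ apSet 2 G :=
  closure_mem_apSet (by simpa using hs) (Set.singleton_nonempty s) (by simp)

theorem closure_pair_mem_apSet {s t : G} (hs : s ∈ involutions G) (ht : t ∈ involutions G)
    (h : Commute s t) : Subgroup.closure {s, t} ∈ apSet 2 G := by
  refine closure_mem_apSet (by simp [Set.insert_subset_iff, hs, ht]) (Set.insert_nonempty _ _) ?_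
  rintro _ (rfl | rfl) _ (rfl | rfl)
  exacts [.refl _, h, h.symm, .refl _]

theorem closure_triple_mem_apSet {s t u : G} (hs : s ∈ involutions G) (ht : t ∈ involutions G)
    (hu : u ∈ involutions G) (hst : Commute s t) (htu : Commute t u) (hsu : Commute s u) :
    Subgroup.closure {s, t, u} ∈ apSet 2 G := by
  refine closure_mem_apSet (by simp [Set.insert_subset_iff, hs, ht, hu])
    (Set.insert_nonempty _ _) ?_
  rintro _ (rfl | rfl | rfl) _ (rfl | rfl | rfl)
  exacts [.refl _, hst, hsu, hst.symm, .refl _, htu, hsu.symm, htu.symm, .refl _]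

theorem closure_singleton_le {s : G} {K : Subgroup G} (h : s ∈ K) : Subgroup.closure {s} ≤ K := by
  simpa using h

theorem connOn_apSet (h : ConnOn Commute (involutions G)) : ConnOn Comp (apSet 2 G) := by
  have step : ∀ {H K : Subgroup G}, H ∈ apSet 2 G → K ∈ apSet 2 G → Comp H K →
      Relation.ReflTransGen (fun a b => a ∈ apSet 2 G ∧ b ∈ apSet 2 G ∧ Comp a b) H K :=
    fun hH hK h => .single ⟨hH, hK, h⟩
  intro H hH K hK
  obtain ⟨s, hsH, hs⟩ := exists_involution_mem hH
  obtain ⟨t, htK, ht⟩ := exists_involution_mem hK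
  refine (step hH (closure_singleton_mem_apSet hs) (.inr (closure_singleton_le hsH))).trans
    (.trans ?_ (step (closure_singleton_mem_apSet ht) hK (.inl (closure_singleton_le htK))))
  have := h s hs t ht
  clear htK ht
  induction this with
  | refl => exact .refl
  | @tail a b _ hab ih =>
    have hp := closure_pair_mem_apSet hab.1 hab.2.1 hab.2.2
    refine ih.trans ((step (closure_singleton_mem_apSet hab.1) hp (.inl ?_)).trans
      (step hp (closure_singleton_mem_apSet hab.2.1) (.inr ?_))) <;>
    exact closure_singleton_le (Subgroup.subset_closure (by simp))

/-- A cocycle on the poset of elementary abelian subgroups is a coboundary as soon as all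
cocycles on commuting involutions are. -/
theorem isCobound_apSet {H : Type*} [Group H]
    (htriv : ∀ c : G → G → H, IsCocycle Commute (involutions G) c →
      IsCobound Commute (involutions G) c)
    (c : Subgroup G → Subgroup G → H) (hc : IsCocycle Comp (apSet 2 G) c) :
    IsCobound Comp (apSet 2 G) c := by
  classical
  let z (s : G) : Subgroup G := .closure {s}
  have hz : ∀ {s}, s ∈ involutions G → z s ∈ apSet 2 G := closure_singleton_mem_apSet
  have hself : ∀ K ∈ apSet 2 G, c K K = 1 := fun K hK => by
    have h : Comp K K := .inl le_rfl
    simpa using hc K hK K hK K hK h h h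
  have hinv : ∀ K ∈ apSet 2 G, ∀ L ∈ apSet 2 G, Comp K L → c K L * c L K = 1 :=
    fun K hK L hL h => by
    rw [hc K hK L hL K hK h h.symm (.inl le_rfl), hself K hK]
  let e (s t : G) : H := c (z s) (.closure {s, t}) * c (.closure {s, t}) (z t)
  have he : ∀ s t, s ∈ involutions G → t ∈ involutions G → ∀ K ∈ apSet 2 G, s ∈ K → t ∈ K →
      e s t = c (z s) K * c K (z t) := by
    intro s t hs ht K hK hsK htK
    have hp := closure_pair_mem_apSet hs ht (apSet_commute hK hsK htK)
    have hsp : z s ≤ .closure {s, t} := closure_singleton_le (Subgroup.subset_closure (by simp))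
    have htp : z t ≤ .closure {s, t} := closure_singleton_le (Subgroup.subset_closure (by simp))
    have hpK : Subgroup.closure {s, t} ≤ K := by
      simp [Subgroup.closure_le, Set.insert_subset_iff, hsK, htK]
    rw [← hc _ (hz hs) _ hp _ hK (.inl hsp) (.inl hpK) (.inl (hsp.trans hpK)),
      ← hc _ hK _ hp _ (hz ht) (.inr hpK) (.inr htp) (.inr (htp.trans hpK)), mul_assoc,
      ← mul_assoc (c _ K), hinv _ hp _ hK (.inl hpK), one_mul]
  obtain ⟨d, hd⟩ := htriv e (by
    intro s hs t ht u hu hst htu hsu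
    have hK := closure_triple_mem_apSet hs ht hu hst htu hsu
    set K := Subgroup.closure {s, t, u}
    have hsK : s ∈ K := Subgroup.subset_closure (by simp)
    have htK : t ∈ K := Subgroup.subset_closure (by simp)
    have huK : u ∈ K := Subgroup.subset_closure (by simp)
    rw [he s t hs ht K hK hsK htK, he t u ht hu K hK htK huK, he s u hs hu K hK hsK huK, mul_assoc,
      ← mul_assoc (c K _), hinv _ hK _ (hz ht) (.inr (closure_singleton_le htK)), one_mul])
  choose! x hxK hx using fun (K : Subgroup G) (hK : K ∈ apSet 2 G) => exists_involution_mem hK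
  have hD : ∀ K ∈ apSet 2 G, ∀ s ∈ K, s ∈ involutions G →
      d (x K) * c (z (x K)) K = d s * c (z s) K := by
    intro K hK s hsK hs
    have hxK' := hxK K hK
    rw [← hd _ (hx K hK) s hs (apSet_commute hK hxK' hsK),
      he _ s (hx K hK) hs K hK hxK' hsK, mul_assoc, mul_assoc,
      hinv _ hK _ (hz hs) (.inr (closure_singleton_le hsK)), mul_one]
  have hle : ∀ K ∈ apSet 2 G, ∀ L ∈ apSet 2 G, K ≤ L →
      d (x K) * c (z (x K)) K * c K L = d (x L) * c (z (x L)) L := by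
    intro K hK L hL h
    have hzK : z (x K) ≤ K := closure_singleton_le (hxK K hK)
    rw [hD L hL (x K) (h (hxK K hK)) (hx K hK), mul_assoc,
      hc _ (hz (hx K hK)) K hK L hL (.inl hzK) (.inl h) (.inl (hzK.trans h))]
  refine ⟨fun K => d (x K) * c (z (x K)) K, fun K hK L hL h => ?_⟩
  rcases h with h | h
  · exact hle K hK L hL h
  · change d (x K) * c (z (x K)) K * c K L = d (x L) * c (z (x L)) L
    rw [← hle L hL K hK h, mul_assoc, hinv L hL K hK (.inl h), mul_one]

end Involutions

section CocycleTools

variable {α H : Type*} [Group H] {r : α → α → Prop} {S D : Set α} {c : α → α → H}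

theorem IsCocycle.mono (hc : IsCocycle r S c) (h : D ⊆ S) : IsCocycle r D c :=
  fun x hx y hy z hz => hc x (h hx) y (h hy) z (h hz)

theorem IsCobound.mono (hc : IsCobound r S c) (h : D ⊆ S) : IsCobound r D c :=
  hc.imp fun _ hd x hx y hy => hd x (h hx) y (h hy)

theorem ConnOn.eq_of_forall {β : Type*} (h : ConnOn r D) {f : α → β}
    (hf : ∀ x ∈ D, ∀ y ∈ D, r x y → f x = f y) {x y : α} (hx : x ∈ D) (hy : y ∈ D) :
    f x = f y := by
  have := h x hx y hy
  clear hy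
  induction this with
  | refl => rfl
  | tail _ h' ih => exact ih.trans (hf _ h'.1 _ h'.2.1 h'.2.2)

/-- Extension of coboundaries: the links in `D` of the elements of `S` are connected, and every
edge in `S` has a common neighbour in `D`. -/
theorem IsCobound.extend (hr : ∀ s ∈ S, r s s) (hc : IsCocycle r S c) (hDS : D ⊆ S)
    (hD : IsCobound r D c)
    (hconn : ∀ s ∈ S, ConnOn r {a | a ∈ D ∧ r a s})
    (hedge : ∀ s ∈ S, ∀ t ∈ S, r s t → ∃ a ∈ D, r a s ∧ r a t) : IsCobound r S c := by
  obtain ⟨d, hd⟩ := hD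
  have hne : ∀ s ∈ S, ∃ a ∈ D, r a s := fun s hs => by
    obtain ⟨a, ha, h, -⟩ := hedge s hs s hs (hr s hs)
    exact ⟨a, ha, h⟩
  choose! a haD has using hne
  have key : ∀ s ∈ S, ∀ b ∈ D, r b s → d (a s) * c (a s) s = d b * c b s := by
    intro s hs b hb hbs
    refine (hconn s hs).eq_of_forall (f := fun b => d b * c b s) ?_ ⟨haD s hs, has s hs⟩ ⟨hb, hbs⟩
    rintro x ⟨hx, hxs⟩ y ⟨hy, hys⟩ hxy
    rw [← hd x hx y hy hxy, mul_assoc, hc x (hDS hx) y (hDS hy) s hs hxy hys hxs]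
  refine ⟨fun s => d (a s) * c (a s) s, fun s hs t ht hst => ?_⟩
  obtain ⟨b, hb, hbs, hbt⟩ := hedge s hs t ht hst
  change d (a s) * c (a s) s * c s t = d (a t) * c (a t) t
  rw [key s hs b hb hbs, key t ht b hb hbt, mul_assoc, hc b (hDS hb) s hs t ht hbs hst hbt]

/-- Cocycles are coboundaries on the neighbours of a vertex. -/
theorem IsCocycle.isCobound_neighbors (hc : IsCocycle r S c) {x : α}
    (hx : x ∈ S) : IsCobound r {y | y ∈ S ∧ r x y} c :=
  ⟨c x, fun y hy z hz h => hc x hx y hy.1 z hz.1 hy.2 h hz.2⟩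

/-- A nerve argument: if `S` contains cliques `E A` such that related indices have overlapping
cliques, then triviality of cocycles on the index set implies triviality on all sets `D` of vertices
lying in compatible cliques. -/
theorem IsCocycle.isCobound_of_cliques {β : Type*} {ρ : β → β → Prop} {J : Set β} {E : β → Set α}
    (hc : IsCocycle r S c) (hES : ∀ A ∈ J, E A ⊆ S)
    (hE : ∀ A ∈ J, ∀ a ∈ E A, ∀ b ∈ E A, r a b) (hρ : ∀ A ∈ J, ρ A A)
    (hEE : ∀ A ∈ J, ∀ B ∈ J, ρ A B → (E A ∩ E B).Nonempty)
    (htriv : ∀ g : β → β → H, IsCocycle ρ J g → IsCobound ρ J g)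
    (L : α → β) (hL : ∀ s ∈ D, L s ∈ J ∧ s ∈ E (L s))
    (hLr : ∀ s ∈ D, ∀ t ∈ D, r s t → ρ (L s) (L t)) : IsCobound r D c := by
  have hcE : ∀ A ∈ J, ∀ x ∈ E A, ∀ y ∈ E A, ∀ z ∈ E A, c x y * c y z = c x z :=
    fun A hA x hx y hy z hz => hc x (hES A hA hx) y (hES A hA hy) z (hES A hA hz)
      (hE A hA x hx y hy) (hE A hA y hy z hz) (hE A hA x hx z hz)
  rcases isEmpty_or_nonempty α with hα | hα
  · exact ⟨fun _ => 1, fun x => isEmptyElim x⟩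
  have hv : ∀ A ∈ J, ∃ v, v ∈ E A := fun A hA =>
    let ⟨v, hv⟩ := hEE A hA A hA (hρ A hA)
    ⟨v, hv.1⟩
  choose! v hv using hv
  have ht : ∀ A B, ∃ t, A ∈ J → B ∈ J → ρ A B → t ∈ E A ∧ t ∈ E B := fun A B => by
    by_cases h : A ∈ J ∧ B ∈ J ∧ ρ A B
    · obtain ⟨t, ht⟩ := hEE A h.1 B h.2.1 h.2.2
      exact ⟨t, fun _ _ _ => ht⟩
    · exact ⟨v A, fun h1 h2 h3 => absurd ⟨h1, h2, h3⟩ h⟩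
  choose t ht using ht
  obtain ⟨δ, hδ⟩ := htriv (fun A B => c (v A) (t A B) * c (t A B) (v B)) (by
    intro A hA B hB C hC hAB hBC hAC
    obtain ⟨h1, h2⟩ := ht A B hA hB hAB
    obtain ⟨h3, h4⟩ := ht B C hB hC hBC
    obtain ⟨h5, h6⟩ := ht A C hA hC hAC
    have e1 := hcE B hB _ h2 _ (hv B hB) _ h3
    have e2 := hcE A hA _ (hv A hA) _ h5 _ h1
    have e3 := hcE C hC _ h6 _ h4 _ (hv C hC)
    have e5 := hc _ (hES A hA h5) _ (hES A hA h1) _ (hES B hB h3) (hE A hA _ h5 _ h1)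
      (hE B hB _ h2 _ h3) (hE C hC _ h6 _ h4)
    calc c (v A) (t A B) * c (t A B) (v B) * (c (v B) (t B C) * c (t B C) (v C))
        = c (v A) (t A B) * (c (t A B) (v B) * c (v B) (t B C)) * c (t B C) (v C) := by group
      _ = c (v A) (t A C) * (c (t A C) (t A B) * c (t A B) (t B C)) * c (t B C) (v C) := by
        rw [e1, ← e2]; group
      _ = c (v A) (t A C) * c (t A C) (v C) := by rw [e5, mul_assoc, e3])
  refine ⟨fun s => δ (L s) * c (v (L s)) s, fun x hx y hy hxy => ?_⟩
  obtain ⟨hLx, hxE⟩ := hL x hx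
  obtain ⟨hLy, hyE⟩ := hL y hy
  obtain ⟨h1, h2⟩ := ht _ _ hLx hLy (hLr x hx y hy hxy)
  have hδ' := hδ _ hLx _ hLy (hLr x hx y hy hxy)
  have e1 := hcE _ hLx _ (hv _ hLx) _ hxE _ h1
  have e2 := hcE _ hLy _ h2 _ (hv _ hLy) _ hyE
  have e3 := hc _ (hES _ hLx hxE) _ (hES _ hLx h1) _ (hES _ hLy hyE) (hE _ hLx _ hxE _ h1)
    (hE _ hLy _ h2 _ hyE) hxy
  calc δ (L x) * c (v (L x)) x * c x y
      = δ (L x) * (c (v (L x)) x * c x (t (L x) (L y))) * c (t (L x) (L y)) y := by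
        rw [← e3]; group
    _ = δ (L x) * (c (v (L x)) (t (L x) (L y)) * c (t (L x) (L y)) (v (L y))) * c (v (L y)) y := by
        rw [e1, ← e2]; group
    _ = δ (L y) * c (v (L y)) y := by rw [hδ']

end CocycleTools

section SimplyConnected

universe u

variable {G : Type u} [Group G]

theorem simplyConnectedSpace_apSet (hne : (involutions G).Nonempty)
    (hconn : ConnOn Commute (involutions G))
    (htriv : ∀ (H : Type u) [Group H] (c : G → G → H), IsCocycle Commute (involutions G) c →
      IsCobound Commute (involutions G) c) :
    SimplyConnectedSpace (geomRealOn (apSet 2 G)) := by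
  obtain ⟨s, hs⟩ := hne
  exact simplyConnectedSpace_of_isCobound ⟨_, closure_singleton_mem_apSet hs⟩
    (connOn_apSet hconn) fun H _ c hc => isCobound_apSet (htriv H) c hc

end SimplyConnected

section EvenInvolutions

open Equiv

variable {α : Type*}

theorem apply_apply_of_sq {s : Perm α} (h : s ^ 2 = 1) (x : α) : s (s x) = x := by
  rw [← Perm.mul_apply, ← sq, h, Perm.one_apply]

theorem sq_eq_one_of_apply {s : Perm α} (h : ∀ x, s (s x) = x) : s ^ 2 = 1 := by
  ext x
  rw [sq, Perm.mul_apply, h, Perm.one_apply]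

theorem commute_apply {s t : Perm α} (h : Commute s t) (x : α) : s (t x) = t (s x) := by
  rw [← Perm.mul_apply, h.eq, Perm.mul_apply]

theorem commute_of_apply {s t : Perm α} (h : ∀ x, s (t x) = t (s x)) : Commute s t :=
  Equiv.ext h

/-- The even permutations of order two. -/
def evenInvolutions (α : Type*) [DecidableEq α] [Fintype α] : Set (Perm α) :=
  {s | s ≠ 1 ∧ s ^ 2 = 1 ∧ Perm.sign s = 1}

/-- The products of two disjoint transpositions of elements of `X`. -/
def doubleSwaps {α : Type*} [DecidableEq α] (X : Set α) : Set (Perm α) :=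
  {s | ∃ a b c d, a ∈ X ∧ b ∈ X ∧ c ∈ X ∧ d ∈ X ∧ [a, b, c, d].Nodup ∧ s = swap a b * swap c d}

theorem doubleSwaps_mono [DecidableEq α] {X Y : Set α} (h : X ⊆ Y) :
    doubleSwaps X ⊆ doubleSwaps Y := by
  rintro _ ⟨a, b, c, d, ha, hb, hc, hd, h', rfl⟩
  exact ⟨a, b, c, d, h ha, h hb, h hc, h hd, h', rfl⟩

variable [DecidableEq α] [Fintype α]

theorem swap_mul_swap_mem_evenInvolutions {a b c d : α} (h : [a, b, c, d].Nodup) :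
    swap a b * swap c d ∈ evenInvolutions α := by
  simp only [List.nodup_cons, List.mem_cons, List.not_mem_nil, or_false, not_or] at h
  obtain ⟨⟨hab, hac, had⟩, ⟨hbc, hbd⟩, hcd, -⟩ := h
  refine ⟨fun h => hab ?_, sq_eq_one_of_apply fun x => ?_, by simp [hab, hcd]⟩
  · have := congrArg (· a) h
    simpa [swap_apply_of_ne_of_ne hac had, eq_comm] using this
  · simp only [Perm.mul_apply, swap_apply_def]
    grind

theorem doubleSwaps_subset (X : Set α) : doubleSwaps X ⊆ evenInvolutions α := by
  rintro _ ⟨a, b, c, d, -, -, -, -, h, rfl⟩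
  exact swap_mul_swap_mem_evenInvolutions h

theorem support_swap_mul_swap_of_nodup {a b c d : α} (h : [a, b, c, d].Nodup) :
    (swap a b * swap c d).support = {a, b, c, d} := by
  simp only [List.nodup_cons, List.mem_cons, List.not_mem_nil, or_false, not_or] at h
  ext x
  simp only [Perm.mem_support, Perm.mul_apply, swap_apply_def, Finset.mem_insert,
    Finset.mem_singleton]
  grind

theorem card_support_swap_mul_swap {a b c d : α} (h : [a, b, c, d].Nodup) :
    (swap a b * swap c d).support.card = 4 := by
  rw [support_swap_mul_swap_of_nodup h]
  simpa using List.toFinset_card_of_nodup h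

theorem sign_eq_one_iff_of_sq {s : Perm α} (h : s ^ 2 = 1) :
    Perm.sign s = 1 ↔ 4 ∣ s.support.card := by
  have h2 : ∀ k ∈ s.cycleType, k = 2 := fun k hk => by
    have h1 := (Perm.dvd_of_mem_cycleType hk).trans (orderOf_dvd_of_pow_eq_one h)
    exact le_antisymm (Nat.le_of_dvd two_pos h1) (Perm.two_le_of_mem_cycleType hk)
  have hrep := Multiset.eq_replicate_card.2 h2
  have hsum : s.support.card = 2 * s.cycleType.card := by
    rw [← Perm.sum_cycleType, hrep, Multiset.sum_replicate, Multiset.card_replicate, smul_eq_mul,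
      mul_comm]
  rw [Perm.sign_of_cycleType, Perm.sum_cycleType, hsum, pow_add, pow_mul]
  simp only [even_two, Even.neg_pow, one_pow, one_mul]
  rw [show (-1 : ℤˣ) ^ s.cycleType.card = 1 ↔ Even s.cycleType.card from
    neg_one_pow_eq_one_iff_even (by decide)]
  rw [even_iff_two_dvd, show 4 = 2 * 2 from rfl]
  exact (Nat.mul_dvd_mul_iff_left two_pos).symm

end EvenInvolutions

section Cliques

open Equiv

variable {α : Type*} [DecidableEq α] [Fintype α]

/-- The even involutions preserving the fibres of `χ` which are trivial or fixed point free on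
each of them. -/
def fibreClique (χ : α → Bool) : Set (Perm α) :=
  {s | s ∈ evenInvolutions α ∧ (∀ i, χ (s i) = χ i) ∧
    ∀ v, (∀ i, χ i = v → s i = i) ∨ ∀ i, χ i = v → s i ≠ i}

theorem commute_of_mem_fibreClique {χ : α → Bool}
    (hχ : ∀ v, (Finset.univ.filter fun i => χ i = v).card = 4) {s t : Perm α}
    (hs : s ∈ fibreClique χ) (ht : t ∈ fibreClique χ) : Commute s t := by
  obtain ⟨⟨-, hs2, -⟩, hsχ, hs⟩ := hs
  obtain ⟨⟨-, ht2, -⟩, htχ, ht⟩ := ht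
  replace hs2 := apply_apply_of_sq hs2
  replace ht2 := apply_apply_of_sq ht2
  refine commute_of_apply fun i => ?_
  rcases hs (χ i) with h | h
  · rw [h i rfl, h (t i) (htχ i)]
  rcases ht (χ i) with h' | h'
  · rw [h' i rfl, h' (s i) (hsχ i)]
  by_cases hst : s i = t i
  · rw [← hst, hs2, hst, ht2]
  by_contra hne
  have h1 := h i rfl
  have h2 := h' i rfl
  have h3 := h (t i) (htχ i)
  have h4 := h' (s i) (hsχ i)
  have h5 := hs2 i
  have h6 := ht2 i
  have hsub : ({i, s i, t i, s (t i), t (s i)} : Finset α) ⊆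
      Finset.univ.filter fun j => χ j = χ i := by
    intro j
    simp only [Finset.mem_insert, Finset.mem_singleton, Finset.mem_filter, Finset.mem_univ,
      true_and]
    rintro (rfl | rfl | rfl | rfl | rfl) <;> simp [hsχ, htχ]
  have hcard := Finset.card_le_card hsub
  rw [hχ, Finset.card_insert_of_notMem, Finset.card_insert_of_notMem, Finset.card_insert_of_notMem,
    Finset.card_insert_of_notMem, Finset.card_singleton] at hcard
  · omega
  all_goals
    simp only [Finset.mem_insert, Finset.mem_singleton, not_or]
    grind

theorem fibreClique_congr {χ ψ : α → Bool} (h : ∀ i j, χ i = χ j ↔ ψ i = ψ j) :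
    fibreClique χ ⊆ fibreClique ψ := by
  rintro s ⟨hs, h1, h2⟩
  refine ⟨hs, fun i => (h _ _).1 (h1 i), fun v => ?_⟩
  by_cases hv : ∃ j, ψ j = v
  · obtain ⟨j, rfl⟩ := hv
    simpa only [← h] using h2 (χ j)
  · exact .inl fun i hi => absurd ⟨i, hi⟩ hv

theorem fibreClique_inter_nonempty {χ ψ : α → Bool}
    (hχ : ∀ v, (Finset.univ.filter fun i => χ i = v).card = 4)
    (hψ : ∀ v, (Finset.univ.filter fun i => ψ i = v).card = 4)
    (h : Even (Finset.univ.filter fun i => χ i = true ∧ ψ i = true).card) :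
    (fibreClique χ ∩ fibreClique ψ).Nonempty := by
  have split : ∀ u v, (Finset.univ.filter fun i => χ i = u ∧ ψ i = v).card +
      (Finset.univ.filter fun i => χ i = u ∧ ψ i = !v).card = 4 := fun u v => by
    rw [← hχ u, ← Finset.card_filter_add_card_filter_not (s := Finset.univ.filter fun i => χ i = u)
      (fun i => ψ i = v), Finset.filter_filter, Finset.filter_filter]
    simp only [Bool.eq_not, ne_eq]
  have split' : ∀ u v, (Finset.univ.filter fun i => χ i = u ∧ ψ i = v).card +
      (Finset.univ.filter fun i => (χ i = !u) ∧ ψ i = v).card = 4 := fun u v => by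
    rw [← hψ v, ← Finset.card_filter_add_card_filter_not (s := Finset.univ.filter fun i => ψ i = v)
      (fun i => χ i = u), Finset.filter_filter, Finset.filter_filter]
    simp only [Bool.eq_not, ne_eq, and_comm]
  have s1 := split true true
  have s2 := split' true true
  have s3 := split false true
  by_cases h2 : (Finset.univ.filter fun i => χ i = true ∧ ψ i = true).card = 2
  · have hcard : ∀ u v, (Finset.univ.filter fun i => χ i = u ∧ ψ i = v).card = 2 := by
      intro u v
      simp only [Bool.not_true] at s1 s2 s3
      cases u <;> cases v <;> omega
    have hpq : ∀ u v, ∃ p q, p ≠ q ∧ ∀ i, (χ i = u ∧ ψ i = v) ↔ i = p ∨ i = q := fun u v => by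
      obtain ⟨p, q, hpq, h⟩ := Finset.card_eq_two.1 (hcard u v)
      refine ⟨p, q, hpq, fun i => ?_⟩
      simpa using Finset.ext_iff.1 h i
    choose p q hne hpq using hpq
    let f (i : α) : α := swap (p (χ i) (ψ i)) (q (χ i) (ψ i)) i
    have hf : ∀ i, χ (f i) = χ i ∧ ψ (f i) = ψ i ∧ f i ≠ i := fun i => by
      have h3 : ∀ P Q, p (χ i) (ψ i) = P → q (χ i) (ψ i) = Q → f i = swap P Q i := by
        rintro _ _ rfl rfl
        rfl
      rcases (hpq (χ i) (ψ i) i).1 ⟨rfl, rfl⟩ with h1 | h1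
      · have h4 : f i = q (χ i) (ψ i) := by
          rw [h3 i _ h1.symm rfl, swap_apply_left]
        have h5 := (hpq (χ i) (ψ i) (f i)).2 (.inr h4)
        exact ⟨h5.1, h5.2, fun h6 => hne (χ i) (ψ i) (by rw [← h1, ← h4, h6])⟩
      · have h4 : f i = p (χ i) (ψ i) := by
          rw [h3 _ i rfl h1.symm, swap_apply_right]
        have h5 := (hpq (χ i) (ψ i) (f i)).2 (.inl h4)
        exact ⟨h5.1, h5.2, fun h6 => hne (χ i) (ψ i) (by rw [← h1, ← h4, h6])⟩
    have hff : Involutive f := fun i => by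
      change swap (p (χ (f i)) (ψ (f i))) (q (χ (f i)) (ψ (f i))) (f i) = i
      rw [(hf i).1, (hf i).2.1]
      exact swap_apply_self _ _ _
    have hsq : hff.toPerm ^ 2 = 1 := sq_eq_one_of_apply hff
    have hsupp : hff.toPerm.support = Finset.univ :=
      Finset.eq_univ_of_forall fun i => Perm.mem_support.2 (hf i).2.2
    have huniv : (Finset.univ : Finset α).card = 8 := by
      rw [← Finset.card_filter_add_card_filter_not (fun i => χ i = true), hχ]
      simp only [Bool.not_eq_true, hχ]
    have hmem : hff.toPerm ∈ evenInvolutions α := by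
      refine ⟨fun h1 => ?_, hsq, ?_⟩
      · rw [← Perm.support_eq_empty_iff, hsupp] at h1
        rw [h1, Finset.card_empty] at huniv
        omega
      · rw [sign_eq_one_iff_of_sq hsq, hsupp, huniv]
        decide
    exact ⟨hff.toPerm, ⟨hmem, fun i => (hf i).1, fun v => .inr fun i _ => (hf i).2.2⟩,
      hmem, fun i => (hf i).2.1, fun v => .inr fun i _ => (hf i).2.2⟩
  · have hiff : ∀ i j, χ i = χ j ↔ ψ i = ψ j := by
      have h04 : (Finset.univ.filter fun i => χ i = true ∧ ψ i = true).card = 0 ∨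
          (Finset.univ.filter fun i => χ i = true ∧ ψ i = false).card = 0 := by
        rw [Bool.not_true] at s1
        obtain ⟨k, hk⟩ := h
        omega
      have h04' : (Finset.univ.filter fun i => χ i = true ∧ ψ i = true).card = 0 ∧
          (Finset.univ.filter fun i => χ i = false ∧ ψ i = false).card = 0 ∨
          (Finset.univ.filter fun i => χ i = true ∧ ψ i = false).card = 0 ∧
          (Finset.univ.filter fun i => χ i = false ∧ ψ i = true).card = 0 := by
        simp only [Bool.not_true] at s1 s2 s3
        omega
      simp only [Finset.card_eq_zero, Finset.filter_eq_empty_iff, Finset.mem_univ,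
        true_implies] at h04'
      intro i j
      rcases h04' with ⟨h1, h2⟩ | ⟨h1, h2⟩ <;>
      · have a1 := @h1 i
        have a2 := @h1 j
        have a3 := @h2 i
        have a4 := @h2 j
        revert a1 a2 a3 a4
        generalize χ i = x1
        generalize χ j = x2
        generalize ψ i = x3
        generalize ψ j = x4
        revert x1 x2 x3 x4
        decide
    suffices h : (fibreClique χ).Nonempty by
      obtain ⟨s, hs⟩ := h
      exact ⟨s, hs, fibreClique_congr hiff hs⟩
    obtain ⟨a, b, c, d, hab, hac, had, hbc, hbd, hcd, heq⟩ := Finset.card_eq_four.1 (hχ true)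
    have hmem : ∀ i, χ i = true ↔ i = a ∨ i = b ∨ i = c ∨ i = d := fun i => by
      simpa using Finset.ext_iff.1 heq i
    refine ⟨swap a b * swap c d, swap_mul_swap_mem_evenInvolutions (by simp; grind), fun i => ?_,
      Bool.forall_bool.2 ⟨.inl fun i hi => ?_, .inr fun i hi => ?_⟩⟩
    · rw [Bool.eq_iff_iff, hmem, hmem, Perm.mul_apply]
      simp only [swap_apply_def]
      grind
    · have hi' := (hmem i).not.1 (by simp [hi])
      rw [Perm.mul_apply]
      simp only [swap_apply_def]
      grind
    · have hi' := (hmem i).1 hi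
      rw [Perm.mul_apply]
      simp only [swap_apply_def]
      grind

end Cliques

section EightPoints

open Equiv

/-- The number of common binary digits `1` of `a` and `b` among the lowest eight is even. -/
def evenOverlap (a b : ℕ) : Bool :=
  (fun m : ℕ => (m.testBit 0 ^^ m.testBit 1 ^^ m.testBit 2 ^^ m.testBit 3 ^^ m.testBit 4 ^^
    m.testBit 5 ^^ m.testBit 6 ^^ m.testBit 7) == false) (a &&& b)

/-- The subset of `Fin 8` with the given binary digits, as a function. -/
def bits (m : ℕ) (i : Fin 8) : Bool := m.testBit i

/-- The numbers encoding subsets of `Fin 8` with four elements. -/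
def quads : List ℕ :=
  (List.range 256).filter fun m => (Finset.univ.filter fun i => bits m i = true).card = 4

theorem card_bits_of_mem_quads :
    ∀ m ∈ quads, ∀ v, (Finset.univ.filter fun i => bits m i = v).card = 4 := by
  decide +kernel

theorem bits_ofBits (f : Fin 8 → Bool) : bits (Nat.ofBits f) = f := by
  funext i
  simp [bits]

theorem ofBits_mem_quads {f : Fin 8 → Bool}
    (h : (Finset.univ.filter fun i => f i = true).card = 4) :
    Nat.ofBits f ∈ quads := by
  rw [quads, List.mem_filter, List.mem_range, bits_ofBits, h]
  exact ⟨Nat.ofBits_lt_two_pow f, by simp⟩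

theorem evenOverlap_iff (a b : ℕ) : evenOverlap a b = true ↔
    Even (Finset.univ.filter fun i => bits a i = true ∧ bits b i = true).card := by
  have key : ∀ f : Fin 8 → Bool, ((f 0 ^^ f 1 ^^ f 2 ^^ f 3 ^^ f 4 ^^ f 5 ^^ f 6 ^^ f 7) == false) =
      true ↔ Even (Finset.univ.filter fun i => f i = true).card := by
    decide +kernel
  have h := key (bits (a &&& b))
  simp only [bits, Nat.testBit_and, Bool.and_eq_true] at h
  simp only [evenOverlap, bits, Nat.testBit_and]
  exact h

theorem evenOverlap_link : (quads.all fun s =>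
    (fun l => l.all fun x => l.all fun y => l.any fun z => evenOverlap x z && evenOverlap z y)
      (quads.filter fun x => evenOverlap 15 x && evenOverlap x s)) = true := by
  decide +kernel

theorem evenOverlap_edge : (quads.all fun s => quads.all fun t => !evenOverlap s t ||
    quads.any fun a => evenOverlap 15 a && evenOverlap a s && evenOverlap a t) = true := by
  decide +kernel

theorem evenOverlap_self : (quads.all fun s => evenOverlap s s) = true := by
  decide +kernel

theorem isCobound_quads {H : Type*} [Group H] (g : ℕ → ℕ → H)
    (hg : IsCocycle (fun a b => evenOverlap a b = true) {m | m ∈ quads} g) :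
    IsCobound (fun a b => evenOverlap a b = true) {m | m ∈ quads} g := by
  have hlink := evenOverlap_link
  have hedge := evenOverlap_edge
  have hself := evenOverlap_self
  simp only [List.all_eq_true, List.any_eq_true, List.mem_filter, Bool.and_eq_true,
    Bool.or_eq_true, Bool.not_eq_true'] at hlink hedge hself
  refine IsCobound.extend (D := {y | y ∈ quads ∧ evenOverlap 15 y = true}) ?_ hg
    (fun y hy => hy.1) (hg.isCobound_neighbors (x := 15) ?_) ?_ ?_
  · exact hself
  · decide +kernel
  · rintro s hs x ⟨⟨hx, h1⟩, h2⟩ y ⟨⟨hy, h3⟩, h4⟩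
    obtain ⟨z, ⟨hz, h5, h6⟩, h7, h8⟩ := hlink s hs x ⟨hx, h1, h2⟩ y ⟨hy, h3, h4⟩
    exact (Relation.ReflTransGen.single ⟨⟨⟨hx, h1⟩, h2⟩, ⟨⟨hz, h5⟩, h6⟩, h7⟩).tail
      ⟨⟨⟨hz, h5⟩, h6⟩, ⟨⟨hy, h3⟩, h4⟩, h8⟩
  · intro s hs t ht hst
    rcases hedge s hs t ht with h | ⟨a, ha, ⟨h1, h2⟩, h3⟩
    · rw [hst] at h
      cases h
    · exact ⟨a, ⟨ha, h1⟩, h2, h3⟩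

theorem even_card_support_inter {α : Type*} [DecidableEq α] [Fintype α] {s t : Perm α}
    (hs : s ^ 2 = 1) (h : Commute s t) : Even (s.support ∩ t.support).card := by
  have h0 : (∑ _i ∈ s.support ∩ t.support, (1 : ZMod 2)) = 0 := by
    refine Finset.sum_involution (fun i _ => s i) (fun _ _ => by decide) (fun i hi _ => ?_)
      (fun i hi => ?_) (fun i _ => apply_apply_of_sq hs i)
    · exact Perm.mem_support.1 (Finset.mem_inter.1 hi).1
    · rw [Finset.mem_inter, Perm.mem_support, Perm.mem_support] at hi ⊢
      exact ⟨fun h1 => hi.1 (s.injective h1),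
        fun h1 => hi.2 (s.injective (by rw [commute_apply h, h1]))⟩
  rw [Finset.sum_const, nsmul_one, ZMod.natCast_eq_zero_iff] at h0
  exact even_iff_two_dvd.2 h0

theorem isCobound_doubleSwaps_fin_eight {H : Type*} [Group H]
    {c : Perm (Fin 8) → Perm (Fin 8) → H} (hc : IsCocycle Commute (evenInvolutions (Fin 8)) c) :
    IsCobound Commute (doubleSwaps Set.univ) c := by
  have hfilter : ∀ s : Perm (Fin 8), (Finset.univ.filter fun i => (!decide (s i = i)) = true) =
      s.support := fun s => by ext; simp
  refine hc.isCobound_of_cliques (ρ := fun a b => evenOverlap a b = true) (J := {m | m ∈ quads})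
    (E := fun m => fibreClique (bits m)) (fun _ _ _ hs => hs.1) (fun m hm s hs t ht =>
      commute_of_mem_fibreClique (card_bits_of_mem_quads m hm) hs ht) ?_ (fun a ha b hb hab =>
      fibreClique_inter_nonempty (card_bits_of_mem_quads a ha) (card_bits_of_mem_quads b hb)
        ((evenOverlap_iff a b).1 hab)) isCobound_quads
    (fun s => Nat.ofBits fun i => !decide (s i = i)) ?_ ?_
  · have hself := evenOverlap_self
    rwa [List.all_eq_true] at hself
  · rintro _ ⟨a, b, c, d, -, -, -, -, h, rfl⟩
    refine ⟨ofBits_mem_quads ?_, ?_⟩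
    · rw [hfilter]
      exact card_support_swap_mul_swap h
    · rw [bits_ofBits]
      refine ⟨swap_mul_swap_mem_evenInvolutions h, fun i => ?_, ?_⟩
      · have := apply_apply_of_sq (swap_mul_swap_mem_evenInvolutions h).2.1 i
        grind
      · exact Bool.forall_bool.2 ⟨.inl fun i hi => of_decide_eq_true (by simpa using hi),
          .inr fun i hi => of_decide_eq_false (by simpa using hi)⟩
  · intro s hs t _ hst
    rw [evenOverlap_iff, bits_ofBits, bits_ofBits, Finset.filter_and, hfilter, hfilter]
    exact even_card_support_inter (doubleSwaps_subset _ hs).2.1 hst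

end EightPoints

section Swaps

open Equiv

variable {α : Type*} [DecidableEq α]

theorem swap_mul_swap_apply {a b c d : α} (h : [a, b, c, d].Nodup) :
    (swap a b * swap c d) a = b ∧ (swap a b * swap c d) b = a ∧ (swap a b * swap c d) c = d ∧
      (swap a b * swap c d) d = c ∧
      ∀ x, x ≠ a → x ≠ b → x ≠ c → x ≠ d → (swap a b * swap c d) x = x := by
  simp only [List.nodup_cons, List.mem_cons, List.not_mem_nil, or_false, not_or] at h
  simp only [Perm.mul_apply, swap_apply_def]
  grind

theorem commute_swap {s : Perm α} {u v : α}
    (h : s u = u ∧ s v = v ∨ s u = v ∧ s v = u) : Commute s (swap u v) := by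
  have := mul_swap_eq_swap_mul s u v
  rcases h with ⟨h1, h2⟩ | ⟨h1, h2⟩
  · rwa [h1, h2] at this
  · rwa [h1, h2, swap_comm v u] at this

theorem commute_swap_mul_swap {s : Perm α} {u v w z : α}
    (h : s u = u ∧ s v = v ∨ s u = v ∧ s v = u) (h' : s w = w ∧ s z = z ∨ s w = z ∧ s z = w) :
    Commute s (swap u v * swap w z) :=
  (commute_swap h).mul_right (commute_swap h')

theorem exists_swap_commute {Y : Finset α} (hY : 5 ≤ Y.card) {u v w z : α} (hu : u ∈ Y)
    (hv : v ∈ Y) (huv : u ≠ v) :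
    ∃ y ∈ Y, ∃ y' ∈ Y, y ≠ y' ∧ Commute (swap u v) (swap y y') ∧
      Commute (swap w z) (swap y y') := by
  by_cases h : (w ≠ u ∧ w ≠ v) ∧ z ≠ u ∧ z ≠ v
  · refine ⟨u, hu, v, hv, huv, .refl _, commute_swap (.inl ⟨?_, ?_⟩)⟩ <;>
    exact swap_apply_of_ne_of_ne (by grind) (by grind)
  · have h1 : ({u, v, w, z} : Finset α).card ≤ 3 := by
      have h2 : ∃ x, ({u, v, w, z} : Finset α) ⊆ {u, v, x} := by
        by_cases hw : w ≠ u ∧ w ≠ v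
        · exact ⟨w, by intro; simp only [Finset.mem_insert, Finset.mem_singleton]; grind⟩
        · exact ⟨z, by intro; simp only [Finset.mem_insert, Finset.mem_singleton]; grind⟩
      obtain ⟨x, hx⟩ := h2
      exact (Finset.card_le_card hx).trans Finset.card_le_three
    have h2 := Finset.le_card_sdiff ({u, v, w, z} : Finset α) Y
    obtain ⟨y, hy, y', hy', hne⟩ := Finset.one_lt_card.1 (show 1 < (Y \ {u, v, w, z}).card by omega)
    simp only [Finset.mem_sdiff, Finset.mem_insert, Finset.mem_singleton, not_or] at hy hy'
    refine ⟨y, hy.1, y', hy'.1, hne, commute_swap (.inl ⟨?_, ?_⟩), commute_swap (.inl ⟨?_, ?_⟩)⟩ <;>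
    exact swap_apply_of_ne_of_ne (by grind) (by grind)

theorem exists_nodup_four {Y : Finset α} (hY : 4 ≤ Y.card) :
    ∃ a b c d, a ∈ Y ∧ b ∈ Y ∧ c ∈ Y ∧ d ∈ Y ∧ [a, b, c, d].Nodup := by
  obtain ⟨Z, hZY, hZ⟩ := Finset.exists_subset_card_eq hY
  obtain ⟨a, b, c, d, hab, hac, had, hbc, hbd, hcd, rfl⟩ := Finset.card_eq_four.1 hZ
  exact ⟨a, b, c, d, hZY (by simp), hZY (by simp), hZY (by simp), hZY (by simp), by simp; grind⟩

theorem exists_eq_of_mem_doubleSwaps_insert {Y : Set α} {p : α}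
    {s : Perm α} (hs : s ∈ doubleSwaps (insert p Y)) (hs' : s ∉ doubleSwaps Y) :
    ∃ a b c, a ∈ Y ∧ b ∈ Y ∧ c ∈ Y ∧ [p, a, b, c].Nodup ∧ s = swap p a * swap b c := by
  obtain ⟨a, b, c, d, ha, hb, hc, hd, h, rfl⟩ := hs
  have hcomm : swap a b * swap c d = swap c d * swap a b := by
    have h1 := swap_mul_swap_apply h
    simp only [List.nodup_cons, List.mem_cons, List.not_mem_nil, or_false, not_or] at h
    refine (commute_swap (.inl ⟨?_, ?_⟩) : Commute (swap a b) (swap c d)).eq <;>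
    exact swap_apply_of_ne_of_ne (by grind) (by grind)
  by_cases hpa : a = p
  · subst hpa
    exact ⟨b, c, d, by grind, by grind, by grind, h, rfl⟩
  by_cases hpb : b = p
  · subst hpb
    exact ⟨a, c, d, by grind, by grind, by grind, by grind, by rw [swap_comm]⟩
  by_cases hpc : c = p
  · subst hpc
    exact ⟨d, a, b, by grind, by grind, by grind, by grind, hcomm⟩
  by_cases hpd : d = p
  · subst hpd
    exact ⟨c, a, b, by grind, by grind, by grind, by grind, by rw [hcomm, swap_comm c]⟩
  · exact absurd ⟨a, b, c, d, by grind, by grind, by grind, by grind, h, rfl⟩ hs'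

end Swaps

section Extension

open Equiv

variable {α H : Type*} [DecidableEq α] [Fintype α] [Group H]

theorem IsCobound.image {G K : Type*} [Group G] [Group K] (φ : G →* K) (hφ : Injective φ)
    {D : Set G}
    {c : K → K → H} (h : IsCobound Commute D fun s t => c (φ s) (φ t)) :
    IsCobound Commute (φ '' D) c := by
  obtain ⟨d, hd⟩ := h
  refine ⟨fun x => d (invFun φ x), ?_⟩
  rintro _ ⟨x, hx, rfl⟩ _ ⟨y, hy, rfl⟩ hxy
  simp only [leftInverse_invFun hφ _]
  exact hd x hx y hy (hφ (by rw [map_mul, hxy.eq, map_mul]))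

theorem isCobound_doubleSwaps_range {c : Perm α → Perm α → H}
    (hc : IsCocycle Commute (evenInvolutions α) c) (f : Fin 8 ↪ α) :
    IsCobound Commute (doubleSwaps (Set.range f)) c := by
  have hswap : ∀ a b : Fin 8, (swap a b).viaFintypeEmbedding f = swap (f a) (f b) := fun a b => by
    ext x
    by_cases hx : x ∈ Set.range f
    · obtain ⟨y, rfl⟩ := hx
      rw [Perm.viaFintypeEmbedding_apply_image, f.injective.swap_apply]
    · rw [Perm.viaFintypeEmbedding_apply_notMem_range _ _ hx, swap_apply_of_ne_of_ne]
      · rintro rfl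
        exact hx ⟨a, rfl⟩
      · rintro rfl
        exact hx ⟨b, rfl⟩
  let φ : Perm (Fin 8) →* Perm α :=
    { toFun := fun s => s.viaFintypeEmbedding f
      map_one' := Perm.extendDomain_one _
      map_mul' := fun s t => (Perm.extendDomain_mul _ s t).symm }
  have hφ : Injective φ := Perm.extendDomainHom_injective (f.toEquivRange)
  have hmaps : ∀ s ∈ evenInvolutions (Fin 8), φ s ∈ evenInvolutions α := fun s hs =>
    ⟨fun h => hs.1 (hφ (h.trans φ.map_one.symm)), by rw [← map_pow, hs.2.1, map_one],
      (Perm.viaFintypeEmbedding_sign _ _).trans hs.2.2⟩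
  have hsub : doubleSwaps (Set.range f) ⊆ φ '' doubleSwaps Set.univ := by
    rintro _ ⟨_, _, _, _, ⟨a, rfl⟩, ⟨b, rfl⟩, ⟨c, rfl⟩, ⟨d, rfl⟩, h, rfl⟩
    refine ⟨swap a b * swap c d, ⟨a, b, c, d, trivial, trivial, trivial, trivial, ?_, rfl⟩, ?_⟩
    · exact List.Nodup.of_map f h
    · rw [map_mul]
      exact congrArg₂ _ (hswap a b) (hswap c d)
  refine IsCobound.mono (IsCobound.image φ hφ (isCobound_doubleSwaps_fin_eight ?_)) hsub
  intro x hx y hy z hz hxy hyz hxz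
  exact hc _ (hmaps x hx) _ (hmaps y hy) _ (hmaps z hz) (hxy.map φ) (hyz.map φ) (hxz.map φ)

end Extension

section Induction

open Equiv

variable {α H : Type*} [DecidableEq α] [Group H]

theorem ConnOn.of_forall_reach {β : Type*} {r : β → β → Prop} {D : Set β}
    (hr : ∀ a b, r a b → r b a)
    (x₀ : β) (h : ∀ x ∈ D, Relation.ReflTransGen (fun a b => a ∈ D ∧ b ∈ D ∧ r a b) x x₀) :
    ConnOn r D := by
  intro x hx y hy
  refine (h x hx).trans ?_
  have := h y hy
  clear hy
  induction this using Relation.ReflTransGen.head_induction_on with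
  | refl => exact .refl
  | head hab _ ih => exact ih.tail ⟨hab.2.1, hab.1, hr _ _ hab.2.2⟩

theorem ConnOn.of_cone {β : Type*} {r : β → β → Prop} {D : Set β} (hr : ∀ a b, r a b → r b a)
    {x₀ : β} (hx₀ : x₀ ∈ D) (h : ∀ x ∈ D, r x x₀) : ConnOn r D :=
  .of_forall_reach hr x₀ fun x hx => .single ⟨hx, hx₀, h x hx⟩

theorem exists_mem_doubleSwaps_commute {Y : Finset α} {p : α} (hp : p ∉ Y) (hY : 8 ≤ Y.card)
    {s t : Perm α} (hs : s ∈ doubleSwaps (insert p (Y : Set α)))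
    (ht : t ∈ doubleSwaps (insert p (Y : Set α))) (hst : Commute s t) :
    ∃ a ∈ doubleSwaps (Y : Set α), Commute a s ∧ Commute a t := by
  by_cases hs' : s ∈ doubleSwaps (Y : Set α)
  · exact ⟨s, hs', .refl s, hst⟩
  by_cases ht' : t ∈ doubleSwaps (Y : Set α)
  · exact ⟨t, ht', hst.symm, .refl t⟩
  obtain ⟨a, b, c, ha, hb, hc, hn, rfl⟩ := exists_eq_of_mem_doubleSwaps_insert hs hs'
  obtain ⟨a', b', c', ha', hb', hc', hn', rfl⟩ := exists_eq_of_mem_doubleSwaps_insert ht ht'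
  obtain ⟨h1, h2, h3, h4, h5⟩ := swap_mul_swap_apply hn
  obtain ⟨h1', h2', h3', h4', h5'⟩ := swap_mul_swap_apply hn'
  have e1 := commute_apply hst p
  have e2 := commute_apply hst b
  have e3 := commute_apply hst c
  generalize swap p a * swap b c = s at *
  generalize swap p a' * swap b' c' = t at *
  simp only [List.nodup_cons, List.mem_cons, List.not_mem_nil, or_false, not_or] at hn hn'
  rw [h1, h1'] at e1
  rw [h3] at e2
  rw [h4] at e3
  have key : (a = a' ∧ b ≠ b' ∧ b ≠ c' ∧ c ≠ b' ∧ c ≠ c') ∨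
      ((a' = a ∨ a' = b ∨ a' = c) ∧ (b' = a ∨ b' = b ∨ b' = c) ∧ (c' = a ∨ c' = b ∨ c' = c)) := by
    by_cases haa : a = a'
    · by_cases hbb : b = b'
      · grind
      · grind
    · have k1 := h5 a'
      have k2 : t a = a' → a = p := fun h => t.injective (h.trans h1'.symm)
      have k3 := h5' a
      have k4 : t a = p → a = a' := fun h => t.injective (h.trans h2'.symm)
      clear hs ht hs' ht' hst hp hY ha hb hc ha' hb' hc' h5 h5' e2 e3
      simp only [List.nodup_nil, not_false_eq_true, and_true] at hn hn'
      obtain ⟨⟨n1, n2, n3⟩, ⟨n4, n5⟩, n6⟩ := hn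
      by_cases hb : a' = b
      · subst hb
        rw [h3] at e1
        grind
      by_cases hc : a' = c
      · subst hc
        rw [h4] at e1
        grind
      exact absurd (k2 (e1.symm.trans (k1 (by grind) (by grind) hb hc))) (by grind)
  rcases key with ⟨rfl, k1, k2, k3, k4⟩ | ⟨k1, k2, k3⟩
  · refine ⟨swap b c * swap b' c', ⟨b, c, b', c', hb, hc, hb', hc', by simp; grind, rfl⟩, ?_, ?_⟩
    · exact (commute_swap_mul_swap (.inr ⟨h3, h4⟩) (.inl ⟨h5 _ (by grind) (by grind) (by grind)
        (by grind), h5 _ (by grind) (by grind) (by grind) (by grind)⟩)).symm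
    · exact (commute_swap_mul_swap (.inl ⟨h5' _ (by grind) (by grind) (by grind)
        (by grind), h5' _ (by grind) (by grind) (by grind) (by grind)⟩) (.inr ⟨h3', h4'⟩)).symm
  · have hcard := Finset.le_card_sdiff ({a, b, c} : Finset α) Y
    have h3c : ({a, b, c} : Finset α).card ≤ 3 := Finset.card_le_three
    obtain ⟨u, v, w, z, hu, hv, hw, hz, huv⟩ :=
      exists_nodup_four (Y := Y \ {a, b, c}) (by lia)
    simp only [Finset.mem_sdiff, Finset.mem_insert, Finset.mem_singleton, not_or] at hu hv hw hz
    have hfix : ∀ x, x ∈ Y ∧ x ≠ a ∧ x ≠ b ∧ x ≠ c → s x = x ∧ t x = x := fun x hx => by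
      have hxp : x ≠ p := by
        rintro rfl
        exact hp hx.1
      exact ⟨h5 x hxp hx.2.1 hx.2.2.1 hx.2.2.2, h5' x hxp (by grind) (by grind) (by grind)⟩
    exact ⟨swap u v * swap w z, ⟨u, v, w, z, hu.1, hv.1, hw.1, hz.1, huv, rfl⟩,
      (commute_swap_mul_swap (.inl ⟨(hfix u hu).1, (hfix v hv).1⟩)
        (.inl ⟨(hfix w hw).1, (hfix z hz).1⟩)).symm,
      (commute_swap_mul_swap (.inl ⟨(hfix u hu).2, (hfix v hv).2⟩)
        (.inl ⟨(hfix w hw).2, (hfix z hz).2⟩)).symm⟩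

theorem connOn_link_doubleSwaps {Y : Finset α} {p : α} (hp : p ∉ Y) (hY : 8 ≤ Y.card)
    {s : Perm α} (hs : s ∈ doubleSwaps (insert p (Y : Set α))) :
    ConnOn Commute {x | x ∈ doubleSwaps (Y : Set α) ∧ Commute x s} := by
  by_cases hs' : s ∈ doubleSwaps (Y : Set α)
  · exact .of_cone (fun _ _ h => h.symm) ⟨hs', .refl s⟩ fun x hx => hx.2
  obtain ⟨a, b, c, ha, hb, hc, hn, rfl⟩ := exists_eq_of_mem_doubleSwaps_insert hs hs'
  obtain ⟨h1, h2, h3, h4, h5⟩ := swap_mul_swap_apply hn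
  generalize swap p a * swap b c = s at *
  simp only [List.nodup_cons, List.mem_cons, List.not_mem_nil, or_false, not_or] at hn
  set T := Y \ {a, b, c} with hT
  have hcard := Finset.le_card_sdiff ({a, b, c} : Finset α) Y
  have h3c : ({a, b, c} : Finset α).card ≤ 3 := Finset.card_le_three
  have hTc : 5 ≤ T.card := by
    rw [hT]
    omega
  have hTmem : ∀ x, x ∈ T ↔ x ∈ Y ∧ x ≠ a ∧ x ≠ b ∧ x ≠ c := fun x => by simp [hT]
  have hfix : ∀ x ∈ T, s x = x := fun x hx => by
    rw [hTmem] at hx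
    exact h5 x (by rintro rfl; exact hp hx.1) hx.2.1 hx.2.2.1 hx.2.2.2
  have hq : ∀ u ∈ T, ∀ v ∈ T, u ≠ v →
      swap b c * swap u v ∈ {x | x ∈ doubleSwaps (Y : Set α) ∧ Commute x s} :=
        fun u hu v hv huv => by
    refine ⟨⟨b, c, u, v, hb, hc, ((hTmem u).1 hu).1, ((hTmem v).1 hv).1, ?_, rfl⟩,
      (commute_swap_mul_swap (.inr ⟨h3, h4⟩) (.inl ⟨hfix u hu, hfix v hv⟩)).symm⟩
    have := (hTmem u).1 hu
    have := (hTmem v).1 hv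
    simp only [List.nodup_cons, List.mem_cons, List.not_mem_nil, or_false, not_or]
    grind
  have hqq : ∀ u ∈ T, ∀ v ∈ T, ∀ w ∈ T, ∀ z ∈ T, Commute (swap u v) (swap w z) →
      Commute (swap b c * swap u v) (swap b c * swap w z) := fun u hu v hv w hw z hz h => by
    have hbc : ∀ u ∈ T, ∀ v ∈ T, Commute (swap b c) (swap u v) := fun u hu v hv => by
      rw [hTmem] at hu hv
      exact commute_swap (.inl ⟨swap_apply_of_ne_of_ne hu.2.2.1 hu.2.2.2,
        swap_apply_of_ne_of_ne hv.2.2.1 hv.2.2.2⟩)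
    exact ((Commute.refl _).mul_right (hbc w hw z hz)).mul_left ((hbc u hu v hv).symm.mul_right h)
  obtain ⟨u₀, hu₀, v₀, hv₀, huv₀⟩ := Finset.one_lt_card.1 (show 1 < T.card by omega)
  refine .of_forall_reach (fun _ _ h => h.symm) (swap b c * swap u₀ v₀) ?_
  intro x hx
  have hxq : ∃ u ∈ T, ∃ v ∈ T, u ≠ v ∧ Commute x (swap b c * swap u v) := by
    obtain ⟨⟨u, v, w, z, hu, hv, hw, hz, hn', rfl⟩, hxs⟩ := hx
    obtain ⟨g1, g2, g3, g4, g5⟩ := swap_mul_swap_apply hn'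
    have e1 := commute_apply hxs p
    have e2 := commute_apply hxs b
    have e3 := commute_apply hxs c
    generalize swap u v * swap w z = x at *
    simp only [List.nodup_cons, List.mem_cons, List.not_mem_nil, or_false, not_or] at hn'
    simp only [Finset.mem_coe] at hu hv hw hz
    have hpx : x p = p := g5 p (by grind) (by grind) (by grind) (by grind)
    rw [h1, hpx, h1] at e1
    have hbc : x b = b ∧ x c = c ∨ x b = c ∧ x c = b := by
      rw [h3] at e2
      rw [h4] at e3
      have k1 := h5 (x b)
      have k2 : x b = p → b = p := fun h => x.injective (h.trans hpx.symm)
      have k3 : x b = a → b = a := fun h => x.injective (h.trans e1.symm)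
      have k4 : x b = b → x c = c := fun h => by rw [e2, h, h3]
      have k5 : x b = c → x c = b := fun h => by rw [e2, h, h4]
      clear hq hqq hfix hTmem
      grind
    by_cases hub : u = b ∨ u = c
    · refine ⟨w, (hTmem w).2 ⟨hw, ?_, ?_, ?_⟩, z, (hTmem z).2 ⟨hz, ?_, ?_, ?_⟩, by grind,
        commute_swap_mul_swap hbc (.inr ⟨g3, g4⟩)⟩ <;> clear hq hqq hfix hTmem <;> grind
    · refine ⟨u, (hTmem u).2 ⟨hu, ?_, ?_, ?_⟩, v, (hTmem v).2 ⟨hv, ?_, ?_, ?_⟩, by grind,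
        commute_swap_mul_swap hbc (.inr ⟨g1, g2⟩)⟩ <;> clear hq hqq hfix hTmem <;> grind
  obtain ⟨u, hu, v, hv, huv, hxu⟩ := hxq
  obtain ⟨y, hy, y', hy', hyy, k1, k2⟩ := exists_swap_commute (Y := T) (by omega)
    (w := u₀) (z := v₀) hu hv huv
  exact ((Relation.ReflTransGen.single ⟨hx, hq u hu v hv huv, hxu⟩).tail
    ⟨hq u hu v hv huv, hq y hy y' hy' hyy, hqq u hu v hv y hy y' hy' k1⟩).tail
    ⟨hq y hy y' hy' hyy, hq u₀ hu₀ v₀ hv₀ huv₀, (hqq u₀ hu₀ v₀ hv₀ y hy y' hy' k2).symm⟩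

theorem isCobound_doubleSwaps [Fintype α] {c : Perm α → Perm α → H}
    (hc : IsCocycle Commute (evenInvolutions α) c) {n : ℕ} (hn : 8 ≤ n) :
    ∀ X : Finset α, X.card = n → IsCobound Commute (doubleSwaps (X : Set α)) c := by
  induction n, hn using Nat.le_induction with
  | base =>
    intro X hX
    have hrange : (X : Set α) =
        Set.range ((X.equivFinOfCardEq hX).symm.toEmbedding.trans (.subtype _)) := by
      ext x
      simp only [Set.mem_range, Embedding.trans_apply, Equiv.coe_toEmbedding,
        Embedding.subtype_apply]
      exact ⟨fun h => ⟨X.equivFinOfCardEq hX ⟨x, h⟩, by simp⟩, by rintro ⟨y, rfl⟩; simp⟩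
    rw [hrange]
    exact isCobound_doubleSwaps_range hc _
  | succ n hn ih =>
    intro X hX
    obtain ⟨p, Y, hp, rfl, hY⟩ := Finset.card_eq_succ.1 hX
    rw [Finset.coe_insert]
    exact (IsCobound.extend (fun _ _ => Commute.refl _) (hc.mono (doubleSwaps_subset _))
      (doubleSwaps_mono (Set.subset_insert _ _)) (ih Y hY)
      (fun s hs => connOn_link_doubleSwaps hp (by omega) hs)
      fun s hs t ht hst => exists_mem_doubleSwaps_commute hp (by omega) hs ht hst)

end Induction

section AllInvolutions

open Equiv

theorem nodup_of_apply_ne {α : Type*} {s : Perm α} {p r : α} (hs : s ^ 2 = 1)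
    (hp : s p ≠ p) (hr : s r ≠ r) (h : r ≠ p) (h' : r ≠ s p) : [p, s p, r, s r].Nodup := by
  have k1 : s r = p → r = s p := fun e => by rw [← e, apply_apply_of_sq hs]
  have k2 : s p = s r → p = r := fun e => s.injective e
  simp only [List.nodup_cons, List.mem_cons, List.not_mem_nil, or_false, not_or, List.nodup_nil]
  grind

variable {α : Type*} [DecidableEq α]

section

variable {s t : Perm α} {p r : α}

theorem commute_swap_mul_swap_apply (hs : s ^ 2 = 1) (p r : α) :
    Commute s (swap p (s p) * swap r (s r)) :=
  commute_swap_mul_swap (.inr ⟨rfl, apply_apply_of_sq hs p⟩) (.inr ⟨rfl, apply_apply_of_sq hs r⟩)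

/-- A permutation acting at `p` and `r` either trivially or as `s` preserves these cycles of `s`. -/
theorem commute_swap_mul_swap_apply_of_eq_or (hs : s ^ 2 = 1) (hst : Commute s t)
    (hp : t p = p ∨ t p = s p) (hr : t r = r ∨ t r = s r) :
    Commute t (swap p (s p) * swap r (s r)) := by
  have key : ∀ {x}, t x = x ∨ t x = s x → t x = x ∧ t (s x) = s x ∨ t x = s x ∧ t (s x) = x := by
    intro x hx
    refine hx.imp (fun h => ⟨h, ?_⟩) fun h => ⟨h, ?_⟩
    · rw [← commute_apply hst, h]
    · rw [← commute_apply hst, h, apply_apply_of_sq hs]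
  exact commute_swap_mul_swap (key hp) (key hr)

theorem swap_mul_swap_apply_eq_or (hs : s ^ 2 = 1) (h : [p, s p, r, s r].Nodup) (x : α) :
    (swap p (s p) * swap r (s r)) x = x ∨ (swap p (s p) * swap r (s r)) x = s x := by
  obtain ⟨h1, h2, h3, h4, h5⟩ := swap_mul_swap_apply h
  have k1 := apply_apply_of_sq hs p
  have k2 := apply_apply_of_sq hs r
  generalize swap p (s p) * swap r (s r) = q at *
  clear h
  by_cases hx : x = p ∨ x = s p ∨ x = r ∨ x = s r
  · rcases hx with rfl | rfl | rfl | rfl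
    · exact .inr h1
    · exact .inr (h2.trans k1.symm)
    · exact .inr h3
    · exact .inr (h4.trans k2.symm)
  · simp only [not_or] at hx
    exact .inl (h5 x hx.1 hx.2.1 hx.2.2.1 hx.2.2.2)

theorem swap_mul_swap_mem_doubleSwaps_univ (h : [p, s p, r, s r].Nodup) :
    swap p (s p) * swap r (s r) ∈ doubleSwaps (Set.univ : Set α) :=
  ⟨p, s p, r, s r, trivial, trivial, trivial, trivial, h, rfl⟩

/-- Conjugation by `t` exchanges two cycles of `s`. -/
theorem commute_swap_mul_swap_apply_apply (ht : t ^ 2 = 1) (hst : Commute s t)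
    (h : [p, s p, t p, s (t p)].Nodup) : Commute t (swap p (s p) * swap (t p) (s (t p))) := by
  have h1 := mul_swap_eq_swap_mul t p (s p)
  have h2 := mul_swap_eq_swap_mul t (t p) (s (t p))
  rw [← commute_apply hst] at h1
  rw [commute_apply hst, apply_apply_of_sq ht, apply_apply_of_sq ht] at h2
  have h3 : Commute (swap (t p) (s (t p))) (swap p (s p)) := by
    simp only [List.nodup_cons, List.mem_cons, List.not_mem_nil, or_false, not_or] at h
    exact commute_swap (.inl ⟨swap_apply_of_ne_of_ne (by grind) (by grind),
      swap_apply_of_ne_of_ne (by grind) (by grind)⟩)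
  rw [commute_iff_eq, ← mul_assoc, h1, mul_assoc, commute_apply hst, h2, ← commute_apply hst,
    ← mul_assoc, h3.eq, mul_assoc]

end

variable [Fintype α] {s t : Perm α}

theorem exists_apply_ne (hs : 4 ≤ s.support.card) :
    ∃ p r, s p ≠ p ∧ s r ≠ r ∧ r ≠ p ∧ r ≠ s p := by
  obtain ⟨p, hp⟩ := Finset.card_pos.1 (show 0 < s.support.card by omega)
  obtain ⟨r, hr⟩ := Finset.card_pos.1 (show 0 < (s.support \ {p, s p}).card by
    have := Finset.le_card_sdiff {p, s p} s.support
    have : ({p, s p} : Finset α).card ≤ 2 := Finset.card_le_two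
    omega)
  simp only [Finset.mem_sdiff, Perm.mem_support, Finset.mem_insert, Finset.mem_singleton,
    not_or] at hp hr
  exact ⟨p, r, hp, hr.1, hr.2.1, hr.2.2⟩

theorem four_le_card_support (hs : s ∈ evenInvolutions α) :
    4 ∣ s.support.card ∧ 4 ≤ s.support.card := by
  have h := (sign_eq_one_iff_of_sq hs.2.1).1 hs.2.2
  have h0 : s.support.card ≠ 0 := fun h => hs.1 (Perm.card_support_eq_zero.1 h)
  omega

theorem mem_doubleSwaps_univ_of_card_support (hs : s ∈ evenInvolutions α)
    (h : s.support.card < 8) : s ∈ doubleSwaps (Set.univ : Set α) := by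
  obtain ⟨h4, h4'⟩ := four_le_card_support hs
  obtain ⟨p, r, hp, hr, h1, h2⟩ := exists_apply_ne h4'
  have hn := nodup_of_apply_ne hs.2.1 hp hr h1 h2
  convert swap_mul_swap_mem_doubleSwaps_univ hn
  have hsupp : (swap p (s p) * swap r (s r)).support = s.support := by
    refine Finset.eq_of_subset_of_card_le (fun x hx => ?_) ?_
    · rw [Perm.mem_support] at hx ⊢
      rcases swap_mul_swap_apply_eq_or hs.2.1 hn x with h | h
      · exact absurd h hx
      · rwa [h] at hx
    · rw [card_support_swap_mul_swap hn]
      omega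
  ext x
  by_cases hx : x ∈ s.support
  · rcases swap_mul_swap_apply_eq_or hs.2.1 hn x with h | h
    · rw [← hsupp, Perm.mem_support] at hx
      exact absurd h hx
    · exact h.symm
  · rw [Perm.notMem_support.1 hx, Perm.notMem_support.1 (hsupp ▸ hx)]

theorem exists_mem_doubleSwaps_univ_commute (hs : s ∈ evenInvolutions α)
    (ht : t ∈ evenInvolutions α) (hst : Commute s t) :
    ∃ a ∈ doubleSwaps (Set.univ : Set α), Commute a s ∧ Commute a t := by
  by_cases h : ∃ p, s p ≠ p ∧ t p ≠ p ∧ t p ≠ s p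
  · obtain ⟨p, hp, h1, h2⟩ := h
    have hn := nodup_of_apply_ne (r := t p) hs.2.1 hp
      (fun e => hp (t.injective ((commute_apply hst p).symm.trans e))) h1 h2
    exact ⟨_, swap_mul_swap_mem_doubleSwaps_univ hn, (commute_swap_mul_swap_apply hs.2.1 _ _).symm,
      (commute_swap_mul_swap_apply_apply ht.2.1 hst hn).symm⟩
  · obtain ⟨p, r, hp, hr, h1, h2⟩ := exists_apply_ne (four_le_card_support hs).2
    have key : ∀ x, s x ≠ x → t x = x ∨ t x = s x := fun x hx => by
      by_contra! hx'
      exact h ⟨x, hx, hx'⟩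
    exact ⟨_, swap_mul_swap_mem_doubleSwaps_univ (nodup_of_apply_ne hs.2.1 hp hr h1 h2),
      (commute_swap_mul_swap_apply hs.2.1 _ _).symm,
      (commute_swap_mul_swap_apply_of_eq_or hs.2.1 hst (key p hp) (key r hr)).symm⟩

theorem connOn_link_doubleSwaps_univ (hs : s ∈ evenInvolutions α) :
    ConnOn Commute {x | x ∈ doubleSwaps (Set.univ : Set α) ∧ Commute x s} := by
  by_cases hs' : s ∈ doubleSwaps (Set.univ : Set α)
  · exact .of_cone (fun _ _ h => h.symm) ⟨hs', .refl s⟩ fun x hx => hx.2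
  have h8 : 8 ≤ s.support.card := by
    by_contra! h
    exact hs' (mem_doubleSwaps_univ_of_card_support hs h)
  obtain ⟨p, r, hp, hr, h1, h2⟩ := exists_apply_ne (four_le_card_support hs).2
  have hn := nodup_of_apply_ne hs.2.1 hp hr h1 h2
  refine .of_forall_reach (fun _ _ h => h.symm) (swap p (s p) * swap r (s r)) fun x hx => ?_
  obtain ⟨p', hp', r', hr', h1', h2'⟩ : ∃ p', (s p' ≠ p' ∧ x p' = p') ∧
      ∃ r', (s r' ≠ r' ∧ x r' = r') ∧ r' ≠ p' ∧ r' ≠ s p' := by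
    have hx4 : x.support.card = 4 := by
      obtain ⟨⟨a, b, c, d, -, -, -, -, hn, rfl⟩, -⟩ := hx
      exact card_support_swap_mul_swap hn
    have k1 := Finset.le_card_sdiff x.support s.support
    obtain ⟨p', hp'⟩ := Finset.card_pos.1 (show 0 < (s.support \ x.support).card by omega)
    obtain ⟨r', hr'⟩ := Finset.card_pos.1 (show 0 < ((s.support \ x.support) \ {p', s p'}).card by
      have := Finset.le_card_sdiff {p', s p'} (s.support \ x.support)
      have : ({p', s p'} : Finset α).card ≤ 2 := Finset.card_le_two
      omega)
    simp only [Finset.mem_sdiff, Perm.mem_support, Finset.mem_insert, Finset.mem_singleton,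
      not_or, not_not] at hp' hr'
    exact ⟨p', hp', r', hr'.1, hr'.2⟩
  have hn' := nodup_of_apply_ne hs.2.1 hp'.1 hr'.1 h1' h2'
  have hc := (commute_swap_mul_swap_apply hs.2.1 p r).symm
  have hc' := (commute_swap_mul_swap_apply hs.2.1 p' r').symm
  have hm := swap_mul_swap_mem_doubleSwaps_univ hn
  have hm' := swap_mul_swap_mem_doubleSwaps_univ hn'
  exact (Relation.ReflTransGen.single ⟨hx, ⟨hm', hc'⟩,
    commute_swap_mul_swap_apply_of_eq_or hs.2.1 hx.2.symm (.inl hp'.2) (.inl hr'.2)⟩).tail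
    ⟨⟨hm', hc'⟩, ⟨hm, hc⟩, commute_swap_mul_swap_apply_of_eq_or hs.2.1 hc'.symm
      (swap_mul_swap_apply_eq_or hs.2.1 hn' p) (swap_mul_swap_apply_eq_or hs.2.1 hn' r)⟩

theorem isCobound_evenInvolutions {H : Type*} [Group H] (hα : 8 ≤ Fintype.card α)
    {c : Perm α → Perm α → H} (hc : IsCocycle Commute (evenInvolutions α) c) :
    IsCobound Commute (evenInvolutions α) c := by
  have h := isCobound_doubleSwaps hc hα Finset.univ rfl
  rw [Finset.coe_univ] at h
  exact IsCobound.extend (fun _ _ => Commute.refl _) hc (doubleSwaps_subset _) h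
    (fun s hs => connOn_link_doubleSwaps_univ hs)
    fun s hs t ht hst => exists_mem_doubleSwaps_univ_commute hs ht hst

end AllInvolutions

section ConnectedInvolutions

open Equiv

theorem swap_mul_swap_comm {α : Type*} [DecidableEq α] {a b c d : α}
    (h : [a, b, c, d].Nodup) :
    swap a b * swap c d = swap c d * swap a b := by
  simp only [List.nodup_cons, List.mem_cons, List.not_mem_nil, or_false, not_or] at h
  exact commute_swap (.inl ⟨swap_apply_of_ne_of_ne (by grind) (by grind),
    swap_apply_of_ne_of_ne (by grind) (by grind)⟩)

variable {α : Type*} [DecidableEq α] [Fintype α] {a b c d e f : α}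

/-- Connectedness of even involutions through chains of commuting even involutions. -/
abbrev CommuteChain (s t : Perm α) : Prop :=
  Relation.ReflTransGen
    (fun x y => x ∈ evenInvolutions α ∧ y ∈ evenInvolutions α ∧ Commute x y) s t

theorem CommuteChain.symm {s t : Perm α} (h : CommuteChain s t) : CommuteChain t s :=
  have : Std.Symm fun x y : Perm α => x ∈ evenInvolutions α ∧ y ∈ evenInvolutions α ∧ Commute x y :=
    ⟨fun _ _ h => ⟨h.2.1, h.1, h.2.2.symm⟩⟩
  Relation.ReflTransGen.stdSymm.symm _ _ h

theorem exists_forall_ne (l : List α) (h : l.length < Fintype.card α) : ∃ x, x ∉ l := by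
  by_contra! h'
  have h1 := Finset.card_le_card (show Finset.univ ⊆ l.toFinset from fun x _ => by simpa using h' x)
  have h2 := l.toFinset_card_le
  rw [Finset.card_univ] at h1
  omega

theorem commuteChain_of_adj (hα : 6 ≤ Fintype.card α) (h : [a, b, c, d].Nodup)
    (h' : [a, b, c, e].Nodup) :
    CommuteChain (swap a b * swap c d) (swap a b * swap c e) := by
  rcases eq_or_ne d e with rfl | hde
  · exact .refl
  obtain ⟨f, hf⟩ := exists_forall_ne [a, b, c, d, e] (by simp; omega)
  have n1 : [c, d, e, f].Nodup := by
    simp only [List.nodup_cons, List.mem_cons, List.not_mem_nil, or_false, not_or] at h h' hf ⊢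
    grind
  have n2 : [c, e, d, f].Nodup := by
    simp only [List.nodup_cons, List.mem_cons, List.not_mem_nil, or_false, not_or] at n1 ⊢
    grind
  have n3 : [a, b, e, f].Nodup := by
    simp only [List.nodup_cons, List.mem_cons, List.not_mem_nil, or_false, not_or] at h' hf ⊢
    grind
  have n4 : [a, b, d, f].Nodup := by
    simp only [List.nodup_cons, List.mem_cons, List.not_mem_nil, or_false, not_or] at h hf ⊢
    grind
  have m1 := swap_mul_swap_mem_evenInvolutions h
  have m2 := swap_mul_swap_mem_evenInvolutions n1
  have m3 := swap_mul_swap_mem_evenInvolutions n2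
  have m4 := swap_mul_swap_mem_evenInvolutions h'
  refine ((Relation.ReflTransGen.single ⟨m1, m2, ?_⟩).tail ⟨m2, m3, ?_⟩).tail ⟨m3, m4, ?_⟩
  · have k1 : Commute (swap a b) (swap c e) := swap_mul_swap_comm h'
    have k2 : Commute (swap a b) (swap d f) := swap_mul_swap_comm n4
    have k3 : Commute (swap c e) (swap d f) := swap_mul_swap_comm n2
    exact (k1.symm.mul_right (Commute.refl _)).mul_left (k2.symm.mul_right k3.symm)
  · have k1 : Commute (swap a b) (swap c d) := swap_mul_swap_comm h
    have k2 : Commute (swap a b) (swap e f) := swap_mul_swap_comm n3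
    have k3 : Commute (swap c d) (swap e f) := swap_mul_swap_comm n1
    exact (k1.mul_right k2).mul_left ((Commute.refl _).mul_right k3)
  · obtain ⟨h1, h2, h3, h4, h5⟩ := swap_mul_swap_apply n1
    have := mul_swap_eq_swap_mul (swap c d * swap e f) c e
    have h6 := mul_swap_eq_swap_mul (swap c d * swap e f) d f
    rw [h1, h3] at this
    rw [h2, h4] at h6
    rw [commute_iff_eq, ← mul_assoc, this, mul_assoc, h6, ← mul_assoc, swap_mul_swap_comm n2]

theorem commuteChain_right {c' d' : α} (hα : 6 ≤ Fintype.card α) (h : [a, b, c, d].Nodup)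
    (h' : [a, b, c', d'].Nodup) :
    CommuteChain (swap a b * swap c d) (swap a b * swap c' d') := by
  rcases eq_or_ne d' c with rfl | hne
  · have := commuteChain_of_adj hα h (e := c')
    rw [swap_comm c' d']
    apply this
    simp only [List.nodup_cons, List.mem_cons, List.not_mem_nil, or_false, not_or] at h' ⊢
    grind
  · have n1 : [a, b, c, d'].Nodup := by
      simp only [List.nodup_cons, List.mem_cons, List.not_mem_nil, or_false, not_or] at h h' ⊢
      grind
    have n2 : [a, b, d', c].Nodup := by
      simp only [List.nodup_cons, List.mem_cons, List.not_mem_nil, or_false, not_or] at h h' ⊢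
      grind
    have n3 : [a, b, d', c'].Nodup := by
      simp only [List.nodup_cons, List.mem_cons, List.not_mem_nil, or_false, not_or] at h h' ⊢
      grind
    refine (commuteChain_of_adj hα h n1).trans ?_
    rw [swap_comm c d', swap_comm c' d']
    exact commuteChain_of_adj hα n2 n3

theorem commuteChain_left {b' c' d' : α} (hα : 6 ≤ Fintype.card α) (h : [a, b, c, d].Nodup)
    (h' : [a, b', c', d'].Nodup) :
    CommuteChain (swap a b * swap c d) (swap a b' * swap c' d') := by
  obtain ⟨u, hu⟩ := exists_forall_ne [a, b, b'] (by simp; omega)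
  obtain ⟨v, hv⟩ := exists_forall_ne [a, b, b', u] (by simp; omega)
  have n1 : [a, b, u, v].Nodup := by
    simp only [List.nodup_cons, List.mem_cons, List.not_mem_nil, or_false, not_or] at h hu hv ⊢
    grind
  have n2 : [a, b', u, v].Nodup := by
    simp only [List.nodup_cons, List.mem_cons, List.not_mem_nil, or_false, not_or] at h' hu hv ⊢
    grind
  have n3 : [u, v, a, b].Nodup := by
    simp only [List.nodup_cons, List.mem_cons, List.not_mem_nil, or_false, not_or] at n1 ⊢
    grind
  have n4 : [u, v, a, b'].Nodup := by
    simp only [List.nodup_cons, List.mem_cons, List.not_mem_nil, or_false, not_or] at n2 ⊢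
    grind
  refine (commuteChain_right hα h n1).trans (.trans ?_ (commuteChain_right hα n2 h'))
  rw [swap_mul_swap_comm n1, swap_mul_swap_comm n2]
  exact commuteChain_right hα n3 n4

theorem commuteChain_swap_mul_swap {a' b' c' d' : α} (hα : 6 ≤ Fintype.card α)
    (h : [a, b, c, d].Nodup) (h' : [a', b', c', d'].Nodup) :
    CommuteChain (swap a b * swap c d) (swap a' b' * swap c' d') := by
  rcases eq_or_ne b' a with rfl | hne
  · rw [swap_comm a' b']
    refine commuteChain_left hα h ?_
    simp only [List.nodup_cons, List.mem_cons, List.not_mem_nil, or_false, not_or] at h' ⊢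
    grind
  · obtain ⟨u, hu⟩ := exists_forall_ne [a, b'] (by simp; omega)
    obtain ⟨v, hv⟩ := exists_forall_ne [a, b', u] (by simp; omega)
    have n1 : [a, b', u, v].Nodup := by
      simp only [List.nodup_cons, List.mem_cons, List.not_mem_nil, or_false, not_or] at hu hv ⊢
      grind
    have n2 : [b', a, u, v].Nodup := by
      simp only [List.nodup_cons, List.mem_cons, List.not_mem_nil, or_false, not_or] at n1 ⊢
      grind
    have n3 : [b', a', c', d'].Nodup := by
      simp only [List.nodup_cons, List.mem_cons, List.not_mem_nil, or_false, not_or] at h' ⊢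
      grind
    refine (commuteChain_left hα h n1).trans ?_
    rw [swap_comm a b', swap_comm a' b']
    exact commuteChain_left hα n2 n3

theorem connOn_evenInvolutions (hα : 6 ≤ Fintype.card α) :
    ConnOn Commute (evenInvolutions α) := by
  have key : ∀ s ∈ evenInvolutions α, ∃ a b c d, [a, b, c, d].Nodup ∧
      CommuteChain s (Equiv.swap a b * Equiv.swap c d) := fun s hs => by
    obtain ⟨q, ⟨a, b, c, d, -, -, -, -, hn, rfl⟩, hq, -⟩ :=
      exists_mem_doubleSwaps_univ_commute hs hs (.refl s)
    exact ⟨a, b, c, d, hn, Relation.ReflTransGen.single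
      ⟨hs, swap_mul_swap_mem_evenInvolutions hn, hq.symm⟩⟩
  intro s hs t ht
  obtain ⟨a, b, c, d, hn, h⟩ := key s hs
  obtain ⟨a', b', c', d', hn', h'⟩ := key t ht
  exact (h.trans (commuteChain_swap_mul_swap hα hn hn')).trans h'.symm

end ConnectedInvolutions

section RankTwo

variable {G : Type*} [Group G]

theorem mem_closure_singleton_of_involution {s u : G} (hs : s ∈ involutions G) :
    u ∈ Subgroup.closure {s} ↔ u = 1 ∨ u = s := by
  refine ⟨fun h => ?_, ?_⟩
  · obtain ⟨n, rfl⟩ := Subgroup.mem_closure_singleton.1 h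
    rcases Int.even_or_odd' n with ⟨m, rfl | rfl⟩
    · left
      rw [zpow_mul, zpow_ofNat, hs.2, one_zpow]
    · right
      rw [zpow_add, zpow_mul, zpow_ofNat, hs.2, one_zpow, one_mul, zpow_one]
  · rintro (rfl | rfl)
    exacts [one_mem _, Subgroup.mem_closure_singleton_self _]

variable (G) in
/-- Three pairwise commuting involutions never generate a group of order eight. -/
def InvolutionRankLeTwo : Prop :=
  ∀ s ∈ involutions G, ∀ t ∈ involutions G, ∀ u ∈ involutions G, s ≠ t → Commute s t →
    Commute s u → Commute t u → u = s ∨ u = t ∨ u = s * t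

/-- The elementary abelian `2`-subgroups of rank at least two. -/
def fourGroups (G : Type*) [Group G] : Set (Subgroup G) :=
  {K | K ∈ apSet 2 G ∧ ∃ s ∈ involutions G, ∃ t ∈ involutions G, s ∈ K ∧ t ∈ K ∧ s ≠ t}

section

variable {K H : Subgroup G} {s t u : G}

theorem InvolutionRankLeTwo.eq_of_mem (hG : InvolutionRankLeTwo G) (hK : K ∈ apSet 2 G)
    (hs : s ∈ involutions G)
    (ht : t ∈ involutions G) (hst : s ≠ t) (hsK : s ∈ K) (htK : t ∈ K) (huK : u ∈ K) :
    u = 1 ∨ u = s ∨ u = t ∨ u = s * t := by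
  by_cases hu : u = 1
  · exact .inl hu
  · exact .inr (hG s hs t ht u ⟨hu, apSet_sq hK huK⟩ hst (apSet_commute hK hsK htK)
      (apSet_commute hK hsK huK) (apSet_commute hK htK huK))

theorem InvolutionRankLeTwo.le_of_mem (hG : InvolutionRankLeTwo G) (hK : K ∈ apSet 2 G)
    (hs : s ∈ involutions G)
    (ht : t ∈ involutions G) (hst : s ≠ t) (hsK : s ∈ K) (htK : t ∈ K) (hsH : s ∈ H)
    (htH : t ∈ H) : K ≤ H := by
  intro u hu
  rcases hG.eq_of_mem hK hs ht hst hsK htK hu with rfl | rfl | rfl | rfl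
  exacts [one_mem _, hsH, htH, mul_mem hsH htH]

theorem InvolutionRankLeTwo.mem_fourGroups_of_lt (hG : InvolutionRankLeTwo G) (hH : H ∈ apSet 2 G)
    (hK : K ∈ apSet 2 G)
    (h : H < K) (hs : s ∈ involutions G) (hsH : s ∈ H) :
    K ∈ fourGroups G ∧ H = Subgroup.closure {s} := by
  obtain ⟨t, htK, htH⟩ := SetLike.exists_of_lt h
  have ht : t ∈ involutions G :=
    ⟨fun h => htH (h ▸ one_mem H), apSet_sq hK htK⟩
  have hst : s ≠ t := fun h => htH (h ▸ hsH)
  refine ⟨⟨hK, s, hs, t, ht, h.le hsH, htK, hst⟩, le_antisymm (fun u hu => ?_)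
    (closure_singleton_le hsH)⟩
  rw [mem_closure_singleton_of_involution hs]
  by_contra! hne
  have hu' : u ∈ involutions G := ⟨hne.1, apSet_sq hH hu⟩
  exact htH (hG.le_of_mem hK hs hu' hne.2.symm (h.le hsH) (h.le hu) hsH hu htK)

theorem InvolutionRankLeTwo.not_lt_of_lt (hG : InvolutionRankLeTwo G) {L : Subgroup G}
    (hH : H ∈ apSet 2 G)
    (hK : K ∈ apSet 2 G) (hL : L ∈ apSet 2 G) (h : H < K) : ¬ K < L := by
  intro h'
  obtain ⟨s, hsH, hs⟩ := exists_involution_mem hH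
  have h1 := (hG.mem_fourGroups_of_lt hH hK h hs hsH).2
  have h2 := (hG.mem_fourGroups_of_lt hK hL h' hs (h.le hsH)).2
  exact h.ne (h1.trans h2.symm)

theorem InvolutionRankLeTwo.card_involutions_mem (hG : InvolutionRankLeTwo G)
    (hK : K ∈ fourGroups G) :
    Nat.card {s : G // s ∈ involutions G ∧ s ∈ K} = 3 := by
  classical
  obtain ⟨hK, s, hs, t, ht, hsK, htK, hst⟩ := hK
  have h1 : s * t ≠ 1 := fun h => hst (by
    rw [mul_eq_one_iff_eq_inv.1 h, inv_eq_of_mul_eq_one_left (by rw [← sq, ht.2])])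
  have hfin : {s : G | s ∈ involutions G ∧ s ∈ K} = (({s, t, s * t} : Finset G) : Set G) := by
    ext u
    simp only [Set.mem_ofPred_eq, Finset.coe_insert, Finset.coe_singleton, Set.mem_insert_iff,
      Set.mem_singleton_iff]
    refine ⟨fun hu => (hG.eq_of_mem hK hs ht hst hsK htK hu.2).resolve_left hu.1.1, ?_⟩
    rintro (rfl | rfl | rfl)
    exacts [⟨hs, hsK⟩, ⟨ht, htK⟩, ⟨⟨h1, apSet_sq hK (mul_mem hsK htK)⟩, mul_mem hsK htK⟩]
  have : Nat.card {s : G | s ∈ involutions G ∧ s ∈ K} = 3 := by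
    rw [hfin, Nat.card_coe_set_eq, Set.ncard_coe_finset, Finset.card_eq_three]
    refine ⟨s, t, s * t, hst, fun h => ht.1 ?_, fun h => hs.1 ?_, rfl⟩
    · exact left_eq_mul.1 h
    · exact right_eq_mul.1 h
  exact this

variable [Finite G]

theorem card_apSet_two :
    Nat.card (apSet 2 G) = Nat.card (involutions G) + Nat.card (fourGroups G) := by
  rw [← Nat.card_sum]
  symm
  refine Nat.card_congr (.ofBijective (Sum.elim
    (fun s => ⟨Subgroup.closure {s.1}, closure_singleton_mem_apSet s.2⟩)
    fun K => ⟨K.1, K.2.1⟩) ⟨?_, ?_⟩)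
  · have key : ∀ (s : involutions G) (K : fourGroups G), Subgroup.closure {s.1} ≠ K.1 := by
      rintro s ⟨K, -, t, ht, t', ht', htK, htK', hne⟩ rfl
      rw [mem_closure_singleton_of_involution s.2] at htK htK'
      exact hne ((htK.resolve_left ht.1).trans (htK'.resolve_left ht'.1).symm)
    rintro (s | K) (t | L) h
    · have h' : Subgroup.closure {s.1} = Subgroup.closure {t.1} := congrArg Subtype.val h
      have := (mem_closure_singleton_of_involution t.2).1
        (h' ▸ Subgroup.mem_closure_singleton_self s.1)
      exact congrArg _ (Subtype.ext (this.resolve_left s.2.1))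
    · exact absurd (congrArg Subtype.val h) (key s L)
    · exact absurd (congrArg Subtype.val h).symm (key t K)
    · have h' : K.1 = L.1 := congrArg (fun A : apSet 2 G => A.1) h
      exact congrArg _ (Subtype.ext h')
  · rintro ⟨K, hK⟩
    by_cases h : K ∈ fourGroups G
    · exact ⟨.inr ⟨K, h⟩, rfl⟩
    · obtain ⟨s, hsK, hs⟩ := exists_involution_mem hK
      refine ⟨.inl ⟨s, hs⟩, Subtype.ext (le_antisymm (closure_singleton_le hsK) fun u hu => ?_)⟩
      refine (mem_closure_singleton_of_involution hs).2 (or_iff_not_imp_left.2 fun h1 => ?_)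
      by_contra hne
      exact h ⟨hK, u, ⟨h1, apSet_sq hK hu⟩, s, hs, hu, hsK, hne⟩

theorem InvolutionRankLeTwo.card_lt (hG : InvolutionRankLeTwo G) :
    Nat.card {e : apSet 2 G × apSet 2 G // e.1 < e.2} = 3 * Nat.card (fourGroups G) := by
  have := Fintype.ofFinite (fourGroups G)
  have h : Nat.card (Σ K : fourGroups G, {s : G // s ∈ involutions G ∧ s ∈ K.1}) =
      3 * Nat.card (fourGroups G) := by
    rw [Nat.card_sigma, Finset.sum_congr rfl fun K _ => hG.card_involutions_mem K.2]
    simp [mul_comm]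
  rw [← h]
  symm
  have hlt : ∀ (K : fourGroups G) (s : G), s ∈ involutions G → s ∈ K.1 →
      Subgroup.closure {s} < K.1 := by
    rintro ⟨K, hK, t, ht, t', ht', htK, htK', hne⟩ s hs hsK
    refine lt_of_le_of_ne (closure_singleton_le hsK) ?_
    rintro rfl
    rw [mem_closure_singleton_of_involution hs] at htK htK'
    exact hne ((htK.resolve_left ht.1).trans (htK'.resolve_left ht'.1).symm)
  refine Nat.card_congr (.ofBijective (fun p => ⟨(⟨Subgroup.closure {p.2.1},
    closure_singleton_mem_apSet p.2.2.1⟩, ⟨p.1.1, p.1.2.1⟩), hlt p.1 _ p.2.2.1 p.2.2.2⟩) ⟨?_, ?_⟩)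
  · rintro ⟨⟨K, hK⟩, s, hs, hsK⟩ ⟨⟨L, hL⟩, t, ht, htL⟩ h
    simp only [Subtype.mk.injEq, Prod.mk.injEq] at h
    obtain ⟨h1, rfl⟩ := h
    have := (mem_closure_singleton_of_involution ht).1
      (h1 ▸ Subgroup.mem_closure_singleton_self s)
    obtain rfl := this.resolve_left hs.1
    rfl
  · rintro ⟨⟨⟨H, hH⟩, K, hK⟩, hlt⟩
    obtain ⟨s, hsH, hs⟩ := exists_involution_mem hH
    obtain ⟨h1, h2⟩ := hG.mem_fourGroups_of_lt hH hK hlt hs hsH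
    exact ⟨⟨⟨K, h1⟩, s, hs, hlt.le hsH⟩, Subtype.ext (Prod.ext (Subtype.ext h2.symm) rfl)⟩

theorem InvolutionRankLeTwo.six_mul_card_fourGroups (hG : InvolutionRankLeTwo G) {k : ℕ}
    (hk : ∀ s ∈ involutions G,
    Nat.card {t : G // t ∈ involutions G ∧ s ≠ t ∧ Commute s t} = k) :
    6 * Nat.card (fourGroups G) = Nat.card (involutions G) * k := by
  have := Fintype.ofFinite (fourGroups G)
  have := Fintype.ofFinite (involutions G)
  have h1 : Nat.card (Σ s : involutions G, {t : G // t ∈ involutions G ∧ s.1 ≠ t ∧ Commute s.1 t})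
      = Nat.card (involutions G) * k := by
    rw [Nat.card_sigma, Finset.sum_congr rfl fun s _ => hk s.1 s.2]
    simp
  have h2 : ∀ K : fourGroups G, Nat.card {p : {s : G // s ∈ involutions G ∧ s ∈ K.1} ×
      {s : G // s ∈ involutions G ∧ s ∈ K.1} // p.1 ≠ p.2} = 6 := fun K => by
    have e := Finite.equivFinOfCardEq (hG.card_involutions_mem K.2)
    rw [Nat.card_congr (Equiv.subtypeEquiv (q := fun p : Fin 3 × Fin 3 => p.1 ≠ p.2)
      (e.prodCongr e) fun p => by simp), Nat.card_eq_fintype_card]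
    rfl
  have h3 : Nat.card (Σ K : fourGroups G, {p : {s : G // s ∈ involutions G ∧ s ∈ K.1} ×
      {s : G // s ∈ involutions G ∧ s ∈ K.1} // p.1 ≠ p.2}) = 6 * Nat.card (fourGroups G) := by
    rw [Nat.card_sigma, Finset.sum_congr rfl fun K _ => h2 K]
    simp [mul_comm]
  rw [← h1, ← h3]
  refine Nat.card_congr (.ofBijective (fun q => ⟨⟨q.2.1.1.1, q.2.1.1.2.1⟩, q.2.1.2.1,
    q.2.1.2.2.1, fun h => q.2.2 (Subtype.ext h), apSet_commute q.1.2.1 q.2.1.1.2.2 q.2.1.2.2.2⟩)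
    ⟨?_, ?_⟩)
  · rintro ⟨⟨K, hK⟩, ⟨⟨s, hs, hsK⟩, t, ht, htK⟩, hst⟩
      ⟨⟨L, hL⟩, ⟨⟨s', hs', hsL⟩, t', ht', htL⟩, hst'⟩ h
    obtain ⟨rfl, rfl⟩ : s = s' ∧ t = t' := by
      simp only [Sigma.mk.injEq, Subtype.mk.injEq] at h
      obtain ⟨rfl, h⟩ := h
      exact ⟨rfl, congrArg Subtype.val (eq_of_heq h)⟩
    have hne : s ≠ t := fun h => hst (Subtype.ext h)
    obtain rfl : K = L := le_antisymm (hG.le_of_mem hK.1 hs ht hne hsK htK hsL htL)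
      (hG.le_of_mem hL.1 hs ht hne hsL htL hsK htK)
    rfl
  · rintro ⟨⟨s, hs⟩, t, ht, hst, h⟩
    have hsK : s ∈ Subgroup.closure {s, t} := Subgroup.subset_closure (by simp)
    have htK : t ∈ Subgroup.closure {s, t} := Subgroup.subset_closure (by simp)
    exact ⟨⟨⟨_, closure_pair_mem_apSet hs ht h, s, hs, t, ht, hsK, htK, hst⟩,
      ⟨⟨s, hs, hsK⟩, t, ht, htK⟩, fun h => hst (congrArg Subtype.val h)⟩, rfl⟩

theorem InvolutionRankLeTwo.fundamentalGroup_apSet (hG : InvolutionRankLeTwo G)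
    (hne : (involutions G).Nonempty)
    (hconn : ConnOn Commute (involutions G)) {k n f : ℕ} (hk : ∀ s ∈ involutions G,
      Nat.card {t : G // t ∈ involutions G ∧ s ≠ t ∧ Commute s t} = k)
    (hf : 6 * f = Nat.card (involutions G) * k) (hn : n + Nat.card (involutions G) = 2 * f + 1)
    (x : geomRealOn (apSet 2 G)) :
    Nonempty (FundamentalGroup (geomRealOn (apSet 2 G)) x ≃* FreeGroup (Fin n)) := by
  have h6 := hG.six_mul_card_fourGroups hk
  have hSet : (apSet 2 G).Nonempty := by
    obtain ⟨s, hs⟩ := hne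
    exact ⟨_, closure_singleton_mem_apSet hs⟩
  refine fundamentalGroup_geomRealOn hSet (connOn_apSet hconn)
    (fun H hH K hK L hL h => hG.not_lt_of_lt hH hK hL h) ?_ x
  rw [card_apSet_two, hG.card_lt]
  omega

end

end RankTwo

section Transfer

open Equiv

variable {α : Type*} [DecidableEq α] [Fintype α]

theorem coe_mem_evenInvolutions {s : alternatingGroup α} :
    (s : Perm α) ∈ evenInvolutions α ↔ s ∈ involutions (alternatingGroup α) := by
  have h : Perm.sign (s : Perm α) = 1 := Perm.mem_alternatingGroup.1 s.2
  exact ⟨fun hs => ⟨fun e => hs.1 (by rw [e]; rfl), Subtype.ext (by simpa using hs.2.1)⟩,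
    fun hs => ⟨fun e => hs.1 (Subtype.ext e), by simpa using congrArg Subtype.val hs.2, h⟩⟩

theorem mem_alternatingGroup_of_mem_evenInvolutions {s : Perm α} (hs : s ∈ evenInvolutions α) :
    s ∈ alternatingGroup α := Perm.mem_alternatingGroup.2 hs.2.2

theorem commute_coe {s t : alternatingGroup α} : Commute (s : Perm α) t ↔ Commute s t := by
  simp [commute_iff_eq, Subtype.ext_iff]

open Classical in
/-- A retraction of the symmetric group onto the alternating group. -/
noncomputable def toAlternating (s : Perm α) : alternatingGroup α :=
  if h : s ∈ alternatingGroup α then ⟨s, h⟩ else 1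

theorem coe_toAlternating {s : Perm α} (hs : s ∈ evenInvolutions α) :
    (toAlternating s : Perm α) = s := by
  rw [toAlternating, dif_pos (mem_alternatingGroup_of_mem_evenInvolutions hs)]

theorem toAlternating_coe (s : alternatingGroup α) : toAlternating (s : Perm α) = s := by
  rw [toAlternating, dif_pos s.2]

theorem toAlternating_mem {s : Perm α} (hs : s ∈ evenInvolutions α) :
    toAlternating s ∈ involutions (alternatingGroup α) := by
  rwa [← coe_mem_evenInvolutions, coe_toAlternating hs]

theorem commute_toAlternating {s t : Perm α} (hs : s ∈ evenInvolutions α)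
    (ht : t ∈ evenInvolutions α) (h : Commute s t) :
    Commute (toAlternating s) (toAlternating t) := by
  rwa [← commute_coe, coe_toAlternating hs, coe_toAlternating ht]

theorem connOn_involutions_alternatingGroup (hα : 6 ≤ Fintype.card α) :
    ConnOn Commute (involutions (alternatingGroup α)) := by
  intro s hs t ht
  have h := connOn_evenInvolutions hα s (coe_mem_evenInvolutions.2 hs) t
    (coe_mem_evenInvolutions.2 ht)
  rw [← toAlternating_coe s, ← toAlternating_coe t]
  exact h.lift _ fun a b h => ⟨toAlternating_mem h.1, toAlternating_mem h.2.1,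
    commute_toAlternating h.1 h.2.1 h.2.2⟩

theorem isCobound_involutions_alternatingGroup {H : Type*} [Group H] (hα : 8 ≤ Fintype.card α)
    {c : alternatingGroup α → alternatingGroup α → H}
    (hc : IsCocycle Commute (involutions (alternatingGroup α)) c) :
    IsCobound Commute (involutions (alternatingGroup α)) c := by
  obtain ⟨d, hd⟩ := isCobound_evenInvolutions hα
    (c := fun s t => c (toAlternating s) (toAlternating t))
    fun x hx y hy z hz hxy hyz hxz => hc _ (toAlternating_mem hx) _ (toAlternating_mem hy) _
      (toAlternating_mem hz) (commute_toAlternating hx hy hxy) (commute_toAlternating hy hz hyz)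
      (commute_toAlternating hx hz hxz)
  refine ⟨fun s => d s, fun x hx y hy hxy => ?_⟩
  have := hd x (coe_mem_evenInvolutions.2 hx) y (coe_mem_evenInvolutions.2 hy) (commute_coe.2 hxy)
  simpa only [toAlternating_coe] using this

theorem involutions_alternatingGroup_nonempty (hα : 4 ≤ Fintype.card α) :
    (involutions (alternatingGroup α)).Nonempty := by
  obtain ⟨a, b, c, d, -, -, -, -, h⟩ := exists_nodup_four (Y := (Finset.univ : Finset α)) hα
  exact ⟨_, toAlternating_mem (swap_mul_swap_mem_evenInvolutions h)⟩

theorem simplyConnectedSpace_alternatingGroup {n : ℕ} (hn : 8 ≤ n) :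
    SimplyConnectedSpace (geomRealOn (apSet 2 (alternatingGroup (Fin n)))) :=
  simplyConnectedSpace_apSet (involutions_alternatingGroup_nonempty (by simp; omega))
    (connOn_involutions_alternatingGroup (by simp; omega))
    fun _ _ _ hc => isCobound_involutions_alternatingGroup (by simpa using hn) hc

theorem card_subtype_alternatingGroup {P : Perm α → Prop} (h : ∀ t, P t → t ∈ evenInvolutions α) :
    Nat.card {t : alternatingGroup α // P t} = Nat.card {t : Perm α // P t} :=
  Nat.card_congr ⟨fun t => ⟨t.1.1, t.2⟩,
    fun t => ⟨⟨t.1, mem_alternatingGroup_of_mem_evenInvolutions (h _ t.2)⟩, t.2⟩,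
    fun _ => rfl, fun _ => rfl⟩

end Transfer

section SmallDegree

open Equiv

variable {α : Type*} [DecidableEq α] [Fintype α] {s₀ : Perm α} {L : List (Perm α)}

theorem mem_evenInvolutions_iff_cycleType (hα : Fintype.card α < 8) {s : Perm α} :
    s ∈ evenInvolutions α ↔ s.cycleType = {2, 2} := by
  refine ⟨fun hs => ?_, fun hs => ⟨?_, ?_, ?_⟩⟩
  · obtain ⟨a, b, c, d, -, -, -, -, hn, rfl⟩ := mem_doubleSwaps_univ_of_card_support hs
      ((Finset.card_le_univ _).trans_lt hα)
    exact Perm.cycleType_swap_mul_swap_of_nodup hn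
  · rintro rfl
    simp at hs
  · rw [← orderOf_dvd_iff_pow_eq_one, ← Perm.lcm_cycleType, hs]
    decide
  · rw [Perm.sign_of_cycleType, hs]
    decide

theorem card_evenInvolutions (hα : Fintype.card α < 8) (hα' : 4 ≤ Fintype.card α) :
    Nat.card (evenInvolutions α) =
      (Fintype.card α).factorial / ((Fintype.card α - 4).factorial * 8) := by
  have h : Nat.card (evenInvolutions α) =
      (Finset.univ.filter fun s : Perm α => s.cycleType = {2, 2}).card :=
    Nat.subtype_card _ fun s => by simp [mem_evenInvolutions_iff_cycleType hα]
  rw [h, Perm.card_of_cycleType]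
  simp [hα', mul_assoc]

theorem conj_mem_evenInvolutions {s : Perm α} (hs : s ∈ evenInvolutions α) (g : Perm α) :
    MulAut.conj g s ∈ evenInvolutions α := by
  refine ⟨by simpa using hs.1, by rw [← map_pow, hs.2.1, map_one], ?_⟩
  simp [hs.2.2]

theorem conj_mem_evenInvolutions_iff {s : Perm α} (g : Perm α) :
    MulAut.conj g s ∈ evenInvolutions α ↔ s ∈ evenInvolutions α := by
  refine ⟨fun h => ?_, fun h => conj_mem_evenInvolutions h g⟩
  simpa [mul_assoc] using conj_mem_evenInvolutions h g⁻¹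

theorem exists_conj_eq (hα : Fintype.card α < 8) {s : Perm α} (hs : s ∈ evenInvolutions α)
    (hs₀ : s₀ ∈ evenInvolutions α) : ∃ g : Perm α, MulAut.conj g s = s₀ := by
  rw [mem_evenInvolutions_iff_cycleType hα] at hs hs₀
  exact isConj_iff.1 (Perm.isConj_of_cycleType_eq (hs.trans hs₀.symm))

/-- The list `L` consists of the even involutions centralizing `s₀` and different from it. -/
structure IsCommutingList (s₀ : Perm α) (L : List (Perm α)) : Prop where
  mem : s₀ ∈ evenInvolutions α
  mem_iff : ∀ t, t ∈ L ↔ t ∈ evenInvolutions α ∧ s₀ ≠ t ∧ Commute s₀ t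

theorem exists_eq_swap_mul_swap (hα : Fintype.card α < 8) {t : Perm α}
    (ht : t ∈ evenInvolutions α) : ∃ a b c d : α,
      (a ≠ b ∧ a ≠ c ∧ a ≠ d ∧ b ≠ c ∧ b ≠ d ∧ c ≠ d) ∧ t = swap a b * swap c d := by
  obtain ⟨a, b, c, d, -, -, -, -, hn, rfl⟩ := mem_doubleSwaps_univ_of_card_support ht
    ((Finset.card_le_univ _).trans_lt hα)
  refine ⟨a, b, c, d, ?_, rfl⟩
  simp only [List.nodup_cons, List.mem_cons, List.not_mem_nil, or_false, not_or] at hn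
  grind

theorem IsCommutingList.of_swap (hα : Fintype.card α < 8) (hs₀ : s₀ ∈ evenInvolutions α)
    (hL : ∀ t ∈ L, (t ≠ 1 ∧ t ^ 2 = 1 ∧ Perm.sign t = 1) ∧ s₀ ≠ t ∧ s₀ * t = t * s₀)
    (h : ∀ a b c d : α, a ≠ b ∧ a ≠ c ∧ a ≠ d ∧ b ≠ c ∧ b ≠ d ∧ c ≠ d →
      s₀ * (swap a b * swap c d) = (swap a b * swap c d) * s₀ → swap a b * swap c d ∈ s₀ :: L) :
    IsCommutingList s₀ L := by
  refine ⟨hs₀, fun t => ⟨fun ht => ?_, fun ht => ?_⟩⟩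
  · obtain ⟨h1, h2, h3⟩ := hL t ht
    exact ⟨h1, h2, h3⟩
  · obtain ⟨ht, hne, hst⟩ := ht
    obtain ⟨a, b, c, d, hn, rfl⟩ := exists_eq_swap_mul_swap hα ht
    exact (List.mem_cons.1 (h a b c d hn hst)).resolve_left hne.symm

theorem IsCommutingList.card_eq (hα : Fintype.card α < 8) (hL : IsCommutingList s₀ L)
    (hnd : L.Nodup) {s : alternatingGroup α} (hs : s ∈ involutions (alternatingGroup α)) :
    Nat.card {t // t ∈ involutions (alternatingGroup α) ∧ s ≠ t ∧ Commute s t} = L.length := by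
  obtain ⟨g, hg⟩ := exists_conj_eq hα (coe_mem_evenInvolutions.2 hs) hL.mem
  have h1 := card_subtype_alternatingGroup
    (P := fun t => t ∈ evenInvolutions α ∧ (s : Perm α) ≠ t ∧ Commute (s : Perm α) t) fun t h => h.1
  simp only [coe_mem_evenInvolutions, commute_coe, ne_eq, SetLike.coe_eq_coe] at h1
  rw [h1, ← List.toFinset_card_of_nodup hnd, ← Nat.card_eq_finsetCard]
  refine Nat.card_congr (Equiv.subtypeEquiv (MulAut.conj g).toEquiv fun t => ?_)
  rw [List.mem_toFinset, hL.mem_iff]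
  change _ ↔ MulAut.conj g t ∈ _ ∧ _ ≠ MulAut.conj g t ∧ Commute _ (MulAut.conj g t)
  rw [conj_mem_evenInvolutions_iff, ← hg, (MulAut.conj g).injective.ne_iff, commute_iff_eq,
    commute_iff_eq, ← map_mul, ← map_mul, (MulAut.conj g).injective.eq_iff]

theorem IsCommutingList.involutionRankLeTwo (hα : Fintype.card α < 8) (hL : IsCommutingList s₀ L)
    (h : ∀ t ∈ L, ∀ u ∈ L, t * u = u * t → u = t ∨ u = s₀ * t) :
    InvolutionRankLeTwo (alternatingGroup α) := by
  intro s hs t ht u hu hst h1 h2 h3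
  rw [← coe_mem_evenInvolutions] at hs ht hu
  obtain ⟨g, hg⟩ := exists_conj_eq hα hs hL.mem
  rw [← commute_coe] at h1 h2 h3
  by_cases hsu : s = u
  · exact .inl hsu.symm
  have key : ∀ t : alternatingGroup α, (t : Perm α) ∈ evenInvolutions α → s ≠ t →
      Commute (s : Perm α) t → MulAut.conj g (t : Perm α) ∈ L := fun t ht hne hc =>
    (hL.mem_iff _).2 ⟨conj_mem_evenInvolutions ht g,
      fun h => hne (Subtype.ext ((MulAut.conj g).injective (hg.trans h))),
      hg ▸ hc.map (MulAut.conj g)⟩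
  have := h _ (key t ht hst h1) _ (key u hu hsu h2) (h3.map (MulAut.conj g))
  rw [← hg, ← map_mul, (MulAut.conj g).injective.eq_iff, (MulAut.conj g).injective.eq_iff] at this
  exact .inr (this.imp Subtype.ext Subtype.ext)

theorem IsCommutingList.commute (hα : Fintype.card α < 8) (hL : IsCommutingList s₀ L)
    (h : ∀ t ∈ L, ∀ u ∈ L, t * u = u * t) (x s t : alternatingGroup α) (hx : x ≠ 1)
    (hx2 : x ^ 2 = 1) (hs2 : s ^ 2 = 1) (ht2 : t ^ 2 = 1) (hs : Commute s x) (ht : Commute t x) :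
    Commute s t := by
  obtain ⟨g, hg⟩ := exists_conj_eq hα (coe_mem_evenInvolutions.2 ⟨hx, hx2⟩) hL.mem
  by_cases hs1 : s = 1
  · exact hs1 ▸ Commute.one_left t
  by_cases ht1 : t = 1
  · exact ht1 ▸ Commute.one_right s
  by_cases hxs : x = s
  · exact hxs ▸ ht.symm
  by_cases hxt : x = t
  · exact hxt ▸ hs
  have key : ∀ t : alternatingGroup α, t ≠ 1 → t ^ 2 = 1 → x ≠ t →
      Commute t x → MulAut.conj g (t : Perm α) ∈ L := fun t ht ht2 hne hc =>
    (hL.mem_iff _).2 ⟨conj_mem_evenInvolutions (coe_mem_evenInvolutions.2 ⟨ht, ht2⟩) g,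
      fun h => hne (Subtype.ext ((MulAut.conj g).injective (hg.trans h))),
      hg ▸ (commute_coe.2 hc.symm).map (MulAut.conj g)⟩
  have := h _ (key s hs1 hs2 hxs hs) _ (key t ht1 ht2 hxt ht)
  rw [← map_mul, ← map_mul, (MulAut.conj g).injective.eq_iff] at this
  exact commute_coe.1 this

theorem IsCommutingList.fundamentalGroup (hα : Fintype.card α < 8) (hα' : 6 ≤ Fintype.card α)
    (hL : IsCommutingList s₀ L) (hnd : L.Nodup)
    (h : ∀ t ∈ L, ∀ u ∈ L, t * u = u * t → u = t ∨ u = s₀ * t) {n f : ℕ}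
    (hf : 6 * f = Nat.card (evenInvolutions α) * L.length)
    (hn : n + Nat.card (evenInvolutions α) = 2 * f + 1)
    (x : geomRealOn (apSet 2 (alternatingGroup α))) :
    Nonempty (FundamentalGroup (geomRealOn (apSet 2 (alternatingGroup α))) x ≃*
      FreeGroup (Fin n)) := by
  have hcard : Nat.card (involutions (alternatingGroup α)) = Nat.card (evenInvolutions α) := by
    have := card_subtype_alternatingGroup (P := fun t => t ∈ evenInvolutions α) fun _ h => h
    simp only [coe_mem_evenInvolutions] at this
    exact this
  refine (hL.involutionRankLeTwo hα h).fundamentalGroup_apSet (f := f)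
    (involutions_alternatingGroup_nonempty (by omega)) (connOn_involutions_alternatingGroup hα')
    (fun s hs => hL.card_eq hα hnd hs) ?_ ?_ x
  · rw [hcard, hf]
  · rw [hcard, hn]

end SmallDegree

section Concrete

open Equiv

theorem isCommutingList_four : IsCommutingList (swap 0 1 * swap 2 3 : Perm (Fin 4))
    [swap 0 2 * swap 1 3, swap 0 3 * swap 1 2] :=
  .of_swap (by simp) (swap_mul_swap_mem_evenInvolutions (by simp)) (by decide +kernel)
    (by decide +kernel)

theorem isCommutingList_five : IsCommutingList (swap 0 1 * swap 2 3 : Perm (Fin 5))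
    [swap 0 2 * swap 1 3, swap 0 3 * swap 1 2] :=
  .of_swap (by simp) (swap_mul_swap_mem_evenInvolutions (by simp)) (by decide +kernel)
    (by decide +kernel)

theorem isCommutingList_six : IsCommutingList (swap 0 1 * swap 2 3 : Perm (Fin 6))
    [swap 0 2 * swap 1 3, swap 0 3 * swap 1 2, swap 0 1 * swap 4 5, swap 2 3 * swap 4 5] :=
  .of_swap (by simp) (swap_mul_swap_mem_evenInvolutions (by simp)) (by decide +kernel)
    (by decide +kernel)

set_option maxRecDepth 4000 in
theorem isCommutingList_seven : IsCommutingList (swap 0 1 * swap 2 3 : Perm (Fin 7))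
    [swap 0 2 * swap 1 3, swap 0 3 * swap 1 2, swap 0 1 * swap 4 5, swap 0 1 * swap 4 6,
      swap 0 1 * swap 5 6, swap 2 3 * swap 4 5, swap 2 3 * swap 4 6, swap 2 3 * swap 5 6] :=
  .of_swap (by simp) (swap_mul_swap_mem_evenInvolutions (by simp)) (by decide +kernel)
    (by decide +kernel)

/-- Any two involutions of `A₄` commute, as all of them commute with a common one. -/
theorem commute_alternatingGroup_four (s t : alternatingGroup (Fin 4)) (hs : s ^ 2 = 1)
    (ht : t ^ 2 = 1) : Commute s t := by
  have h : ∀ a b c d : Fin 4, a ≠ b ∧ a ≠ c ∧ a ≠ d ∧ b ≠ c ∧ b ≠ d ∧ c ≠ d →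
      (swap a b * swap c d) * (swap 0 1 * swap 2 3) =
        (swap 0 1 * swap 2 3) * (swap a b * swap c d) := by decide +kernel
  have h₀ := isCommutingList_four.mem
  have key : ∀ t : alternatingGroup (Fin 4), t ^ 2 = 1 →
      Commute t (toAlternating (swap 0 1 * swap 2 3)) := by
    intro t ht
    by_cases ht1 : t = 1
    · exact ht1 ▸ Commute.one_left _
    obtain ⟨a, b, c, d, hn, hq⟩ := exists_eq_swap_mul_swap (by simp)
      (coe_mem_evenInvolutions.2 ⟨ht1, ht⟩)
    rw [← commute_coe, coe_toAlternating h₀, hq]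
    exact h a b c d hn
  obtain ⟨hx, hx2⟩ := toAlternating_mem h₀
  exact isCommutingList_four.commute (by simp) (by decide +kernel) _ s t hx hx2 hs ht
    (key s hs) (key t ht)

theorem fundamentalGroup_six (x : geomRealOn (apSet 2 (alternatingGroup (Fin 6)))) :
    Nonempty (FundamentalGroup (geomRealOn (apSet 2 (alternatingGroup (Fin 6)))) x ≃*
      FreeGroup (Fin 16)) := by
  have hE : Nat.card (evenInvolutions (Fin 6)) = 45 := by
    rw [card_evenInvolutions (by simp) (by simp)]
    simp [Nat.factorial]
  refine isCommutingList_six.fundamentalGroup (f := 30) (by simp) (by simp) ?_ ?_ ?_ ?_ x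
  · decide +kernel
  · decide +kernel
  · rw [hE]; rfl
  · rw [hE]

set_option maxRecDepth 4000 in
theorem fundamentalGroup_seven (x : geomRealOn (apSet 2 (alternatingGroup (Fin 7)))) :
    Nonempty (FundamentalGroup (geomRealOn (apSet 2 (alternatingGroup (Fin 7)))) x ≃*
      FreeGroup (Fin 176)) := by
  have hE : Nat.card (evenInvolutions (Fin 7)) = 105 := by
    rw [card_evenInvolutions (by simp) (by simp)]
    simp [Nat.factorial]
  refine isCommutingList_seven.fundamentalGroup (f := 140) (by simp) (by simp) ?_ ?_ ?_ ?_ x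
  · decide +kernel
  · decide +kernel
  · rw [hE]; rfl
  · rw [hE]

end Concrete

/-- For the alternating groups: `A_2(A_n)` is simply connected for
`n = 4` and for all `n ≥ 8`; `π₁(A_2(A_6))` is free of rank 16; `π₁(A_2(A_7))` is free
of rank 176; and every connected component of the realization of `K(A_2(A_5))` is
simply connected. -/
theorem stmt16 :
    (∀ n : ℕ, n = 4 ∨ 8 ≤ n →
      SimplyConnectedSpace ↥(geomRealOn (apSet 2 ↥(alternatingGroup (Fin n))))) ∧
    (∀ x : ↥(geomRealOn (apSet 2 ↥(alternatingGroup (Fin 6)))),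
      Nonempty (FundamentalGroup ↥(geomRealOn (apSet 2 ↥(alternatingGroup (Fin 6)))) x ≃*
        FreeGroup (Fin 16))) ∧
    (∀ x : ↥(geomRealOn (apSet 2 ↥(alternatingGroup (Fin 7)))),
      Nonempty (FundamentalGroup ↥(geomRealOn (apSet 2 ↥(alternatingGroup (Fin 7)))) x ≃*
        FreeGroup (Fin 176))) ∧
    (∀ x : ↥(geomRealOn (apSet 2 ↥(alternatingGroup (Fin 5)))),
      SimplyConnectedSpace ↥(connectedComponent x)) := by
  refine ⟨?_, fundamentalGroup_six, fundamentalGroup_seven, fun x => ?_⟩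
  · rintro n (rfl | hn)
    · obtain ⟨x, hx⟩ := involutions_alternatingGroup_nonempty (α := Fin 4) (by simp)
      exact simplyConnectedSpace_apSet_of_commute ⟨x, hx⟩ commute_alternatingGroup_four
    · exact simplyConnectedSpace_alternatingGroup hn
  · exact simplyConnectedSpace_connectedComponent_apSet
      (isCommutingList_five.commute (by simp) (by decide +kernel)) x
end

section
/- Let p be a prime and P a nontrivial finite p-group that is not elementary abelian. Then the order complex of the poset of nontrivial proper subgroups of P (ordered by inclusion) is contractible. -/
open Function

/-- The part of the weight `f x` that has been moved at time `t` when the mass of `f` is moved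
at unit speed, beginning with the largest elements of its support. -/
noncomputable def movedMass {X : Type*} [Fintype X] [Preorder X] (t : ℝ) (f : X → ℝ) (x : X) : ℝ :=
  open Classical in min (f x) (max 0 (t - ∑ y with x < y, f y))

/-- The pushforward of a weight function along a self-map. -/
noncomputable def pushWeight {X : Type*} [Fintype X] (r : X → X) (f : X → ℝ) (x : X) : ℝ :=
  open Classical in ∑ y with r y = x, f y

lemma add_sum_le_sum_of_subset {X : Type*} {f : X → ℝ} (hf : ∀ x, 0 ≤ f x) {x : X} {s t : Finset X}
    (hx : x ∈ t) (hxs : x ∉ s) (hst : s ⊆ t) : f x + ∑ y ∈ s, f y ≤ ∑ y ∈ t, f y := by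
  classical
  rw [← Finset.sum_insert hxs]
  exact Finset.sum_le_sum_of_subset_of_nonneg (Finset.insert_subset hx hst) fun y _ _ => hf y

section Weights

variable {X : Type*} [Fintype X]

lemma sum_pushWeight (r : X → X) (f : X → ℝ) : ∑ x, pushWeight r f x = ∑ x, f x := by
  classical
  unfold pushWeight
  convert Finset.sum_fiberwise Finset.univ r f

lemma pushWeight_nonneg (r : X → X) {f : X → ℝ} (hf : ∀ x, 0 ≤ f x) (x : X) :
    0 ≤ pushWeight r f x :=
  Finset.sum_nonneg fun y _ => hf y

lemma exists_of_pushWeight_ne_zero {r : X → X} {f : X → ℝ} {x : X} (h : pushWeight r f x ≠ 0) :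
    ∃ y, r y = x ∧ f y ≠ 0 := by
  classical
  obtain ⟨y, hy, hfy⟩ := Finset.exists_ne_zero_of_sum_ne_zero h
  exact ⟨y, by simpa using hy, hfy⟩

lemma continuous_pushWeight (r : X → X) : Continuous (pushWeight r) := by
  unfold pushWeight
  fun_prop

lemma mem_geomRealOn_iff [Preorder X] {S : Set X} {f : X → ℝ} :
    f ∈ geomRealOn S ↔ (∀ x, 0 ≤ f x) ∧ support f ⊆ S ∧ IsChain (· ≤ ·) (support f) ∧
      ∑ x, f x = 1 := by
  have key (s : Finset X) (hs : support f ⊆ ↑s) : ∑ x ∈ s, f x = ∑ x, f x :=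
    Finset.sum_subset (Finset.subset_univ s) fun x _ hx =>
      by_contra fun h => hx (hs h)
  constructor
  · rintro ⟨h0, hS, hc, s, hs, h1⟩
    exact ⟨h0, hS, hc, key s hs ▸ h1⟩
  · rintro ⟨h0, hS, hc, h1⟩
    exact ⟨h0, hS, hc, Finset.univ, by simp, h1⟩

variable [Preorder X]

lemma continuous_movedMass : Continuous fun q : ℝ × (X → ℝ) => movedMass q.1 q.2 := by
  unfold movedMass
  fun_prop

lemma movedMass_le (t : ℝ) (f : X → ℝ) (x : X) : movedMass t f x ≤ f x := min_le_left _ _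

lemma movedMass_nonneg (t : ℝ) {f : X → ℝ} (hf : ∀ x, 0 ≤ f x) (x : X) : 0 ≤ movedMass t f x :=
  le_min (hf x) (le_max_left _ _)

lemma movedMass_zero {f : X → ℝ} (hf : ∀ x, 0 ≤ f x) : movedMass 0 f = 0 := by
  classical
  funext x
  have h : 0 ≤ ∑ y with x < y, f y := Finset.sum_nonneg fun y _ => hf y
  unfold movedMass
  rw [max_eq_left (by convert (by linarith : 0 - ∑ y with x < y, f y ≤ 0)), min_eq_right (hf x)]
  rfl

lemma movedMass_one {f : X → ℝ} (hf : ∀ x, 0 ≤ f x) (h1 : ∑ x, f x = 1) : movedMass 1 f = f := by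
  classical
  funext x
  have h := add_sum_le_sum_of_subset hf (x := x) (s := {y | x < y}) (Finset.mem_univ x) (by simp)
    (Finset.subset_univ _)
  unfold movedMass
  refine min_eq_left (le_max_of_le_right ?_)
  convert (by linarith : f x ≤ 1 - ∑ y with x < y, f y)

/-- If some mass has been moved at `x`, then all of the mass has been moved at each `y > x`. -/
lemma movedMass_eq_of_lt {t : ℝ} {f : X → ℝ} (hf : ∀ x, 0 ≤ f x) {x y : X} (hxy : x < y)
    (hx : movedMass t f x ≠ 0) : movedMass t f y = f y := by
  classical
  have h := add_sum_le_sum_of_subset hf (x := y) (s := {z | y < z}) (t := {z | x < z}) (by simpa)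
    (by simp) fun z hz => by simp only [Finset.mem_filter_univ] at hz ⊢; exact hxy.trans hz
  have ht : 0 < t - ∑ z with x < z, f z := by
    by_contra! hn
    refine hx ?_
    unfold movedMass
    rw [max_eq_left (by convert hn), min_eq_right (hf x)]
  unfold movedMass
  refine min_eq_left (le_max_of_le_right ?_)
  convert (by linarith : f y ≤ t - ∑ z with y < z, f z)

end Weights

section Homotopy

variable {X : Type*} [Fintype X] [PartialOrder X] {S : Set X} {r : X → X}

lemma pushWeight_mem_geomRealOn (hr : MonotoneOn r S) (hrS : Set.MapsTo r S S) {f : X → ℝ}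
    (hf : f ∈ geomRealOn S) : pushWeight r f ∈ geomRealOn S := by
  rw [mem_geomRealOn_iff] at hf ⊢
  obtain ⟨h0, hS, hc, h1⟩ := hf
  refine ⟨pushWeight_nonneg r h0, fun x hx => ?_, fun x hx y hy _ => ?_,
    (sum_pushWeight r f).trans h1⟩
  · obtain ⟨y, rfl, hy⟩ := exists_of_pushWeight_ne_zero hx
    exact hrS (hS hy)
  · obtain ⟨a, rfl, ha⟩ := exists_of_pushWeight_ne_zero hx
    obtain ⟨b, rfl, hb⟩ := exists_of_pushWeight_ne_zero hy
    exact (hc.total ha hb).imp (hr (hS ha) (hS hb)) (hr (hS hb) (hS ha))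

lemma sub_movedMass_add_pushWeight_mem_geomRealOn (hr : MonotoneOn r S) (hrS : Set.MapsTo r S S)
    (hle : ∀ x ∈ S, x ≤ r x) (t : ℝ) {f : X → ℝ} (hf : f ∈ geomRealOn S) :
    f - movedMass t f + pushWeight r (movedMass t f) ∈ geomRealOn S := by
  rw [mem_geomRealOn_iff] at hf ⊢
  obtain ⟨h0, hS, hc, h1⟩ := hf
  have hmf {x : X} (hx : movedMass t f x ≠ 0) : f x ≠ 0 := fun h =>
    hx (le_antisymm (h ▸ movedMass_le t f x) (movedMass_nonneg t h0 x))
  have hsupp {x : X} (hx : x ∈ support (f - movedMass t f + pushWeight r (movedMass t f))) :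
      (f x ≠ 0 ∧ movedMass t f x ≠ f x) ∨ ∃ y, r y = x ∧ movedMass t f y ≠ 0 := by
    by_cases hm : movedMass t f x = f x
    · right
      refine exists_of_pushWeight_ne_zero fun h => hx ?_
      simp [hm, h]
    · refine Or.inl ⟨fun hfx => hm ?_, hm⟩
      by_contra h
      exact hmf (fun h' => h (h'.trans hfx.symm)) hfx
  have hcomp {x y : X} (hx : f x ≠ 0 ∧ movedMass t f x ≠ f x) (hy : movedMass t f y ≠ 0) :
      x ≤ r y := by
    have hxy : x ≤ y := by
      refine (hc.total hx.1 (hmf hy)).elim id fun hyx => ?_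
      rcases hyx.eq_or_lt with rfl | hlt
      · exact le_rfl
      · exact absurd (movedMass_eq_of_lt h0 hlt hy) hx.2
    exact hxy.trans (hle y (hS (hmf hy)))
  refine ⟨fun x => ?_, fun x hx => ?_, fun x hx y hy _ => ?_, ?_⟩
  · exact add_nonneg (sub_nonneg.2 (movedMass_le t f x))
      (pushWeight_nonneg r (movedMass_nonneg t h0) x)
  · rcases hsupp hx with h | ⟨y, rfl, h⟩
    · exact hS h.1
    · exact hrS (hS (hmf h))
  · rcases hsupp hx with h | ⟨a, rfl, h⟩ <;> rcases hsupp hy with h' | ⟨b, rfl, h'⟩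
    · exact hc.total h.1 h'.1
    · exact Or.inl (hcomp h h')
    · exact Or.inr (hcomp h' h)
    · have ha := hS (hmf h)
      have hb := hS (hmf h')
      exact (hc.total (hmf h) (hmf h')).imp (hr ha hb) (hr hb ha)
  · simp only [Pi.add_apply, Pi.sub_apply, Finset.sum_add_distrib, Finset.sum_sub_distrib,
      sum_pushWeight, h1]
    ring

lemma convexComb_single_mem_geomRealOn [DecidableEq X] {f : X → ℝ} (hf : f ∈ geomRealOn S) {a : X}
    (ha : a ∈ S) (haf : ∀ x ∈ support f, a ≤ x) {t : ℝ} (ht0 : 0 ≤ t) (ht1 : t ≤ 1) :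
    (1 - t) • f + t • Pi.single a 1 ∈ geomRealOn S := by
  rw [mem_geomRealOn_iff] at hf ⊢
  obtain ⟨h0, hS, hc, h1⟩ := hf
  have hsub : support ((1 - t) • f + t • (Pi.single a 1 : X → ℝ)) ⊆ insert a (support f) := by
    intro x hx
    by_contra! h
    simp only [Set.mem_insert_iff, mem_support, not_or, not_not] at h
    exact hx (by simp [h.1, h.2])
  refine ⟨fun x => ?_, hsub.trans (Set.insert_subset ha hS),
    (hc.insert fun x hx _ => Or.inl (haf x hx)).mono hsub, ?_⟩
  · have hs : (0 : ℝ) ≤ (Pi.single a 1 : X → ℝ) x := by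
      by_cases h : x = a <;> simp [h]
    exact add_nonneg (mul_nonneg (sub_nonneg.2 ht1) (h0 x)) (mul_nonneg ht0 hs)
  · simp [Finset.sum_add_distrib, ← Finset.mul_sum, h1]

/-- Quillen's conical contraction: if `x ≤ r x ≥ a` for a monotone self-map `r` of `S` and a fixed
`a ∈ S`, then the order complex of `S` is contractible. -/
theorem contractibleSpace_geomRealOn_of_conical (hr : MonotoneOn r S) (hrS : Set.MapsTo r S S)
    (hle : ∀ x ∈ S, x ≤ r x) {a : X} (ha : a ∈ S) (har : ∀ x ∈ S, a ≤ r x) :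
    ContractibleSpace (geomRealOn S) := by
  classical
  have hpush (f : geomRealOn S) : ∀ x ∈ support (pushWeight r f.1), a ≤ x := by
    intro x hx
    obtain ⟨y, rfl, hy⟩ := exists_of_pushWeight_ne_zero hx
    exact har y ((mem_geomRealOn_iff.1 f.2).2.1 hy)
  have hsingle : (Pi.single a 1 : X → ℝ) ∈ geomRealOn S := by
    refine mem_geomRealOn_iff.2 ⟨fun x => ?_, ?_, ?_, by simp⟩
    · by_cases h : x = a <;> simp [h]
    · exact Pi.support_single_subset.trans (by simpa using ha)
    · exact (Set.subsingleton_singleton.anti Pi.support_single_subset).isChain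
  let φ : C(geomRealOn S, geomRealOn S) :=
    ⟨fun f => ⟨pushWeight r f.1, pushWeight_mem_geomRealOn hr hrS f.2⟩,
      ((continuous_pushWeight r).comp continuous_subtype_val).subtype_mk _⟩
  have H₁ : (ContinuousMap.id (geomRealOn S)).Homotopy φ :=
    { toFun := fun q => ⟨_, sub_movedMass_add_pushWeight_mem_geomRealOn hr hrS hle q.1 q.2.2⟩
      continuous_toFun := by
        have hm : Continuous fun q : unitInterval × geomRealOn S =>
            movedMass (q.1 : ℝ) (q.2 : X → ℝ) :=
          continuous_movedMass.comp (by fun_prop :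
            Continuous fun q : unitInterval × geomRealOn S => ((q.1 : ℝ), (q.2 : X → ℝ)))
        exact (((continuous_subtype_val.comp continuous_snd).sub hm).add
          ((continuous_pushWeight r).comp hm)).subtype_mk _
      map_zero_left := fun f => Subtype.ext <| funext fun x => by
        simp [movedMass_zero (mem_geomRealOn_iff.1 f.2).1, pushWeight]
      map_one_left := fun f => Subtype.ext <| by
        have hf := mem_geomRealOn_iff.1 f.2
        simp [movedMass_one hf.1 hf.2.2.2, φ] }
  have H₂ : φ.Homotopy (ContinuousMap.const _ ⟨Pi.single a 1, hsingle⟩) :=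
    { toFun := fun q => ⟨_, convexComb_single_mem_geomRealOn (φ q.2).2 ha (hpush q.2)
        q.1.2.1 q.1.2.2⟩
      continuous_toFun := by
        have hφ : Continuous fun q : unitInterval × geomRealOn S => (φ q.2 : X → ℝ) := by fun_prop
        have ht : Continuous fun q : unitInterval × geomRealOn S => (q.1 : ℝ) := by fun_prop
        exact (((continuous_const.sub ht).smul hφ).add (ht.smul continuous_const)).subtype_mk _
      map_zero_left := fun f => Subtype.ext <| by simp
      map_one_left := fun f => Subtype.ext <| by simp }
  exact (contractible_iff_id_nullhomotopic _).2 ⟨_, ⟨H₁.trans H₂⟩⟩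

end Homotopy

/-- A maximal subgroup of a finite `p`-group is normal with elementary abelian quotient. -/
lemma IsPGroup.normal_and_isElementaryAbelian_quotient_of_isCoatom {p : ℕ} [Fact p.Prime]
    {P : Type*} [Group P] [Finite P] (hP : IsPGroup p P) {M : Subgroup P} (hM : IsCoatom M) :
    ∃ _ : M.Normal, IsElementaryAbelian p (P ⧸ M) := by
  have := hP.isNilpotent
  have hn : M.Normal := Subgroup.NormalizerCondition.normal_of_coatom M
    Group.normalizerCondition_of_isNilpotent hM
  refine ⟨hn, ?_⟩
  have hQ : IsPGroup p (P ⧸ M) := hP.to_quotient M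
  have : Nontrivial (P ⧸ M) := QuotientGroup.nontrivial_iff.2 hM.1
  obtain ⟨n, hn0, hcard⟩ := hQ.nontrivial_iff_card.1 this
  obtain ⟨x, hx⟩ := exists_prime_orderOf_dvd_card' (G := P ⧸ M) p
    (hcard ▸ dvd_pow_self p hn0.ne')
  have hMx : M ≤ (Subgroup.zpowers x).comap (QuotientGroup.mk' M) := fun m hm => by
    simp [Subgroup.mem_comap, (QuotientGroup.eq_one_iff m).2 hm, one_mem]
  have htop : Subgroup.zpowers x = ⊤ := by
    rcases hMx.eq_or_lt with h | h
    · exfalso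
      obtain ⟨g, rfl⟩ := QuotientGroup.mk_surjective x
      have hg : g ∈ M := by
        rw [h]
        exact Subgroup.mem_zpowers _
      rw [(QuotientGroup.eq_one_iff g).2 hg, orderOf_one] at hx
      exact (Fact.out : p.Prime).one_lt.ne hx
    · have h' := hM.2 _ h
      rwa [← Subgroup.comap_top (QuotientGroup.mk' M),
        (Subgroup.comap_injective (QuotientGroup.mk'_surjective M)).eq_iff] at h'
  have hcardp : Nat.card (P ⧸ M) = p := by
    rw [← hx, ← Nat.card_zpowers, htop, Subgroup.card_top]
  have : IsCyclic (P ⧸ M) := isCyclic_of_prime_card hcardp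
  exact ⟨IsCyclic.commGroup.mul_comm, fun a => hcardp ▸ pow_card_eq_one'⟩

/-- A finite `p`-group that is not elementary abelian has nontrivial Frattini subgroup. -/
lemma IsPGroup.exists_ne_one_mem_coatoms {p : ℕ} [Fact p.Prime] {P : Type*} [Group P] [Finite P]
    (hP : IsPGroup p P) (hnea : ¬ IsElementaryAbelian p P) :
    ∃ z : P, z ≠ 1 ∧ ∀ M : Subgroup P, IsCoatom M → z ∈ M := by
  unfold IsElementaryAbelian at hnea
  rw [not_and_or] at hnea
  push Not at hnea
  rcases hnea with ⟨a, b, hab⟩ | ⟨a, ha⟩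
  · refine ⟨(b * a)⁻¹ * (a * b), fun h => hab (inv_mul_eq_one.1 h).symm, fun M hM => ?_⟩
    obtain ⟨hn, hc, -⟩ := hP.normal_and_isElementaryAbelian_quotient_of_isCoatom hM
    exact QuotientGroup.eq.1 (hc b a)
  · refine ⟨a ^ p, ha, fun M hM => ?_⟩
    obtain ⟨hn, -, hpow⟩ := hP.normal_and_isElementaryAbelian_quotient_of_isCoatom hM
    exact (QuotientGroup.eq_one_iff _).1 (hpow a)

/-- Let `p` be a prime and `P` a nontrivial finite `p`-group which is
not elementary abelian. Then the geometric realization of the order complex of the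
poset of nontrivial proper subgroups of `P` is contractible. -/
theorem stmt19 (p : ℕ) (hp : p.Prime) (P : Type) [Group P] [Finite P] [Nontrivial P]
    (hP : IsPGroup p P) (hnea : ¬ IsElementaryAbelian p P) :
    ContractibleSpace ↥(geomRealOn {H : Subgroup P | H ≠ ⊥ ∧ H ≠ ⊤}) := by
  have : Fact p.Prime := ⟨hp⟩
  have := Fintype.ofFinite (Subgroup P)
  obtain ⟨z, hz1, hz⟩ := hP.exists_ne_one_mem_coatoms hnea
  have hproper {H : Subgroup P} (hH : H ≠ ⊤) : H ⊔ Subgroup.zpowers z ≠ ⊤ := by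
    obtain ⟨M, hM, hHM⟩ := (eq_top_or_exists_le_coatom H).resolve_left hH
    exact fun h => hM.1 (top_le_iff.1 (h ▸ sup_le hHM (Subgroup.zpowers_le.2 (hz M hM))))
  refine contractibleSpace_geomRealOn_of_conical (r := fun H => H ⊔ Subgroup.zpowers z)
    (fun H _ K _ hHK => sup_le_sup_right hHK _)
    (fun H hH => ⟨fun h => hH.1 (sup_eq_bot_iff.1 h).1, hproper hH.2⟩)
    (fun H _ => le_sup_left) (a := Subgroup.zpowers z)
    ⟨fun h => hz1 (Subgroup.zpowers_eq_bot.1 h), ?_⟩ (fun H _ => le_sup_right)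
  simpa using hproper (bot_ne_top (α := Subgroup P))
end
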